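/- There exists a universal constant C > 0 with the following property: for every n ≥ 1 and every pair of independent random vectors X and Y in ℝⁿ with log-concave densities f and g satisfying ‖f‖_∞ ≥ 1 and ‖g‖_∞ ≥ 1, there exist affine volume-preserving maps u₁, u₂ : ℝⁿ → ℝⁿ such that N(u₁(X) + u₂(Y)) ≤ C, where u₁(X) and u₂(Y) are taken independent. -/

import Mathlib

open MeasureTheory ProbabilityTheory Real Pointwise

/-- A nonnegative function on ℝⁿ is log-concave if
`f(tx + (1-t)y) ≥ f(x)^t f(y)^(1-t)` for all `x, y` and `t ∈ [0,1]`. -/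
def IsLogConcave {n : ℕ} (f : EuclideanSpace ℝ (Fin n) → ℝ) : Prop :=
  (∀ x, 0 ≤ f x) ∧
  ∀ x y : EuclideanSpace ℝ (Fin n), ∀ t : ℝ, 0 ≤ t → t ≤ 1 →
    f x ^ t * f y ^ (1 - t) ≤ f (t • x + (1 - t) • y)

/-- Differential (Shannon) entropy of a measure on ℝⁿ,
computed from its density w.r.t. Lebesgue measure: `h(μ) = -∫ p log p`. -/
noncomputable def dEnt {n : ℕ} (μ : Measure (EuclideanSpace ℝ (Fin n))) : ℝ :=
  -∫ x, ((μ.rnDeriv volume x).toReal) * Real.log ((μ.rnDeriv volume x).toReal)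

/-- Entropy power `N(μ) = exp(2 h(μ) / n)`. -/
noncomputable def entPow {n : ℕ} (μ : Measure (EuclideanSpace ℝ (Fin n))) : ℝ :=
  Real.exp (2 * dEnt μ / n)

/-- Euclidean space. -/
abbrev EE (n : ℕ) : Type := EuclideanSpace ℝ (Fin n)

/-- A monotone, Lipschitz, odd, differentiable vector field. -/
structure NiceField {n : ℕ} (m M : ℝ) (G : EE n → EE n) (G' : EE n → EE n →L[ℝ] EE n) : Prop where
  hm : 0 < m
  hM : 0 < M
  mono : ∀ x z, m * ‖x - z‖ ^ 2 ≤ inner ℝ (G x - G z) (x - z)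
  lip : ∀ x z, ‖G x - G z‖ ≤ M * ‖x - z‖
  odd : ∀ x, G (-x) = - G x
  deriv : ∀ x, HasFDerivAt G (G' x) x

/-- The doubling map. -/
noncomputable def psiMap {n : ℕ} (G : EE n → EE n) (a b : ℝ) (p : EE n × EE n) : EE n × EE n :=
  (a • p.1 + b • p.2, a • G p.1 - b • G p.2)

/-- The derivative of `psiMap G 1 1`. -/
noncomputable def psiDer {n : ℕ} (G' : EE n → EE n →L[ℝ] EE n) (p : EE n × EE n) :
    EE n × EE n →L[ℝ] EE n × EE n :=
  (ContinuousLinearMap.fst ℝ (EE n) (EE n) + ContinuousLinearMap.snd ℝ (EE n) (EE n)).prod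
    ((G' p.1).comp (ContinuousLinearMap.fst ℝ (EE n) (EE n)) -
      (G' p.2).comp (ContinuousLinearMap.snd ℝ (EE n) (EE n)))

/-- Diagonal scaling. -/
noncomputable def diagMap (n : ℕ) (a b : ℝ) : EE n × EE n →L[ℝ] EE n × EE n :=
  (a • ContinuousLinearMap.id ℝ (EE n)).prodMap (b • ContinuousLinearMap.id ℝ (EE n))

lemma diagMap_det (n : ℕ) (a b : ℝ) : (diagMap n a b).det = a ^ n * b ^ n := by
  have h : ((diagMap n a b : EE n × EE n →L[ℝ] EE n × EE n) : EE n × EE n →ₗ[ℝ] EE n × EE n)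
      = LinearMap.prodMap (a • LinearMap.id) (b • LinearMap.id) := by
    ext x <;> simp [diagMap]
  unfold ContinuousLinearMap.det
  rw [h, LinearMap.det_prodMap, LinearMap.det_smul, LinearMap.det_smul]
  simp

lemma psiMap_hasFDerivAt {n : ℕ} {G : EE n → EE n} {G' : EE n → EE n →L[ℝ] EE n}
    (hd : ∀ x, HasFDerivAt G (G' x) x) (a b : ℝ) (p : EE n × EE n) :
    HasFDerivAt (psiMap G a b) ((psiDer G' p).comp (diagMap n a b)) p := by
  have h1 : HasFDerivAt (fun p : EE n × EE n => G p.1)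
      ((G' p.1).comp (ContinuousLinearMap.fst ℝ (EE n) (EE n))) p :=
    (hd p.1).comp p hasFDerivAt_fst
  have h2 : HasFDerivAt (fun p : EE n × EE n => G p.2)
      ((G' p.2).comp (ContinuousLinearMap.snd ℝ (EE n) (EE n))) p :=
    (hd p.2).comp p hasFDerivAt_snd
  have h3 := ((hasFDerivAt_fst (𝕜 := ℝ) (p := p)).const_smul a).add
    ((hasFDerivAt_snd (𝕜 := ℝ) (p := p)).const_smul b)
  have h4 := (h1.const_smul a).sub (h2.const_smul b)
  have h5 := h3.prodMk h4
  have e : (psiDer G' p).comp (diagMap n a b) =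
      (a • ContinuousLinearMap.fst ℝ (EE n) (EE n) + b • ContinuousLinearMap.snd ℝ (EE n) (EE n)).prod
      (a • (G' p.1).comp (ContinuousLinearMap.fst ℝ (EE n) (EE n)) -
      b • (G' p.2).comp (ContinuousLinearMap.snd ℝ (EE n) (EE n))) := by
    ext x <;> simp [psiDer, diagMap]
  rw [e]
  exact h5

lemma psiMap_injective {n : ℕ} {G : EE n → EE n}
    (hmono : ∀ x z, x ≠ z → 0 < inner ℝ (G x - G z) (x - z))
    {a b : ℝ} (ha : 0 < a) (hb : 0 < b) :
    Function.Injective (psiMap G a b) := by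
  rintro ⟨x, x'⟩ ⟨z, z'⟩ h
  simp only [psiMap, Prod.mk.injEq] at h
  obtain ⟨h1, h2⟩ := h
  have e1 : a • (x - z) = - (b • (x' - z')) := by
    have : a • x - a • z = b • z' - b • x' := by
      rw [sub_eq_sub_iff_add_eq_add, h1]; abel
    rw [smul_sub, smul_sub, this]; abel
  have e2 : a • (G x - G z) = b • (G x' - G z') := by
    have : a • G x - a • G z = b • G x' - b • G z' := by
      have := sub_eq_sub_iff_add_eq_add.1 h2
      rw [sub_eq_sub_iff_add_eq_add, this]; abel
    rw [smul_sub, smul_sub, this]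
  have e3 : a * (a * inner ℝ (G x - G z) (x - z)) = - (b * (b * inner ℝ (G x' - G z') (x' - z'))) := by
    have : inner ℝ (a • (G x - G z)) (a • (x - z)) = inner ℝ (b • (G x' - G z')) (-(b • (x' - z'))) := by
      rw [e1, e2]
    simpa [inner_smul_left, inner_smul_right, -inner_self_eq_norm_sq_to_K] using this
  have hnn : ∀ x z, 0 ≤ inner ℝ (G x - G z) (x - z) := by
    intro x z
    by_cases hxz : x = z
    · simp [hxz]
    · exact (hmono x z hxz).le
  have hxz : x = z := by
    by_contra hne
    have h3 := hmono x z hne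
    have h4 := hnn x' z'
    have : 0 < a * (a * inner ℝ (G x - G z) (x - z)) := by positivity
    have : 0 ≤ (b * (b * inner ℝ (G x' - G z') (x' - z'))) := by positivity
    linarith
  have hxz' : x' = z' := by
    subst hxz
    have : b • (x' - z') = 0 := by simpa using e1.symm
    rcases smul_eq_zero.1 this with h | h
    · exact absurd h hb.ne'
    · exact sub_eq_zero.1 h
  rw [hxz, hxz']

/-- A strongly monotone Lipschitz map is surjective. -/
lemma strongMono_surjective {n : ℕ} {B : EE n → EE n} {m M : ℝ} (hm : 0 < m) (hM : 0 < M)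
    (mono : ∀ x z, m * ‖x - z‖ ^ 2 ≤ inner ℝ (B x - B z) (x - z))
    (lip : ∀ x z, ‖B x - B z‖ ≤ M * ‖x - z‖) : Function.Surjective B := by
  intro b
  set r : ℝ := m / (M ^ 2 + m ^ 2) with hr
  have hr0 : 0 < r := by positivity
  set K : ℝ := Real.sqrt (1 - r * m) with hK
  have hrm : r * m < 1 := by
    rw [hr, div_mul_eq_mul_div, div_lt_one (by positivity)]; nlinarith
  have hrM : r * M ^ 2 ≤ m := by
    rw [hr, div_mul_eq_mul_div, div_le_iff₀ (by positivity)]; nlinarith [sq_nonneg m]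
  have hKlt : K < 1 := by
    rw [hK, Real.sqrt_lt' one_pos]; nlinarith [mul_pos hr0 hm]
  have hc : ContractingWith (Real.toNNReal K) (fun x => x - r • (B x - b)) := by
    refine ⟨by simpa using hKlt, LipschitzWith.of_dist_le_mul fun x z => ?_⟩
    rw [dist_eq_norm, dist_eq_norm, Real.coe_toNNReal _ (Real.sqrt_nonneg _)]
    have e : x - r • (B x - b) - (z - r • (B z - b)) = (x - z) - r • (B x - B z) := by
      simp only [smul_sub]; abel
    rw [e]
    refine abs_le_of_sq_le_sq' ?_ (by positivity) |>.2
    rw [mul_pow, Real.sq_sqrt (by linarith), @norm_sub_sq ℝ]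
    rw [inner_smul_right, norm_smul, real_inner_comm]
    have h1 := mono x z
    have h2 := lip x z
    have h3 : ‖B x - B z‖ ^ 2 ≤ M ^ 2 * ‖x - z‖ ^ 2 := by
      rw [← mul_pow]; exact pow_le_pow_left₀ (norm_nonneg _) h2 2
    simp only [Real.norm_eq_abs, mul_pow, sq_abs, RCLike.re_to_real]
    have h4 : r ^ 2 * ‖B x - B z‖ ^ 2 ≤ r * m * ‖x - z‖ ^ 2 := by
      calc r ^ 2 * ‖B x - B z‖ ^ 2 ≤ r ^ 2 * (M ^ 2 * ‖x - z‖ ^ 2) := by gcongr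
        _ = r * (r * M ^ 2) * ‖x - z‖ ^ 2 := by ring
        _ ≤ r * m * ‖x - z‖ ^ 2 := by gcongr
    have h5 := mul_le_mul_of_nonneg_left h1 hr0.le
    nlinarith
  have := hc.fixedPoint_isFixedPt
  refine ⟨ContractingWith.fixedPoint _ hc, ?_⟩
  have h2 : r • (B (ContractingWith.fixedPoint _ hc) - b) = 0 := by
    have := this.eq
    simpa [sub_eq_self] using this
  rcases smul_eq_zero.1 h2 with h | h
  · exact absurd h hr0.ne'
  · exact sub_eq_zero.1 h

lemma psiMap_surjective {n : ℕ} {G : EE n → EE n} {G' : EE n → EE n →L[ℝ] EE n} {m M : ℝ}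
    (h : NiceField m M G G') {a b : ℝ} (ha : 0 < a) (hb : 0 < b) :
    Function.Surjective (psiMap G a b) := by
  rintro ⟨c, d⟩
  have hs : Function.Surjective (fun x => a • G x - b • G (b⁻¹ • (c - a • x))) := by
    have key : ∀ x z : EE n, b⁻¹ • (c - a • x) - b⁻¹ • (c - a • z) = - ((b⁻¹ * a) • (x - z)) := by
      intro x z
      rw [← smul_sub, mul_smul, ← smul_neg]; congr 1; simp only [smul_sub]; abel
    have key2 : ∀ x z : EE n, (x - z) = - ((b / a) • (b⁻¹ • (c - a • x) - b⁻¹ • (c - a • z))) := by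
      intro x z
      rw [key, smul_neg, neg_neg, smul_smul]
      have : b / a * (b⁻¹ * a) = 1 := by field_simp
      rw [this, one_smul]
    refine strongMono_surjective (m := a * m) (M := a * M + b * (M * (b⁻¹ * a))) (by have := h.hm; positivity)
      (by have := h.hM; positivity) ?_ ?_
    · intro x z
      set x' := b⁻¹ • (c - a • x) with hx'
      set z' := b⁻¹ • (c - a • z) with hz'
      have e : a • G x - b • G x' - (a • G z - b • G z') = a • (G x - G z) - b • (G x' - G z') := by
        simp only [smul_sub]; abel
      simp only [e]
      rw [inner_sub_left, inner_smul_left, inner_smul_left]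
      have h1 := h.mono x z
      have h2 : inner ℝ (G x' - G z') (x - z) ≤ 0 := by
        rw [key2 x z, ← hx', ← hz', inner_neg_right, inner_smul_right]
        have := h.mono x' z'
        have h3 : 0 ≤ inner ℝ (G x' - G z') (x' - z') := le_trans (by have := h.hm; positivity) this
        have : 0 ≤ b / a * inner ℝ (G x' - G z') (x' - z') := by positivity
        linarith
      simp only [conj_trivial]
      nlinarith
    · intro x z
      set x' := b⁻¹ • (c - a • x) with hx'
      set z' := b⁻¹ • (c - a • z) with hz'
      have e : a • G x - b • G x' - (a • G z - b • G z') = a • (G x - G z) - b • (G x' - G z') := by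
        simp only [smul_sub]; abel
      simp only [e]
      have h1 := h.lip x z
      have h2 := h.lip x' z'
      have h3 : ‖x' - z'‖ = b⁻¹ * a * ‖x - z‖ := by
        rw [hx', hz', key, norm_neg, norm_smul, Real.norm_eq_abs, abs_of_pos (by positivity)]
      rw [h3] at h2
      calc ‖a • (G x - G z) - b • (G x' - G z')‖ ≤ ‖a • (G x - G z)‖ + ‖b • (G x' - G z')‖ := norm_sub_le _ _
        _ = a * ‖G x - G z‖ + b * ‖G x' - G z'‖ := by
          rw [norm_smul, norm_smul, Real.norm_eq_abs, Real.norm_eq_abs, abs_of_pos ha, abs_of_pos hb]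
        _ ≤ a * (M * ‖x - z‖) + b * (M * (b⁻¹ * a * ‖x - z‖)) := by gcongr
        _ = _ := by ring
  obtain ⟨x, hx⟩ := hs d
  refine ⟨(x, b⁻¹ • (c - a • x)), ?_⟩
  simp only [psiMap, Prod.mk.injEq]
  refine ⟨?_, hx⟩
  rw [smul_smul, mul_inv_cancel₀ hb.ne', one_smul]; abel

lemma NiceField.strict {n : ℕ} {G : EE n → EE n} {G' : EE n → EE n →L[ℝ] EE n} {m M : ℝ}
    (h : NiceField m M G G') : ∀ x z, x ≠ z → 0 < inner ℝ (G x - G z) (x - z) := by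
  intro x z hxz
  have h1 : 0 < ‖x - z‖ := norm_pos_iff.2 (sub_ne_zero.2 hxz)
  have := h.hm
  exact lt_of_lt_of_le (by positivity) (h.mono x z)

/-- Change of variables. -/
lemma psi_change {n : ℕ} {G : EE n → EE n} {G' : EE n → EE n →L[ℝ] EE n} {m M : ℝ}
    (h : NiceField m M G G') {a b : ℝ} (ha : 0 < a) (hab : a * b = 1) (F : EE n × EE n → ℂ) :
    ∫ p, (|(psiDer G' p).det| : ℝ) • F (psiMap G a b p) = ∫ p, F p := by
  have hb : 0 < b := by
    by_contra hb
    nlinarith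
  haveI : (volume : Measure (EE n × EE n)).IsAddHaarMeasure :=
    inferInstanceAs ((volume : Measure (EE n)).prod (volume : Measure (EE n))).IsAddHaarMeasure
  have := integral_image_eq_integral_abs_det_fderiv_smul (volume : Measure (EE n × EE n))
    (s := Set.univ) (f := psiMap G a b) (f' := fun p => (psiDer G' p).comp (diagMap n a b))
    MeasurableSet.univ (fun p _ => (psiMap_hasFDerivAt h.deriv a b p).hasFDerivWithinAt)
    (psiMap_injective h.strict ha hb).injOn F
  rw [Set.image_univ, (psiMap_surjective h ha hb).range_eq] at this
  simp only [Measure.restrict_univ] at this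
  rw [this]
  congr 1
  ext p
  congr 2
  have : ((psiDer G' p).comp (diagMap n a b)).det = (psiDer G' p).det * (diagMap n a b).det := by
    simp [ContinuousLinearMap.det]
  rw [this, diagMap_det, ← mul_pow, hab, one_pow, mul_one]

section Analytic
variable {X : Type*} [MeasurableSpace X] {μ : Measure X}

/-- The phase. -/
noncomputable def phaseQ (P P' R : X → ℂ) (q : ℂ) (p : X) : ℂ := q * P p + q⁻¹ * P' p + R p

lemma phase_perturb {P P' R : X → ℂ} {N : X → ℝ} {K c : ℝ} (hK : 0 ≤ K) (hc : 0 < c)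
    (hN : ∀ p, 0 ≤ N p)
    (hP : ∀ p, ‖P p‖ ≤ K * N p) (hP' : ∀ p, ‖P' p‖ ≤ K * N p) {q₀ : ℂ} (hq₀ : q₀ ≠ 0)
    (hre : ∀ p, (phaseQ P P' R q₀ p).re ≤ -c * N p) :
    ∀ᶠ q in nhds q₀, q ≠ 0 ∧ ‖q⁻¹‖ ≤ ‖q₀⁻¹‖ + 1 ∧ ∀ p, (phaseQ P P' R q p).re ≤ -(c/2) * N p := by
  have h1 : Filter.Tendsto (fun q : ℂ => (‖q - q₀‖ + ‖q⁻¹ - q₀⁻¹‖) * K) (nhds q₀) (nhds 0) := by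
    have h2 : ContinuousAt (fun q : ℂ => (‖q - q₀‖ + ‖q⁻¹ - q₀⁻¹‖) * K) q₀ := by
      have : ContinuousAt (fun q : ℂ => q⁻¹) q₀ := continuousAt_inv₀ hq₀
      fun_prop
    simpa [ContinuousAt] using h2
  have h3 : ∀ᶠ q in nhds q₀, ‖q⁻¹‖ < ‖q₀⁻¹‖ + 1 :=
    (continuousAt_inv₀ hq₀).norm.eventually_lt continuousAt_const (by simp)
  filter_upwards [h1.eventually (gt_mem_nhds (half_pos hc)), isOpen_ne.mem_nhds hq₀, h3]
    with q h1 h2 h3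
  refine ⟨h2, h3.le, fun p => ?_⟩
  have e : phaseQ P P' R q p = phaseQ P P' R q₀ p + ((q - q₀) * P p + (q⁻¹ - q₀⁻¹) * P' p) := by
    simp only [phaseQ]; ring
  rw [e, Complex.add_re]
  have h4 : ((q - q₀) * P p + (q⁻¹ - q₀⁻¹) * P' p).re ≤ (‖q - q₀‖ + ‖q⁻¹ - q₀⁻¹‖) * K * N p := by
    refine (Complex.re_le_norm _).trans ((norm_add_le _ _).trans ?_)
    rw [norm_mul, norm_mul]
    have := mul_le_mul_of_nonneg_left (hP p) (norm_nonneg (q - q₀))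
    have := mul_le_mul_of_nonneg_left (hP' p) (norm_nonneg (q⁻¹ - q₀⁻¹))
    linarith
  have h5 := mul_le_mul_of_nonneg_right h1.le (hN p)
  have := hre p
  linarith

lemma phase_hasDeriv {P P' R : X → ℂ} {J : X → ℝ} {N : X → ℝ} {K c D : ℝ} (hK : 0 ≤ K) (hc : 0 < c)
    (hN : ∀ p, 0 ≤ N p) (mP : Measurable P) (mP' : Measurable P') (mR : Measurable R)
    (mJ : Measurable J) (hJ : ∀ p, |J p| ≤ D)
    (hintg : ∀ c : ℝ, 0 < c → Integrable (fun p => Real.exp (-c * N p)) μ)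
    (hP : ∀ p, ‖P p‖ ≤ K * N p) (hP' : ∀ p, ‖P' p‖ ≤ K * N p) {q₀ : ℂ} (hq₀ : q₀ ≠ 0)
    (hre : ∀ p, (phaseQ P P' R q₀ p).re ≤ -c * N p) :
    DifferentiableAt ℂ (fun q => ∫ p, (J p : ℂ) * Complex.exp (phaseQ P P' R q p) ∂μ) q₀ := by
  have hs := phase_perturb hK hc hN hP hP' hq₀ hre
  have mQ : ∀ q, Measurable (phaseQ P P' R q) := fun q => by unfold phaseQ; fun_prop
  have mJ' : Measurable (fun p => (J p : ℂ)) := Complex.measurable_ofReal.comp mJ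
  set B := ‖q₀⁻¹‖ + 1 with hB
  have hB0 : 0 ≤ B := by positivity
  refine (hasDerivAt_integral_of_dominated_loc_of_deriv_le (μ := μ)
    (F' := fun q p => (J p : ℂ) * (Complex.exp (phaseQ P P' R q p) * (P p - (q^2)⁻¹ * P' p)))
    (bound := fun p => D * ((K + B ^ 2 * K) * (4 / c)) * Real.exp (-(c/4) * N p))
    hs ?_ ?_ ?_ ?_ ?_ ?_).2.differentiableAt
  · filter_upwards with q
    exact (mJ'.mul (Complex.measurable_exp.comp (mQ q))).aestronglyMeasurable
  · refine ((hintg c hc).const_mul D).mono' (mJ'.mul (Complex.measurable_exp.comp (mQ q₀))).aestronglyMeasurable ?_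
    filter_upwards with p
    rw [norm_mul, Complex.norm_exp, Complex.norm_real]
    exact mul_le_mul (hJ p) (Real.exp_le_exp.2 (hre p)) (Real.exp_pos _).le ((abs_nonneg _).trans (hJ p))
  · exact (mJ'.mul ((Complex.measurable_exp.comp (mQ q₀)).mul (mP.sub (mP'.const_mul _)))).aestronglyMeasurable
  · filter_upwards with p
    rintro q ⟨hq, hqB, hqre⟩
    rw [norm_mul, norm_mul, Complex.norm_exp, Complex.norm_real]
    have hD : 0 ≤ D := (abs_nonneg _).trans (hJ p)
    have h1 : ‖P p - (q^2)⁻¹ * P' p‖ ≤ (K + B ^ 2 * K) * N p := by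
      refine (norm_sub_le _ _).trans ?_
      rw [norm_mul, ← inv_pow, norm_pow]
      have h2 : ‖q⁻¹‖ ^ 2 * ‖P' p‖ ≤ B ^ 2 * (K * N p) := by
        gcongr
        exact hP' p
      have := hP p
      linarith
    have h2 : N p * Real.exp (-(c/2) * N p) ≤ (4 / c) * Real.exp (-(c/4) * N p) := by
      have e : Real.exp (-(c/2) * N p) = Real.exp (-(c/4) * N p) * Real.exp (-(c/4) * N p) := by
        rw [← Real.exp_add]; ring_nf
      have h3 : (c / 4 * N p) * Real.exp (-(c/4) * N p) ≤ 1 := by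
        have := Real.add_one_le_exp (c / 4 * N p)
        have h4 : Real.exp (c/4 * N p) * Real.exp (-(c/4) * N p) = 1 := by
          rw [← Real.exp_add]; simp
        rw [← h4]
        gcongr
        linarith
      rw [e]
      have h5 : N p * Real.exp (-(c/4) * N p) ≤ 4 / c := by
        rw [le_div_iff₀ hc]; linarith
      calc N p * (Real.exp (-(c/4) * N p) * Real.exp (-(c/4) * N p))
          = (N p * Real.exp (-(c/4) * N p)) * Real.exp (-(c/4) * N p) := by ring
        _ ≤ _ := by gcongr
    calc ‖J p‖ * (Real.exp (phaseQ P P' R q p).re * ‖P p - (q^2)⁻¹ * P' p‖)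
        ≤ D * (Real.exp (-(c/2) * N p) * ((K + B ^ 2 * K) * N p)) := by
          gcongr
          · exact hJ p
          · exact hqre p
      _ = D * ((K + B ^ 2 * K) * (N p * Real.exp (-(c/2) * N p))) := by ring
      _ ≤ D * ((K + B ^ 2 * K) * ((4 / c) * Real.exp (-(c/4) * N p))) := by gcongr
      _ = _ := by ring
  · exact (hintg (c/4) (by positivity)).const_mul _
  · filter_upwards with p
    rintro q ⟨hq, hqB, hqre⟩
    refine HasDerivAt.const_mul _ ?_
    refine HasDerivAt.cexp ?_
    have h1 := ((hasDerivAt_id q).mul_const (P p)).add ((hasDerivAt_inv hq).mul_const (P' p))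
    have h2 := h1.add_const (R p)
    have e : P p - (q^2)⁻¹ * P' p = 1 * P p + -(q ^ 2)⁻¹ * P' p := by ring
    rw [e]
    exact h2

lemma phase_continuation {P P' R : X → ℂ} {J : X → ℝ} {N : X → ℝ} {K c D : ℝ} (hK : 0 ≤ K) (hc : 0 < c)
    (hN : ∀ p, 0 ≤ N p) (mP : Measurable P) (mP' : Measurable P') (mR : Measurable R)
    (mJ : Measurable J) (hJ : ∀ p, |J p| ≤ D)
    (hintg : ∀ c : ℝ, 0 < c → Integrable (fun p => Real.exp (-c * N p)) μ)
    (hP : ∀ p, ‖P p‖ ≤ K * N p) (hP' : ∀ p, ‖P' p‖ ≤ K * N p)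
    (hre : ∀ φ : ℝ, 0 ≤ φ → φ ≤ π / 2 → ∀ p, (phaseQ P P' R (Complex.exp (φ * Complex.I)) p).re ≤ -c * N p)
    (C : ℂ) (hC : ∀ q : ℝ, 0 < q → ∫ p, (J p : ℂ) * Complex.exp (phaseQ P P' R q p) ∂μ = C) :
    ∫ p, (J p : ℂ) * Complex.exp (phaseQ P P' R Complex.I p) ∂μ = C := by
  set Φ := fun q : ℂ => ∫ p, (J p : ℂ) * Complex.exp (phaseQ P P' R q p) ∂μ with hΦ
  set U : Set ℂ := (fun φ : ℝ => Complex.exp (φ * Complex.I)) '' Set.Icc 0 (π / 2) with hU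
  have hpi := Real.pi_pos
  have han : AnalyticOnNhd ℂ Φ U := by
    rintro _ ⟨φ, hφ, rfl⟩
    rw [Complex.analyticAt_iff_eventually_differentiableAt]
    filter_upwards [phase_perturb hK hc hN hP hP' (Complex.exp_ne_zero _) (hre φ hφ.1 hφ.2)] with q hq
    exact phase_hasDeriv hK (half_pos hc) hN mP mP' mR mJ hJ hintg hP hP' hq.1 hq.2.2
  have h1U : (1 : ℂ) ∈ U := ⟨0, ⟨le_rfl, by positivity⟩, by simp⟩
  have hIU : Complex.I ∈ U := ⟨π / 2, ⟨by positivity, le_rfl⟩, by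
    simp [Complex.exp_pi_div_two_mul_I]⟩
  have hpre : IsPreconnected U := isPreconnected_Icc.image _ (by fun_prop)
  have hfreq : ∃ᶠ z in nhdsWithin (1 : ℂ) {1}ᶜ, Φ z = (fun _ => C) z := by
    have ht : Filter.Tendsto (fun k : ℕ => (((1 + 1 / ((k:ℝ) + 1) : ℝ)) : ℂ)) Filter.atTop
        (nhdsWithin (1 : ℂ) {1}ᶜ) := by
      refine tendsto_nhdsWithin_iff.2 ⟨?_, ?_⟩
      · have h1 : Filter.Tendsto (fun k : ℕ => (1 + 1 / ((k:ℝ) + 1) : ℝ)) Filter.atTop (nhds (1 + 0)) :=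
          tendsto_const_nhds.add tendsto_one_div_add_atTop_nhds_zero_nat
        have := (Complex.continuous_ofReal.tendsto (1 + 0 : ℝ)).comp h1
        simpa [Function.comp_def] using this
      · filter_upwards with k
        have h2 : (0:ℝ) < 1 / ((k:ℝ) + 1) := by positivity
        intro h
        have h3 : (((1 + 1 / ((k:ℝ) + 1) : ℝ)) : ℂ) = ((1 : ℝ) : ℂ) := by simpa using h
        have := Complex.ofReal_injective h3
        linarith
    refine ht.frequently (Filter.Eventually.frequently ?_)
    filter_upwards with k
    exact hC _ (by positivity)
  exact han.eqOn_of_preconnected_of_frequently_eq analyticOnNhd_const hpre h1U hfreq hIU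

end Analytic

section A3
variable {n : ℕ}

lemma gauss_int {c : ℝ} (hc : 0 < c) : Integrable (fun x : EE n => Real.exp (-c * ‖x‖ ^ 2)) := by
  have h := (GaussianFourier.integrable_cexp_neg_mul_sq_norm_add (b := (c : ℂ)) (by simpa using hc) 0 (0 : EE n)).norm
  refine h.congr ?_
  filter_upwards with x
  rw [Complex.norm_exp]
  congr 1
  simp [← Complex.ofReal_pow]

lemma gauss_int_prod {c : ℝ} (hc : 0 < c) :
    Integrable (fun p : EE n × EE n => Real.exp (-c * (‖p.1‖ ^ 2 + ‖p.2‖ ^ 2))) := by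
  have := (gauss_int (n := n) hc).mul_prod (gauss_int (n := n) hc)
  refine this.congr ?_
  filter_upwards with p
  rw [← Real.exp_add]; ring_nf

/-- Oscillating test function. -/
noncomputable def oscF (n : ℕ) (ε : ℝ) (p : EE n × EE n) : ℂ :=
  Complex.exp (Complex.I * (inner ℝ p.1 p.2 : ℝ) - (ε / 2 * (‖p.1‖ ^ 2 + ‖p.2‖ ^ 2) : ℝ))

lemma oscF_integral {ε : ℝ} (hε : 0 < ε) :
    ∫ p, oscF n ε p = (((4 * π ^ 2 / (1 + ε ^ 2)) ^ ((n : ℝ) / 2) : ℝ) : ℂ) := by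
  have hintg : Integrable (oscF n ε) := by
    refine (gauss_int_prod (n := n) (half_pos hε)).mono' ?_ ?_
    · unfold oscF
      exact (by fun_prop : Continuous _).aestronglyMeasurable
    · filter_upwards with p
      rw [oscF, Complex.norm_exp]
      simp [-Complex.ofReal_mul, -Complex.ofReal_add, -Complex.ofReal_div, -Complex.ofReal_pow]
  rw [Measure.volume_eq_prod, integral_prod _ hintg]
  have hin : ∀ a : EE n, ∫ b, oscF n ε (a, b) =
      (((2 * π / ε) ^ ((n : ℝ) / 2) * Real.exp (-(ε / 2 + 1 / (2 * ε)) * ‖a‖ ^ 2) : ℝ) : ℂ) := by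
    intro a
    have h := GaussianFourier.integral_cexp_neg_mul_sq_norm_add (b := ((ε / 2 : ℝ) : ℂ))
      (by simpa using hε) Complex.I a
    have e : ∀ b, oscF n ε (a, b) = Complex.exp (-((ε / 2 * ‖a‖ ^ 2 : ℝ) : ℂ)) *
        Complex.exp (-((ε / 2 : ℝ) : ℂ) * ‖b‖ ^ 2 + Complex.I * (inner ℝ a b : ℝ)) := by
      intro b
      rw [oscF, ← Complex.exp_add]
      congr 1
      push_cast; ring
    simp only [e]
    rw [integral_const_mul, h]
    have e1 : ((π : ℂ) / ((ε / 2 : ℝ) : ℂ)) ^ ((Module.finrank ℝ (EE n) : ℂ) / 2) =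
        (((2 * π / ε) ^ ((n : ℝ) / 2) : ℝ) : ℂ) := by
      rw [Complex.ofReal_cpow (by positivity)]
      simp only [finrank_euclideanSpace, Fintype.card_fin]
      congr 1
      · push_cast; field_simp
      · push_cast; rfl
    rw [e1, Complex.ofReal_mul ((2 * π / ε) ^ ((n : ℝ) / 2)), Complex.ofReal_exp]
    have hε' : (ε : ℂ) ≠ 0 := by exact_mod_cast hε.ne'
    have e2 : Complex.exp (-((ε / 2 * ‖a‖ ^ 2 : ℝ) : ℂ)) * Complex.exp (Complex.I ^ 2 * (‖a‖:ℂ) ^ 2 / (4 * ((ε / 2 : ℝ) : ℂ)))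
        = Complex.exp (((-(ε / 2 + 1 / (2 * ε)) * ‖a‖ ^ 2 : ℝ)) : ℂ) := by
      rw [← Complex.exp_add, Complex.I_sq]
      congr 1
      push_cast
      field_simp
      ring
    rw [← e2]; ring
  simp only [hin]
  rw [integral_complex_ofReal, integral_const_mul, GaussianFourier.integral_rexp_neg_mul_sq_norm (by positivity)]
  simp only [finrank_euclideanSpace, Fintype.card_fin]
  rw [← Real.mul_rpow (by positivity) (by positivity)]
  congr 2
  field_simp
  ring

lemma coercive_aux {x x' y y' : EE n} {m M : ℝ} (hm : 0 < m) (hM : 0 < M)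
    (h1 : m * ‖x‖ ^ 2 ≤ inner ℝ x y) (h2 : m * ‖x'‖ ^ 2 ≤ inner ℝ x' y')
    (h4 : ‖y'‖ ≤ M * ‖x'‖) :
    m ^ 2 / (1 + M ^ 2) * (‖x‖ ^ 2 + ‖x'‖ ^ 2) ≤ ‖x + x'‖ ^ 2 + ‖y - y'‖ ^ 2 := by
  have h5 : m * (‖x‖ ^ 2 + ‖x'‖ ^ 2) ≤ ‖y - y'‖ * ‖x‖ + M * ‖x + x'‖ * ‖x'‖ := by
    have e : inner ℝ x y + inner ℝ x' y' = inner ℝ x (y - y') + inner ℝ (x + x') y' := by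
      rw [inner_sub_right, inner_add_left]; ring
    have h6 := real_inner_le_norm x (y - y')
    have h7 := real_inner_le_norm (x + x') y'
    have h8 := mul_le_mul_of_nonneg_left h4 (norm_nonneg (x + x'))
    nlinarith
  set a := ‖y - y'‖
  set b := ‖x + x'‖
  set u := ‖x‖
  set v := ‖x'‖
  rw [div_mul_eq_mul_div, div_le_iff₀ (by positivity)]
  rcases (by positivity : 0 ≤ u ^ 2 + v ^ 2).eq_or_lt with h0 | h0
  · rw [← h0]; simp; positivity
  have h6 : (m * (u ^ 2 + v ^ 2)) ^ 2 ≤ (a * u + M * b * v) ^ 2 := by gcongr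
  have h7 : (a * u + M * b * v) ^ 2 ≤ (b ^ 2 + a ^ 2) * (1 + M ^ 2) * (u ^ 2 + v ^ 2) := by
    have : (b ^ 2 + a ^ 2) * (1 + M ^ 2) * (u ^ 2 + v ^ 2) - (a * u + M * b * v) ^ 2
      = (b * u - a * M * v) ^ 2 + (b ^ 2 + a ^ 2) * (M ^ 2 * u ^ 2 + v ^ 2) := by ring
    have : 0 ≤ (b * u - a * M * v) ^ 2 + (b ^ 2 + a ^ 2) * (M ^ 2 * u ^ 2 + v ^ 2) := by positivity
    linarith
  have h8 : (m ^ 2 * (u ^ 2 + v ^ 2)) * (u ^ 2 + v ^ 2) ≤ ((b ^ 2 + a ^ 2) * (1 + M ^ 2)) * (u ^ 2 + v ^ 2) := by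
    nlinarith
  exact le_of_mul_le_mul_right h8 h0

lemma arc_aux {x x' y y' : EE n} {m M ε : ℝ} (hm : 0 < m) (hM : 0 < M)
    (h1 : m * ‖x‖ ^ 2 ≤ inner ℝ x y) (h2 : m * ‖x'‖ ^ 2 ≤ inner ℝ x' y')
    (h3 : ‖y‖ ≤ M * ‖x‖)
    (h4 : ‖y'‖ ≤ M * ‖x'‖) (hε : ε = m / (1 + M ^ 2)) {φ : ℝ} (hφ : 0 ≤ φ) (hφ' : φ ≤ π / 2) :
    - Real.sin φ * (inner ℝ x y + inner ℝ x' y') -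
      (ε / 2) * (Real.cos φ * (‖x‖ ^ 2 + ‖y‖ ^ 2 + ‖x'‖ ^ 2 + ‖y'‖ ^ 2) +
        2 * (inner ℝ x x' - inner ℝ y y'))
    ≤ - (ε / 2 * (m ^ 2 / (1 + M ^ 2))) * (‖x‖ ^ 2 + ‖x'‖ ^ 2) := by
  have hc := coercive_aux hm hM h1 h2 h4
  have hs0 : 0 ≤ Real.sin φ := Real.sin_nonneg_of_nonneg_of_le_pi hφ (by linarith [Real.pi_pos])
  have hc0 : 0 ≤ Real.cos φ := Real.cos_nonneg_of_neg_pi_div_two_le_of_le (by linarith [Real.pi_pos]) hφ'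
  have hsc : 1 - Real.cos φ ≤ Real.sin φ := by
    nlinarith [Real.sin_sq_add_cos_sq φ, Real.sin_le_one φ, Real.cos_le_one φ]
  have hε0 : 0 < ε := by rw [hε]; positivity
  rw [@norm_add_sq_real, @norm_sub_sq_real] at hc
  have hy : ‖y‖ ^ 2 ≤ M ^ 2 * ‖x‖ ^ 2 := by rw [← mul_pow]; gcongr
  have hy' : ‖y'‖ ^ 2 ≤ M ^ 2 * ‖x'‖ ^ 2 := by rw [← mul_pow]; gcongr
  set W := ‖x‖ ^ 2 + ‖y‖ ^ 2 + ‖x'‖ ^ 2 + ‖y'‖ ^ 2 with hW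
  have hW0 : 0 ≤ W := by positivity
  have hWle : W ≤ (1 + M ^ 2) * (‖x‖ ^ 2 + ‖x'‖ ^ 2) := by rw [hW]; nlinarith
  have h5 : ε / 2 * ((1 - Real.cos φ) * W) ≤ Real.sin φ * (m * (‖x‖ ^ 2 + ‖x'‖ ^ 2)) := by
    calc ε / 2 * ((1 - Real.cos φ) * W) ≤ ε / 2 * (Real.sin φ * ((1 + M ^ 2) * (‖x‖ ^ 2 + ‖x'‖ ^ 2))) := by
          gcongr
      _ = Real.sin φ * (m / 2 * (‖x‖ ^ 2 + ‖x'‖ ^ 2)) := by rw [hε]; field_simp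
      _ ≤ Real.sin φ * (m * (‖x‖ ^ 2 + ‖x'‖ ^ 2)) := by gcongr; linarith
  have h6 : Real.sin φ * (m * (‖x‖ ^ 2 + ‖x'‖ ^ 2)) ≤ Real.sin φ * (inner ℝ x y + inner ℝ x' y') := by
    gcongr; linarith
  have h7 : ε / 2 * (m ^ 2 / (1 + M ^ 2) * (‖x‖ ^ 2 + ‖x'‖ ^ 2)) ≤ ε / 2 * (W + 2 * (inner ℝ x x' - inner ℝ y y')) := by
    gcongr; linarith
  linarith

lemma diagMap_one : diagMap n 1 1 = ContinuousLinearMap.id ℝ (EE n × EE n) := by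
  ext x <;> simp [diagMap]

lemma psiDer_measurable {G : EE n → EE n} {G' : EE n → EE n →L[ℝ] EE n}
    (hd : ∀ x, HasFDerivAt G (G' x) x) : Measurable (fun p => |(psiDer G' p).det|) := by
  have e : psiDer G' = fderiv ℝ (psiMap G 1 1) := by
    ext1 p
    have := (psiMap_hasFDerivAt hd 1 1 p).fderiv
    rw [this, diagMap_one]; rfl
  rw [e]
  exact (ContinuousLinearMap.continuous_det.measurable.comp (measurable_fderiv ℝ _)).abs

lemma psiDer_bounded (M : ℝ) :
    ∃ D : ℝ, 0 ≤ D ∧ ∀ G' : EE n → EE n →L[ℝ] EE n, (∀ x, ‖G' x‖ ≤ M) → ∀ p, |(psiDer G' p).det| ≤ D := by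
  obtain ⟨D, hD⟩ := (isCompact_closedBall (0 : EE n × EE n →L[ℝ] EE n × EE n) (2 + 2 * M)).exists_bound_of_continuousOn
    (f := fun A => A.det) ContinuousLinearMap.continuous_det.continuousOn
  refine ⟨max D 0, le_max_right _ _, fun G' hG' p => ?_⟩
  refine le_trans (hD _ ?_) (le_max_left _ _)
  rw [mem_closedBall_zero_iff]
  have hM : 0 ≤ M := (norm_nonneg _).trans (hG' 0)
  refine ContinuousLinearMap.opNorm_le_bound _ (by positivity) fun v => ?_
  have h1 : ‖v.1‖ ≤ ‖v‖ := norm_fst_le v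
  have h2 : ‖v.2‖ ≤ ‖v‖ := norm_snd_le v
  have h3 : ‖G' p.1 v.1‖ ≤ M * ‖v‖ := (ContinuousLinearMap.le_opNorm _ _).trans (by gcongr; exact hG' _)
  have h4 : ‖G' p.2 v.2‖ ≤ M * ‖v‖ := (ContinuousLinearMap.le_opNorm _ _).trans (by gcongr; exact hG' _)
  have e : psiDer G' p v = (v.1 + v.2, G' p.1 v.1 - G' p.2 v.2) := by simp [psiDer]
  rw [e]
  refine max_le ((norm_add_le _ _).trans ?_) ((norm_sub_le _ _).trans ?_)
  · have : 0 ≤ M * ‖v‖ := by positivity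
    linarith
  · have : 0 ≤ ‖v‖ := by positivity
    linarith

/-- Main identity turned into an inequality. -/
lemma niceField_ineq {G : EE n → EE n} {G' : EE n → EE n →L[ℝ] EE n} {m M : ℝ}
    (h : NiceField m M G G') :
    (4 * π ^ 2 / (1 + (m / (1 + M ^ 2)) ^ 2)) ^ ((n : ℝ) / 2) ≤
    ∫ p : EE n × EE n, |(psiDer G' p).det| *
      Real.exp (-(inner ℝ p.1 (G p.1) + inner ℝ p.2 (G p.2)) -
        (m / (1 + M ^ 2)) * (inner ℝ p.1 p.2 - inner ℝ (G p.1) (G p.2))) := by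
  have hm := h.hm
  have hM := h.hM
  have hG0 : G 0 = 0 := by
    have := h.odd 0
    rw [neg_zero] at this
    have h2 : (2 : ℝ) • G 0 = 0 := by
      rw [two_smul]; nth_rewrite 1 [this]; simp
    simpa using h2
  have hs : ∀ x, m * ‖x‖ ^ 2 ≤ inner ℝ x (G x) := by
    intro x
    have := h.mono x 0
    rw [hG0, sub_zero, sub_zero, real_inner_comm] at this
    exact this
  have hl : ∀ x, ‖G x‖ ≤ M * ‖x‖ := by
    intro x
    have := h.lip x 0
    rwa [hG0, sub_zero, sub_zero] at this
  have hGc : Continuous G := continuous_iff_continuousAt.2 fun x => (h.deriv x).continuousAt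
  have hG'M : ∀ x, ‖G' x‖ ≤ M := by
    intro x
    refine (h.deriv x).le_of_lip' hM.le ?_
    filter_upwards with z using h.lip z x
  obtain ⟨D, hD0, hD⟩ := psiDer_bounded (n := n) M
  set ε : ℝ := m / (1 + M ^ 2) with hε
  have hε0 : 0 < ε := by positivity
  set P : EE n × EE n → ℂ := fun p => Complex.I * (inner ℝ p.1 (G p.1) : ℝ) -
    ((ε / 2 * (‖p.1‖ ^ 2 + ‖G p.1‖ ^ 2) : ℝ) : ℂ) with hPdef
  set P' : EE n × EE n → ℂ := fun p => -Complex.I * (inner ℝ p.2 (G p.2) : ℝ) -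
    ((ε / 2 * (‖p.2‖ ^ 2 + ‖G p.2‖ ^ 2) : ℝ) : ℂ) with hPdef'
  set R : EE n × EE n → ℂ := fun p => Complex.I * ((inner ℝ p.2 (G p.1) - inner ℝ p.1 (G p.2) : ℝ) : ℂ) -
    ((ε * (inner ℝ p.1 p.2 - inner ℝ (G p.1) (G p.2)) : ℝ) : ℂ) with hRdef
  have cP : Continuous P := by fun_prop
  have cP' : Continuous P' := by fun_prop
  have cR : Continuous R := by fun_prop
  have bnd : ∀ x : EE n, ‖Complex.I * ((inner ℝ x (G x) : ℝ) : ℂ)‖ + ‖((ε / 2 * (‖x‖ ^ 2 + ‖G x‖ ^ 2) : ℝ) : ℂ)‖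
      ≤ (M + ε / 2 * (1 + M ^ 2)) * ‖x‖ ^ 2 := by
    intro x
    rw [norm_mul, Complex.norm_I, one_mul, Complex.norm_real, Complex.norm_real, Real.norm_eq_abs, Real.norm_eq_abs,
      abs_of_nonneg (by positivity : 0 ≤ ε / 2 * (‖x‖ ^ 2 + ‖G x‖ ^ 2))]
    have h1 := abs_real_inner_le_norm x (G x)
    have h2 := mul_le_mul_of_nonneg_left (hl x) (norm_nonneg x)
    have h3 : ‖G x‖ ^ 2 ≤ M ^ 2 * ‖x‖ ^ 2 := by rw [← mul_pow]; gcongr; exact hl x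
    have h4 : ε / 2 * (‖x‖ ^ 2 + ‖G x‖ ^ 2) ≤ ε / 2 * (‖x‖ ^ 2 + M ^ 2 * ‖x‖ ^ 2) := by gcongr
    nlinarith
  have key := phase_continuation (μ := (volume : Measure (EE n × EE n))) (P := P) (P' := P') (R := R)
    (J := fun p => |(psiDer G' p).det|) (N := fun p => ‖p.1‖ ^ 2 + ‖p.2‖ ^ 2)
    (K := M + ε / 2 * (1 + M ^ 2)) (c := ε / 2 * (m ^ 2 / (1 + M ^ 2))) (D := D)
    (by positivity) (by positivity) (fun p => by positivity) cP.measurable cP'.measurable cR.measurable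
    (psiDer_measurable h.deriv) (fun p => by rw [abs_abs]; exact hD G' hG'M p)
    (fun c hc => gauss_int_prod hc) ?_ ?_ ?_ (((4 * π ^ 2 / (1 + ε ^ 2)) ^ ((n : ℝ) / 2) : ℝ) : ℂ) ?_
  · have h1 : ‖(((4 * π ^ 2 / (1 + ε ^ 2)) ^ ((n : ℝ) / 2) : ℝ) : ℂ)‖ = (4 * π ^ 2 / (1 + ε ^ 2)) ^ ((n : ℝ) / 2) := by
      rw [Complex.norm_real, Real.norm_eq_abs, abs_of_nonneg (by positivity)]
    rw [← h1, ← key]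
    refine (norm_integral_le_integral_norm _).trans (le_of_eq ?_)
    congr 1
    ext p
    rw [norm_mul, Complex.norm_exp, Complex.norm_real, Real.norm_eq_abs, abs_abs]
    congr 2
    simp only [phaseQ, hPdef, hPdef', hRdef]
    simp [-Complex.ofReal_mul, -Complex.ofReal_sub, -Complex.ofReal_add, -Complex.ofReal_div]
    ring
  · intro p
    refine (norm_sub_le _ _).trans ((bnd p.1).trans ?_)
    gcongr
    have : 0 ≤ ‖p.2‖ ^ 2 := by positivity
    linarith
  · intro p
    refine (norm_sub_le _ _).trans ?_
    rw [neg_mul, norm_neg]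
    refine ((bnd p.2).trans ?_)
    gcongr
    have : 0 ≤ ‖p.1‖ ^ 2 := by positivity
    linarith
  · intro φ hφ hφ' p
    have h1 := arc_aux hm hM (hs p.1) (hs p.2) (hl p.1) (hl p.2) hε hφ hφ'
    refine le_trans (le_of_eq ?_) h1
    simp only [phaseQ, hPdef, hPdef', hRdef]
    rw [← Complex.exp_neg, ← neg_mul, ← Complex.ofReal_neg]
    simp [-Complex.ofReal_mul, -Complex.ofReal_sub, -Complex.ofReal_add, -Complex.ofReal_div, -Complex.ofReal_neg,
      Complex.exp_ofReal_mul_I_re, Complex.exp_ofReal_mul_I_im]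
    ring
  · intro q hq
    have hsq : Real.sqrt q * Real.sqrt q = q := Real.mul_self_sqrt hq.le
    have hsq0 : 0 < Real.sqrt q := Real.sqrt_pos.2 hq
    have hab : Real.sqrt q * (Real.sqrt q)⁻¹ = 1 := mul_inv_cancel₀ hsq0.ne'
    have hinv : (Real.sqrt q)⁻¹ * (Real.sqrt q)⁻¹ = q⁻¹ := by rw [← mul_inv, hsq]
    rw [← oscF_integral hε0, ← psi_change h hsq0 hab (oscF n ε)]
    congr 1
    ext p
    rw [Complex.real_smul]
    congr 2
    simp only [phaseQ, hPdef, hPdef', hRdef, psiMap]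
    rw [@norm_add_sq_real, @norm_sub_sq_real]
    simp only [inner_add_left, inner_sub_right, inner_smul_left, inner_smul_right, norm_smul, conj_trivial,
      mul_pow, Real.norm_eq_abs, sq_abs]
    rw [real_inner_comm (G p.1) p.1]
    set a := Real.sqrt q
    set b := (Real.sqrt q)⁻¹
    have e2 : (q : ℂ) = (a : ℂ) * a := by rw [← Complex.ofReal_mul, hsq]
    have e3 : (q : ℂ)⁻¹ = (b : ℂ) * b := by rw [← Complex.ofReal_mul, hinv, Complex.ofReal_inv]
    have e4 : (a : ℂ) * b = 1 := by rw [← Complex.ofReal_mul, hab]; simp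
    rw [e3, e2]
    push_cast
    linear_combination (Complex.I * ((inner ℝ p.2 (G p.1) : ℝ) : ℂ) - Complex.I * ((inner ℝ p.1 (G p.2) : ℝ) : ℂ)
      - ε * ((inner ℝ p.1 p.2 : ℝ) : ℂ) + ε * ((inner ℝ (G p.1) (G p.2) : ℝ) : ℂ)) * (-e4)
end A3

section B1
variable {n : ℕ}

/-- Tilted measure. -/
noncomputable def tl (ν : Measure (EE n)) (ξ : EE n) : Measure (EE n) := ν.tilted (fun x => inner ℝ ξ x)
/-- Laplace transform. -/
noncomputable def MM (ν : Measure (EE n)) (ξ : EE n) : ℝ := ∫ x, Real.exp (inner ℝ ξ x) ∂ν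
/-- Log-Laplace transform. -/
noncomputable def LL (ν : Measure (EE n)) (ξ : EE n) : ℝ := Real.log (MM ν ξ)
/-- Barycenter of the tilted measure. -/
noncomputable def bary (ν : Measure (EE n)) (ξ : EE n) : EE n := ∫ x, x ∂(tl ν ξ)
/-- Covariance operator of the tilted measure. -/
noncomputable def covA (ν : Measure (EE n)) (ξ : EE n) : EE n →L[ℝ] EE n :=
  ∫ x, (innerSL ℝ x).smulRight (x - bary ν ξ) ∂(tl ν ξ)

/-- Compactly supported probability measure. -/
structure CptP (ν : Measure (EE n)) (R : ℝ) : Prop where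
  prob : IsProbabilityMeasure ν
  hR : 0 < R
  bd : ∀ᵐ x ∂ν, ‖x‖ ≤ R
  ac : ν ≪ volume

lemma CptP.int {ν : Measure (EE n)} {R : ℝ} (h : CptP ν R) {W : Type*} [NormedAddCommGroup W]
    {g : EE n → W} (hg : Continuous g) : Integrable g ν := by
  have := h.prob
  obtain ⟨D, hD⟩ := (isCompact_closedBall (0 : EE n) R).exists_bound_of_continuousOn hg.continuousOn
  refine (integrable_const D).mono' hg.aestronglyMeasurable ?_
  filter_upwards [h.bd] with x hx
  exact hD x (by simpa using hx)

lemma CptP.expint {ν : Measure (EE n)} {R : ℝ} (h : CptP ν R) (ξ : EE n) :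
    Integrable (fun x => Real.exp (inner ℝ ξ x)) ν := h.int (by fun_prop)

lemma CptP.tl {ν : Measure (EE n)} {R : ℝ} (h : CptP ν R) (ξ : EE n) : CptP (tl ν ξ) R where
  prob := by
    have := h.prob
    exact isProbabilityMeasure_tilted (h.expint ξ)
  hR := h.hR
  bd := (tilted_absolutelyContinuous ν _) h.bd
  ac := (tilted_absolutelyContinuous ν _).trans h.ac

lemma CptP.MM_pos {ν : Measure (EE n)} {R : ℝ} (h : CptP ν R) (ξ : EE n) : 0 < MM ν ξ := by
  have := h.prob
  exact integral_exp_pos (h.expint ξ)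

lemma tl_integral (ν : Measure (EE n)) (ξ : EE n) {W : Type*} [NormedAddCommGroup W] [NormedSpace ℝ W]
    (g : EE n → W) : ∫ x, g x ∂(tl ν ξ) = (MM ν ξ)⁻¹ • ∫ x, Real.exp (inner ℝ ξ x) • g x ∂ν := by
  rw [tl, integral_tilted, ← integral_smul]
  congr 1; ext x
  rw [smul_smul, MM, div_eq_inv_mul]

lemma hasFDeriv_gen {ν : Measure (EE n)} {R : ℝ} (h : CptP ν R) {W : Type*} [NormedAddCommGroup W]
    [NormedSpace ℝ W] {k : EE n → W} (hk : Continuous k) (ξ : EE n) :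
    HasFDerivAt (fun ξ => ∫ x, Real.exp (inner ℝ ξ x) • k x ∂ν)
      (∫ x, Real.exp (inner ℝ ξ x) • (innerSL ℝ x).smulRight (k x) ∂ν) ξ := by
  obtain ⟨D, hD⟩ := (isCompact_closedBall (0 : EE n) R).exists_bound_of_continuousOn hk.continuousOn
  have := h.prob
  have hD0 : 0 ≤ D := (norm_nonneg _).trans (hD 0 (by simpa using h.hR.le))
  have hR := h.hR
  have hsm : Continuous (fun x : EE n => (innerSL ℝ x).smulRight (k x)) := by
    have h1 : Continuous (fun x : EE n => innerSL ℝ x) := (innerSL ℝ).continuous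
    have h2 : (fun x : EE n => (innerSL ℝ x).smulRight (k x)) =
      fun x => ContinuousLinearMap.smulRightL ℝ (EE n) W (innerSL ℝ x) (k x) := rfl
    rw [h2]
    fun_prop
  refine hasFDerivAt_integral_of_dominated_of_fderiv_le (s := Metric.ball ξ 1)
    (F' := fun ξ x => Real.exp (inner ℝ ξ x) • (innerSL ℝ x).smulRight (k x))
    (bound := fun _ => Real.exp ((‖ξ‖ + 1) * R) * (R * D)) (Metric.ball_mem_nhds _ one_pos)
    ?_ ?_ ?_ ?_ (integrable_const _) ?_
  · filter_upwards with ζ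
    exact (by fun_prop : Continuous _).aestronglyMeasurable
  · exact h.int (by fun_prop)
  · have : SecondCountableTopologyEither (EE n) (EE n →L[ℝ] W) := secondCountableTopologyEither_of_left _ _
    exact (by fun_prop : Continuous _).aestronglyMeasurable
  · filter_upwards [h.bd] with x hx ζ hζ
    rw [norm_smul, ContinuousLinearMap.norm_smulRight_apply, Real.norm_eq_abs, abs_of_pos (Real.exp_pos _),
      innerSL_apply_norm]
    have h1 : inner ℝ ζ x ≤ (‖ξ‖ + 1) * R := by
      refine (real_inner_le_norm _ _).trans ?_
      have : ‖ζ‖ ≤ ‖ξ‖ + 1 := by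
        have h2 : ‖ζ - ξ‖ < 1 := by simpa [dist_eq_norm] using hζ
        have := norm_sub_norm_le ζ ξ
        linarith
      gcongr
    have h2 : ‖k x‖ ≤ D := hD x (by simpa using hx)
    gcongr
  · filter_upwards with x ζ hζ
    have h1 : HasFDerivAt (fun ζ : EE n => inner ℝ ζ x) (innerSL ℝ x) ζ := by
      have := (innerSL ℝ x).hasFDerivAt (x := ζ)
      refine this.congr_of_eventuallyEq ?_
      filter_upwards with z
      rw [innerSL_apply_apply, real_inner_comm]
    have h2 := h1.exp.smul_const (k x)
    have e : (Real.exp (inner ℝ ζ x) • innerSL ℝ x).smulRight (k x) = Real.exp (inner ℝ ζ x) • (innerSL ℝ x).smulRight (k x) := by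
      ext v; simp [smul_smul]
    rw [← e]; exact h2

lemma MM_hasFDeriv {ν : Measure (EE n)} {R : ℝ} (h : CptP ν R) (ξ : EE n) :
    HasFDerivAt (MM ν) (∫ x, Real.exp (inner ℝ ξ x) • innerSL ℝ x ∂ν) ξ := by
  have := hasFDeriv_gen h (k := fun _ => (1 : ℝ)) continuous_const ξ
  have e : ∀ x : EE n, (innerSL ℝ x).smulRight (1 : ℝ) = innerSL ℝ x := by
    intro x; ext v; simp
  simp only [e, smul_eq_mul, mul_one] at this
  exact this

lemma CptP.outer_cont (w : EE n) : Continuous (fun x : EE n => (innerSL ℝ x).smulRight (x - w)) := by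
  have h1 : Continuous (fun x : EE n => innerSL ℝ x) := (innerSL ℝ).continuous
  have h2 : (fun x : EE n => (innerSL ℝ x).smulRight (x - w)) =
    fun x => ContinuousLinearMap.smulRightL ℝ (EE n) (EE n) (innerSL ℝ x) (x - w) := rfl
  rw [h2]
  fun_prop

lemma covA_apply {ν : Measure (EE n)} {R : ℝ} (h : CptP ν R) (ξ η : EE n) :
    covA ν ξ η = ∫ x, (inner ℝ x η : ℝ) • (x - bary ν ξ) ∂(tl ν ξ) := by
  rw [covA, ContinuousLinearMap.integral_apply ((h.tl ξ).int (CptP.outer_cont _))]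
  rfl

lemma covA_inner {ν : Measure (EE n)} {R : ℝ} (h : CptP ν R) (ξ η ζ : EE n) :
    inner ℝ (covA ν ξ η) ζ = ∫ x, (inner ℝ (x - bary ν ξ) η : ℝ) * inner ℝ (x - bary ν ξ) ζ ∂(tl ν ξ) := by
  have := (h.tl ξ).prob
  have hi : ∀ v : EE n, ∫ x, inner ℝ v (x - bary ν ξ) ∂(tl ν ξ) = 0 := by
    intro v
    rw [integral_inner ((h.tl ξ).int (by fun_prop)), integral_sub ((h.tl ξ).int (by fun_prop)) ((h.tl ξ).int (by fun_prop))]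
    simp [bary]
  rw [covA_apply h, real_inner_comm, ← integral_inner ((h.tl ξ).int (by fun_prop))]
  have e : ∀ x : EE n, inner ℝ ζ ((inner ℝ x η : ℝ) • (x - bary ν ξ)) =
      (inner ℝ (x - bary ν ξ) η : ℝ) * inner ℝ (x - bary ν ξ) ζ + inner ℝ (bary ν ξ) η * inner ℝ ζ (x - bary ν ξ) := by
    intro x
    rw [inner_smul_right, inner_sub_left x _ η, real_inner_comm ζ (x - _)]; ring
  simp only [e]
  rw [integral_add ((h.tl ξ).int (by fun_prop)) ((h.tl ξ).int (by fun_prop)), integral_const_mul, hi]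
  simp

lemma bary_norm_le {ν : Measure (EE n)} {R : ℝ} (h : CptP ν R) (ξ : EE n) : ‖bary ν ξ‖ ≤ R := by
  have := (h.tl ξ).prob
  have := norm_integral_le_of_norm_le_const (μ := tl ν ξ) (f := fun x => x) (h.tl ξ).bd
  simpa [bary] using this

lemma covA_norm_le {ν : Measure (EE n)} {R : ℝ} (h : CptP ν R) (ξ : EE n) : ‖covA ν ξ‖ ≤ 2 * R ^ 2 := by
  have := (h.tl ξ).prob
  have hR := h.hR
  refine ContinuousLinearMap.opNorm_le_bound _ (by positivity) fun η => ?_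
  rw [covA_apply h]
  have := norm_integral_le_of_norm_le_const (μ := tl ν ξ) (f := fun x => (inner ℝ x η : ℝ) • (x - bary ν ξ))
    (C := 2 * R ^ 2 * ‖η‖) ?_
  · simpa using this
  filter_upwards [(h.tl ξ).bd] with x hx
  rw [norm_smul]
  have h1 : ‖(inner ℝ x η : ℝ)‖ ≤ R * ‖η‖ := (norm_inner_le_norm _ _).trans (by gcongr)
  have h2 : ‖x - bary ν ξ‖ ≤ R + R := (norm_sub_le _ _).trans (add_le_add hx (bary_norm_le h ξ))
  calc _ ≤ (R * ‖η‖) * (R + R) := by gcongr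
    _ = _ := by ring

lemma bary_eq (ν : Measure (EE n)) (ξ : EE n) :
    bary ν ξ = (MM ν ξ)⁻¹ • ∫ x, Real.exp (inner ℝ ξ x) • x ∂ν := by
  rw [bary, tl_integral]

lemma bary_hasFDeriv {ν : Measure (EE n)} {R : ℝ} (h : CptP ν R) (ξ : EE n) :
    HasFDerivAt (bary ν) (covA ν ξ) ξ := by
  have hM := MM_hasFDeriv h ξ
  have hV := hasFDeriv_gen h (k := fun x => x) continuous_id ξ
  have hMp := h.MM_pos ξ
  have h1 := ((hasDerivAt_inv hMp.ne').comp_hasFDerivAt ξ hM).smul hV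
  have e0 : bary ν = fun ξ => (MM ν ξ)⁻¹ • ∫ x, Real.exp (inner ℝ ξ x) • x ∂ν := by
    ext1 ζ; exact bary_eq ν ζ
  have c1 : Continuous (fun x : EE n => innerSL ℝ x) := (innerSL ℝ).continuous
  have c2 := CptP.outer_cont (n := n) 0
  simp only [sub_zero] at c2
  rw [e0]
  suffices e : covA ν ξ = ((MM ν ξ)⁻¹ • ∫ (x : EE n), rexp (inner ℝ ξ x) • ((innerSL ℝ) x).smulRight x ∂ν +
      (-(MM ν ξ ^ 2)⁻¹ • ∫ (x : EE n), rexp (inner ℝ ξ x) • (innerSL ℝ) x ∂ν).smulRight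
        (∫ (x : EE n), rexp (inner ℝ ξ x) • x ∂ν)) by
    rw [e]; exact h1
  ext1 η
  rw [covA_apply h]
  have e1 : ∀ x : EE n, (inner ℝ x η : ℝ) • (x - bary ν ξ) = (inner ℝ x η : ℝ) • x - (inner ℝ x η : ℝ) • bary ν ξ := by
    intro x; rw [smul_sub]
  simp only [e1]
  rw [integral_sub ((h.tl ξ).int (by fun_prop)) ((h.tl ξ).int (by fun_prop)), integral_smul_const, tl_integral, tl_integral]
  simp only [ContinuousLinearMap.add_apply, ContinuousLinearMap.smul_apply, ContinuousLinearMap.smulRight_apply]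
  rw [ContinuousLinearMap.integral_apply (h.int (by fun_prop)), ContinuousLinearMap.integral_apply (h.int (by fun_prop))]
  simp only [ContinuousLinearMap.smul_apply, ContinuousLinearMap.smulRight_apply, innerSL_apply_apply]
  rw [sub_eq_add_neg, bary_eq]
  congr 1
  rw [smul_smul, ← neg_smul]
  congr 1
  simp only [smul_eq_mul]
  field_simp

/-- strict Jensen -/
lemma CptP.strict {ρ : Measure (EE n)} {R : ℝ} (h : CptP ρ R) {δ : EE n} (hδ : δ ≠ 0) :
    1 < ∫ x, Real.exp (inner ℝ δ (x - ∫ z, z ∂ρ)) ∂ρ := by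
  have := h.prob
  set y := ∫ z, z ∂ρ with hy
  have hi : ∫ x, inner ℝ δ (x - y) ∂ρ = 0 := by
    rw [integral_inner (h.int (by fun_prop)), integral_sub (h.int (by fun_prop)) (h.int (by fun_prop))]
    simp [hy]
  have h0 : 0 < ∫ x, (Real.exp (inner ℝ δ (x - y)) - (inner ℝ δ (x - y) + 1)) ∂ρ := by
    rw [integral_pos_iff_support_of_nonneg]
    · have hsub : {x : EE n | inner ℝ δ (x - y) = 0}ᶜ ⊆
        Function.support (fun x => (Real.exp (inner ℝ δ (x - y)) - (inner ℝ δ (x - y) + 1))) := by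
        intro x hx
        have := Real.add_one_lt_exp (show inner ℝ δ (x - y) ≠ 0 from hx)
        exact (sub_pos.2 this).ne'
      have hnull : volume {x : EE n | inner ℝ δ (x - y) = 0} = 0 := by
        let S : AffineSubspace ℝ (EE n) := AffineSubspace.mk' y (LinearMap.ker (innerSL ℝ δ : EE n →ₗ[ℝ] ℝ))
        have hS : {x : EE n | inner ℝ δ (x - y) = 0} = (S : Set (EE n)) := by
          ext x
          simp [S, AffineSubspace.mem_mk']
        rw [hS]
        refine Measure.addHaar_affineSubspace _ _ ?_
        intro htop
        have : y + δ ∈ S := by rw [htop]; trivial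
        have h2 : y + δ ∈ {x : EE n | inner ℝ δ (x - y) = 0} := by rw [hS]; exact this
        simp at h2
        exact hδ h2
      have h1 : ρ {x : EE n | inner ℝ δ (x - y) = 0} = 0 := h.ac hnull
      have hmeas : MeasurableSet {x : EE n | inner ℝ δ (x - y) = 0} :=
        (isClosed_singleton.preimage (by fun_prop : Continuous (fun x : EE n => inner ℝ δ (x - y)))).measurableSet
      have h2 : ρ {x : EE n | inner ℝ δ (x - y) = 0}ᶜ = 1 := by
        rw [prob_compl_eq_one_iff hmeas]; exact h1
      calc (0 : ENNReal) < 1 := one_pos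
        _ = _ := h2.symm
        _ ≤ _ := measure_mono hsub
    · intro x
      have := Real.add_one_le_exp (inner ℝ δ (x - y))
      simpa using this
    · exact h.int (by fun_prop)
  rw [integral_sub (h.int (by fun_prop)) (h.int (by fun_prop)), integral_add (h.int (by fun_prop)) (h.int (by fun_prop)), hi] at h0
  simpa using h0

lemma LL_strict {ν : Measure (EE n)} {R : ℝ} (h : CptP ν R) {ξ ξ' : EE n} (hne : ξ ≠ ξ') :
    LL ν ξ + inner ℝ (bary ν ξ) (ξ' - ξ) < LL ν ξ' := by
  have h1 := (h.tl ξ).strict (sub_ne_zero.2 hne.symm)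
  have hM := h.MM_pos ξ
  have hM' := h.MM_pos ξ'
  have e : ∫ x, Real.exp (inner ℝ (ξ' - ξ) (x - bary ν ξ)) ∂(tl ν ξ) =
      Real.exp (- inner ℝ (bary ν ξ) (ξ' - ξ)) * ((MM ν ξ)⁻¹ * MM ν ξ') := by
    rw [tl_integral, smul_eq_mul, mul_left_comm]
    congr 1
    rw [MM, ← integral_const_mul]
    refine integral_congr_ae (Filter.Eventually.of_forall fun x => ?_)
    simp only
    rw [smul_eq_mul, ← Real.exp_add, ← Real.exp_add]
    congr 1
    rw [inner_sub_right, real_inner_comm (bary ν ξ) (ξ' - ξ), inner_sub_left]; ring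
  change 1 < ∫ x, Real.exp (inner ℝ (ξ' - ξ) (x - bary ν ξ)) ∂(tl ν ξ) at h1
  rw [e] at h1
  have h2 := Real.log_pos h1
  rw [Real.log_mul (Real.exp_pos _).ne' (by positivity), Real.log_exp, Real.log_mul (by positivity) hM'.ne', Real.log_inv] at h2
  unfold LL
  linarith

lemma LL_le {ν : Measure (EE n)} {R : ℝ} (h : CptP ν R) (ξ ξ' : EE n) :
    LL ν ξ + inner ℝ (bary ν ξ) (ξ' - ξ) ≤ LL ν ξ' := by
  by_cases hne : ξ = ξ'
  · subst hne; simp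
  · exact (LL_strict h hne).le

lemma bary_strict {ν : Measure (EE n)} {R : ℝ} (h : CptP ν R) : ∀ x z, x ≠ z →
    0 < inner ℝ (bary ν x - bary ν z) (x - z) := by
  intro x z hxz
  have h1 := LL_strict h hxz
  have h2 := LL_strict h hxz.symm
  rw [inner_sub_left]
  have : inner ℝ (bary ν x) (z - x) = - inner ℝ (bary ν x) (x - z) := by
    rw [← inner_neg_right, neg_sub]
  linarith

lemma LL_zero {ν : Measure (EE n)} {R : ℝ} (h : CptP ν R) : LL ν 0 = 0 := by
  have := h.prob
  simp [LL, MM]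

lemma LL_mid {ν : Measure (EE n)} {R : ℝ} (h : CptP ν R) (a b : EE n) :
    LL ν ((1 / 2 : ℝ) • (a + b)) ≤ (LL ν a + LL ν b) / 2 := by
  have h1 := LL_le h ((1 / 2 : ℝ) • (a + b)) a
  have h2 := LL_le h ((1 / 2 : ℝ) • (a + b)) b
  have e : inner ℝ (bary ν ((1 / 2 : ℝ) • (a + b))) (a - (1 / 2 : ℝ) • (a + b)) +
    inner ℝ (bary ν ((1 / 2 : ℝ) • (a + b))) (b - (1 / 2 : ℝ) • (a + b)) = 0 := by
    rw [← inner_add_right]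
    have : (a - (1 / 2 : ℝ) • (a + b)) + (b - (1 / 2 : ℝ) • (a + b)) = 0 := by module
    rw [this, inner_zero_right]
  linarith

lemma LL_le_inner {ν : Measure (EE n)} {R : ℝ} (h : CptP ν R) (ξ : EE n) :
    LL ν ξ ≤ inner ℝ ξ (bary ν ξ) := by
  have := LL_le h ξ 0
  rw [LL_zero h, zero_sub, inner_neg_right, real_inner_comm] at this
  linarith

lemma inner_le_LL {ν : Measure (EE n)} {R : ℝ} (h : CptP ν R) (ξ : EE n) :
    inner ℝ ξ (bary ν ξ) ≤ LL ν ((2:ℝ) • ξ) - LL ν ξ := by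
  have := LL_le h ξ ((2:ℝ) • ξ)
  rw [two_smul, add_sub_cancel_right, real_inner_comm] at this
  rw [two_smul]
  linarith

/-- Symmetric measure. -/
def SymM (ν : Measure (EE n)) : Prop := ν.map (fun x => -x) = ν

lemma SymM.integral {ν : Measure (EE n)} (hs : SymM ν) {W : Type*} [NormedAddCommGroup W] [NormedSpace ℝ W]
    (g : EE n → W) : ∫ x, g (-x) ∂ν = ∫ x, g x ∂ν := by
  conv_rhs => rw [← hs]
  exact ((MeasurableEquiv.neg (EE n)).measurableEmbedding.integral_map g).symm

lemma MM_even {ν : Measure (EE n)} (hs : SymM ν) (ξ : EE n) : MM ν (-ξ) = MM ν ξ := by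
  rw [MM, MM, ← hs.integral]; simp

lemma LL_even {ν : Measure (EE n)} (hs : SymM ν) (ξ : EE n) : LL ν (-ξ) = LL ν ξ := by
  rw [LL, LL, MM_even hs]

lemma bary_odd {ν : Measure (EE n)} (hs : SymM ν) (ξ : EE n) : bary ν (-ξ) = - bary ν ξ := by
  rw [bary_eq, bary_eq, MM_even hs, ← hs.integral, ← smul_neg, ← integral_neg]; simp

lemma LL_nonneg {ν : Measure (EE n)} {R : ℝ} (h : CptP ν R) (hs : SymM ν) (ξ : EE n) : 0 ≤ LL ν ξ := by
  have := LL_mid h ξ (-ξ)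
  rw [add_neg_cancel, smul_zero, LL_zero h, LL_even hs] at this
  linarith

lemma LL_half {ν : Measure (EE n)} {R : ℝ} (h : CptP ν R) (ξ : EE n) : LL ν ξ ≤ LL ν ((2:ℝ) • ξ) / 2 := by
  have := LL_mid h ((2:ℝ) • ξ) 0
  rw [add_zero, smul_smul, LL_zero h] at this
  norm_num at this
  linarith
end B1

section B2
variable {n : ℕ}

lemma integrable_exp_neg_norm {ρ : ℝ} (hρ : 0 < ρ) : Integrable (fun x : EE n => Real.exp (-ρ * ‖x‖)) := by
  have h1 := integrable_one_add_norm (μ := (volume : Measure (EE n))) (r := ((n + 1 : ℕ) : ℝ)) (by simp)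
  refine (h1.const_mul (Real.exp ρ * (n+1).factorial / ρ ^ (n + 1))).mono' (by fun_prop) ?_
  filter_upwards with x
  rw [Real.norm_eq_abs, abs_of_pos (Real.exp_pos _)]
  have h2 := Real.pow_div_factorial_le_exp (x := ρ * (1 + ‖x‖)) (by positivity) (n + 1)
  rw [Real.rpow_neg (by positivity), Real.rpow_natCast]
  have h3 : Real.exp (-ρ * ‖x‖) = Real.exp ρ * (Real.exp (ρ * (1 + ‖x‖)))⁻¹ := by
    rw [← Real.exp_neg, ← Real.exp_add]; ring_nf
  rw [h3, mul_div_assoc, mul_assoc]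
  gcongr
  rw [inv_le_comm₀ (by positivity) (by positivity)]
  refine le_trans (le_of_eq ?_) h2
  rw [mul_pow]
  field_simp

lemma MM_cont {ν : Measure (EE n)} {R : ℝ} (h : CptP ν R) : Continuous (MM ν) :=
  continuous_iff_continuousAt.2 fun x => (MM_hasFDeriv h x).continuousAt

lemma LL_cont {ν : Measure (EE n)} {R : ℝ} (h : CptP ν R) : Continuous (LL ν) :=
  (MM_cont h).log fun x => (h.MM_pos x).ne'

lemma bary_cont {ν : Measure (EE n)} {R : ℝ} (h : CptP ν R) : Continuous (bary ν) :=
  continuous_iff_continuousAt.2 fun x => (bary_hasFDeriv h x).continuousAt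

lemma bary_zero {ν : Measure (EE n)} (hs : SymM ν) : bary ν 0 = 0 := by
  have := bary_odd hs (0 : EE n)
  rw [neg_zero] at this
  have h2 : (2 : ℝ) • bary ν 0 = 0 := by
    rw [two_smul]; nth_rewrite 1 [this]; simp
  simpa using h2

lemma expLL_int {ν : Measure (EE n)} {R : ℝ} (h : CptP ν R) (hs : SymM ν) (hn : 1 ≤ n) :
    Integrable (fun ξ => Real.exp (-LL ν ξ)) := by
  haveI : Nonempty (Fin n) := ⟨⟨0, hn⟩⟩
  obtain ⟨ζ, hζ, hmin⟩ := (isCompact_sphere (0 : EE n) 1).exists_isMinOn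
    (NormedSpace.sphere_nonempty.2 zero_le_one) (LL_cont h).continuousOn
  have hζ1 : ‖ζ‖ = 1 := by simpa using hζ
  set ρ := LL ν ζ with hρ
  have hρ0 : 0 < ρ := by
    have := LL_strict h (ξ := 0) (ξ' := ζ) (by rintro rfl; simp at hζ1)
    rw [LL_zero h, bary_zero hs] at this
    simpa using this
  refine ((integrable_exp_neg_norm (n := n) hρ0).const_mul (Real.exp ρ)).mono'
    (by have := LL_cont h; fun_prop) ?_
  filter_upwards with ξ
  rw [Real.norm_eq_abs, abs_of_pos (Real.exp_pos _), ← Real.exp_add, Real.exp_le_exp]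
  rcases le_or_gt 1 ‖ξ‖ with h1 | h1
  · have hpos : 0 < ‖ξ‖ := by linarith
    set u := ‖ξ‖⁻¹ • ξ with hu
    have hu1 : ‖u‖ = 1 := by rw [hu, norm_smul, norm_inv, norm_norm, inv_mul_cancel₀ hpos.ne']
    have e : ξ - u = (‖ξ‖ - 1) • u := by
      rw [hu, sub_smul, one_smul, smul_smul, mul_inv_cancel₀ hpos.ne', one_smul]
    have h2 := LL_le h u ξ
    rw [e, inner_smul_right, real_inner_comm] at h2
    have h3 := LL_le_inner h u
    have h4 : ρ ≤ LL ν u := hmin (by simpa using hu1)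
    have h5 : (‖ξ‖ - 1) * ρ ≤ (‖ξ‖ - 1) * inner ℝ u (bary ν u) :=
      mul_le_mul_of_nonneg_left (h4.trans h3) (by linarith)
    linarith
  · have := LL_nonneg h hs ξ
    nlinarith

/-- Regularised field. -/
noncomputable def Gm (ν : Measure (EE n)) (m : ℝ) (x : EE n) : EE n := bary ν x + m • x
/-- Derivative of the regularised field. -/
noncomputable def Gm' (ν : Measure (EE n)) (m : ℝ) (x : EE n) : EE n →L[ℝ] EE n :=
  covA ν x + m • ContinuousLinearMap.id ℝ (EE n)

lemma bary_lip {ν : Measure (EE n)} {R : ℝ} (h : CptP ν R) (x z : EE n) :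
    ‖bary ν x - bary ν z‖ ≤ 2 * R ^ 2 * ‖x - z‖ :=
  convex_univ.norm_image_sub_le_of_norm_hasFDerivWithin_le
    (fun w _ => (bary_hasFDeriv h w).hasFDerivWithinAt) (fun w _ => covA_norm_le h w)
    (Set.mem_univ z) (Set.mem_univ x)

lemma Gm_nice {ν : Measure (EE n)} {R : ℝ} (h : CptP ν R) (hs : SymM ν) {m : ℝ} (hm : 0 < m) :
    NiceField m (2 * R ^ 2 + m) (Gm ν m) (Gm' ν m) where
  hm := hm
  hM := by positivity
  mono x z := by
    have e : Gm ν m x - Gm ν m z = (bary ν x - bary ν z) + m • (x - z) := by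
      simp only [Gm, smul_sub]; abel
    rw [e, inner_add_left, inner_smul_left, real_inner_self_eq_norm_sq]
    have : 0 ≤ inner ℝ (bary ν x - bary ν z) (x - z) := by
      by_cases hxz : x = z
      · simp [hxz]
      · exact (bary_strict h x z hxz).le
    simp only [conj_trivial]
    linarith
  lip x z := by
    have e : Gm ν m x - Gm ν m z = (bary ν x - bary ν z) + m • (x - z) := by
      simp only [Gm, smul_sub]; abel
    rw [e]
    refine (norm_add_le _ _).trans ?_
    rw [norm_smul, Real.norm_eq_abs, abs_of_pos hm]
    have := bary_lip h x z
    linarith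
  odd x := by simp only [Gm, bary_odd hs, smul_neg]; abel
  deriv x := (bary_hasFDeriv h x).add ((hasFDerivAt_id x).const_smul m)

lemma psiDer_Gm (ν : Measure (EE n)) (m : ℝ) (p : EE n × EE n) :
    psiDer (Gm' ν m) p = psiDer (covA ν) p + m • ((0 : EE n × EE n →L[ℝ] EE n).prod
      (ContinuousLinearMap.fst ℝ (EE n) (EE n) - ContinuousLinearMap.snd ℝ (EE n) (EE n))) := by
  refine ContinuousLinearMap.ext fun v => ?_
  simp only [psiDer, Gm', ContinuousLinearMap.add_apply, ContinuousLinearMap.prod_apply, ContinuousLinearMap.sub_apply,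
    ContinuousLinearMap.comp_apply, ContinuousLinearMap.smul_apply, ContinuousLinearMap.coe_fst',
    ContinuousLinearMap.coe_snd', ContinuousLinearMap.id_apply, ContinuousLinearMap.zero_apply, Prod.smul_mk, smul_zero,
    Prod.mk_add_mk, add_zero, smul_sub]
  congr 1
  abel

lemma main_lower {ν : Measure (EE n)} {R : ℝ} (h : CptP ν R) (hs : SymM ν) (hn : 1 ≤ n) :
    ENNReal.ofReal ((2 * π) ^ n) ≤ ∫⁻ p : EE n × EE n, ENNReal.ofReal |(psiDer (covA ν) p).det| *
      ENNReal.ofReal (Real.exp (-(inner ℝ p.1 (bary ν p.1)))) *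
      ENNReal.ofReal (Real.exp (-(inner ℝ p.2 (bary ν p.2)))) := by
  have hR := h.hR
  set m : ℕ → ℝ := fun k => 1 / ((k : ℝ) + 1) with hmdef
  have hm0 : ∀ k, 0 < m k := fun k => by simp only [hmdef]; positivity
  have hm1 : ∀ k, m k ≤ 1 := fun k => by
    simp only [hmdef]; rw [div_le_one (by positivity)]
    have : (0:ℝ) ≤ k := by positivity
    linarith
  have hmt : Filter.Tendsto m Filter.atTop (nhds 0) := tendsto_one_div_add_atTop_nhds_zero_nat
  set M : ℕ → ℝ := fun k => 2 * R ^ 2 + m k with hM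
  have hM0 : ∀ k, 0 < M k := fun k => by have := hm0 k; simp only [hM]; positivity
  have hMt : Filter.Tendsto M Filter.atTop (nhds (2 * R ^ 2 + 0)) := tendsto_const_nhds.add hmt
  set ε : ℕ → ℝ := fun k => m k / (1 + (M k) ^ 2) with hε
  have hε0 : ∀ k, 0 < ε k := fun k => by have := hm0 k; have := hM0 k; simp only [hε]; positivity
  have hεt : Filter.Tendsto ε Filter.atTop (nhds 0) := by
    have := hmt.div (tendsto_const_nhds.add (hMt.pow 2)) (a := (0:ℝ)) (b := 1 + (2 * R ^ 2 + 0) ^ 2) (by positivity)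
    rw [zero_div] at this
    exact this
  have hineq := fun k => niceField_ineq (Gm_nice h hs (hm0 k))
  obtain ⟨D, hD0, hD⟩ := psiDer_bounded (n := n) (2 * R ^ 2 + 1)
  have hDk : ∀ k p, |(psiDer (Gm' ν (m k)) p).det| ≤ D := by
    intro k p
    refine hD _ (fun x => ?_) p
    refine (norm_add_le _ _).trans ?_
    have h1 := covA_norm_le h x
    have h2 : ‖m k • ContinuousLinearMap.id ℝ (EE n)‖ ≤ 1 := by
      rw [norm_smul, Real.norm_eq_abs, abs_of_pos (hm0 k)]
      exact mul_le_one₀ (hm1 k) (norm_nonneg _) ContinuousLinearMap.norm_id_le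
    linarith
  have hD' : ∀ p, |(psiDer (covA ν) p).det| ≤ D := by
    intro p
    refine hD _ (fun x => ?_) p
    have h1 := covA_norm_le h x
    linarith
  have hcb := bary_cont h
  have hlim : Filter.Tendsto (fun k => ∫ p : EE n × EE n, |(psiDer (Gm' ν (m k)) p).det| *
      Real.exp (-(inner ℝ p.1 (Gm ν (m k) p.1) + inner ℝ p.2 (Gm ν (m k) p.2)) -
        (m k / (1 + (2 * R ^ 2 + m k) ^ 2)) * (inner ℝ p.1 p.2 - inner ℝ (Gm ν (m k) p.1) (Gm ν (m k) p.2)))) Filter.atTop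
      (nhds (∫ p : EE n × EE n, |(psiDer (covA ν) p).det| *
        Real.exp (-(inner ℝ p.1 (bary ν p.1) + inner ℝ p.2 (bary ν p.2))))) := by
    refine tendsto_integral_of_dominated_convergence
      (fun p => D * (Real.exp (-LL ν p.1) * Real.exp (-LL ν p.2))) ?_ ?_ ?_ ?_
    · intro k
      refine Measurable.aestronglyMeasurable ?_
      refine (psiDer_measurable (Gm_nice h hs (hm0 k)).deriv).mul ?_
      have : Continuous (Gm ν (m k)) := by unfold Gm; fun_prop
      exact (by fun_prop : Continuous _).measurable
    · exact ((expLL_int h hs hn).mul_prod (expLL_int h hs hn)).const_mul D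
    · intro k
      filter_upwards with p
      rw [Real.norm_eq_abs, abs_mul, abs_abs, abs_of_pos (Real.exp_pos _), ← Real.exp_add]
      refine mul_le_mul (hDk k p) (Real.exp_le_exp.2 ?_) (Real.exp_pos _).le hD0
      have h1 := LL_le_inner h p.1
      have h2 := LL_le_inner h p.2
      have hnice := Gm_nice h hs (hm0 k)
      have hG0 : Gm ν (m k) 0 = 0 := by simp [Gm, bary_zero hs]
      have hl : ∀ x, ‖Gm ν (m k) x‖ ≤ M k * ‖x‖ := by
        intro x
        have := hnice.lip x 0
        rwa [hG0, sub_zero, sub_zero] at this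
      have e1 : ∀ x, inner ℝ x (Gm ν (m k) x) = inner ℝ x (bary ν x) + m k * ‖x‖ ^ 2 := by
        intro x
        rw [Gm, inner_add_right, inner_smul_right, real_inner_self_eq_norm_sq]
      rw [e1, e1]
      have h3 := abs_le.1 (abs_real_inner_le_norm p.1 p.2)
      have h4 := abs_le.1 (abs_real_inner_le_norm (Gm ν (m k) p.1) (Gm ν (m k) p.2))
      have h5 : ‖Gm ν (m k) p.1‖ * ‖Gm ν (m k) p.2‖ ≤ M k ^ 2 * (‖p.1‖ * ‖p.2‖) := by
        calc _ ≤ (M k * ‖p.1‖) * (M k * ‖p.2‖) := by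
              exact mul_le_mul (hl _) (hl _) (norm_nonneg _) ((norm_nonneg _).trans (hl _))
          _ = _ := by ring
      have h6 : 2 * (‖p.1‖ * ‖p.2‖) ≤ ‖p.1‖ ^ 2 + ‖p.2‖ ^ 2 := by nlinarith [sq_nonneg (‖p.1‖ - ‖p.2‖)]
      have h7 : -(ε k * (inner ℝ p.1 p.2 - inner ℝ (Gm ν (m k) p.1) (Gm ν (m k) p.2))) ≤
          m k * (‖p.1‖ ^ 2 + ‖p.2‖ ^ 2) / 2 := by
        calc -(ε k * (inner ℝ p.1 p.2 - inner ℝ (Gm ν (m k) p.1) (Gm ν (m k) p.2)))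
            = ε k * (inner ℝ (Gm ν (m k) p.1) (Gm ν (m k) p.2) - inner ℝ p.1 p.2) := by ring
          _ ≤ ε k * ((1 + M k ^ 2) * (‖p.1‖ * ‖p.2‖)) := by
              refine mul_le_mul_of_nonneg_left ?_ (hε0 k).le
              linarith [h3.1, h4.2]
          _ = m k * (‖p.1‖ * ‖p.2‖) := by
              simp only [hε]
              have := hM0 k
              field_simp
          _ ≤ _ := by
              have := mul_le_mul_of_nonneg_left h6 (hm0 k).le
              linarith
      have h8 : 0 ≤ m k * (‖p.1‖ ^ 2 + ‖p.2‖ ^ 2) := by have := hm0 k; positivity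
      have h9 : m k / (1 + (2 * R ^ 2 + m k) ^ 2) = ε k := rfl
      rw [h9]
      linarith
    · filter_upwards with p
      have hGt : ∀ x, Filter.Tendsto (fun k => Gm ν (m k) x) Filter.atTop (nhds (bary ν x)) := by
        intro x
        have := (tendsto_const_nhds (x := bary ν x)).add (hmt.smul_const x)
        simpa [Gm] using this
      refine Filter.Tendsto.mul ?_ ?_
      · have h1 : Filter.Tendsto (fun k => psiDer (Gm' ν (m k)) p) Filter.atTop (nhds (psiDer (covA ν) p)) := by
          simp only [psiDer_Gm]
          have := (tendsto_const_nhds (x := psiDer (covA ν) p)).add (hmt.smul_const ((0 : EE n × EE n →L[ℝ] EE n).prod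
            (ContinuousLinearMap.fst ℝ (EE n) (EE n) - ContinuousLinearMap.snd ℝ (EE n) (EE n))))
          have e : psiDer (covA ν) p + (0 : ℝ) • ((0 : EE n × EE n →L[ℝ] EE n).prod
            (ContinuousLinearMap.fst ℝ (EE n) (EE n) - ContinuousLinearMap.snd ℝ (EE n) (EE n))) = psiDer (covA ν) p := by
            refine ContinuousLinearMap.ext fun v => ?_
            simp
          exact this.mono_right (le_of_eq (congrArg nhds e))
        exact ((ContinuousLinearMap.continuous_det.tendsto _).comp h1).abs
      · have h2 := (((tendsto_const_nhds (x := p.1)).inner (𝕜 := ℝ) (hGt p.1)).add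
          ((tendsto_const_nhds (x := p.2)).inner (𝕜 := ℝ) (hGt p.2))).neg
        have h3 := hεt.mul ((tendsto_const_nhds (x := inner ℝ p.1 p.2)).sub ((hGt p.1).inner (𝕜 := ℝ) (hGt p.2)))
        have h4 := (Real.continuous_exp.tendsto _).comp (h2.sub h3)
        rw [zero_mul, sub_zero] at h4
        exact h4
  have hL : Filter.Tendsto (fun k => (4 * π ^ 2 / (1 + (m k / (1 + (2 * R ^ 2 + m k) ^ 2)) ^ 2)) ^ ((n : ℝ) / 2)) Filter.atTop
      (nhds ((2 * π) ^ n)) := by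
    have h1 : Filter.Tendsto (fun k => 4 * π ^ 2 / (1 + (ε k) ^ 2)) Filter.atTop (nhds (4 * π ^ 2 / (1 + 0 ^ 2))) :=
      tendsto_const_nhds.div (tendsto_const_nhds.add (hεt.pow 2)) (by norm_num)
    have h2 := h1.rpow_const (p := (n : ℝ) / 2) (Or.inl (by positivity))
    have e : (4 * π ^ 2 / (1 + 0 ^ 2)) ^ ((n : ℝ) / 2) = (2 * π) ^ n := by
      have : (4 * π ^ 2 / (1 + 0 ^ 2)) = (2 * π) ^ (2 : ℝ) := by norm_num; ring
      rw [this, ← Real.rpow_mul (by positivity), ← Real.rpow_natCast]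
      congr 1; ring
    rw [e] at h2
    exact h2
  have hfin := le_of_tendsto_of_tendsto' hL hlim hineq
  refine (ENNReal.ofReal_le_ofReal hfin).trans ?_
  rw [integral_eq_lintegral_of_nonneg_ae]
  · refine ENNReal.ofReal_toReal_le.trans (le_of_eq ?_)
    congr 1
    ext p
    rw [mul_assoc, ← ENNReal.ofReal_mul (Real.exp_pos _).le, ← Real.exp_add, ← ENNReal.ofReal_mul (abs_nonneg _), neg_add]
  · filter_upwards with p
    positivity
  · refine Measurable.aestronglyMeasurable ?_
    refine (psiDer_measurable (bary_hasFDeriv h)).mul ?_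
    exact (by fun_prop : Continuous _).measurable
end B2

section C1
variable {n : ℕ}

lemma lc_mid {F : EE n → ℝ} (hF : IsLogConcave F) (x y : EE n) :
    F x * F y ≤ F ((1/2 : ℝ) • (x + y)) ^ 2 := by
  have h := hF.2 x y (1/2) (by norm_num) (by norm_num)
  have e : (1 : ℝ) - 1/2 = 1/2 := by norm_num
  rw [e, ← smul_add, ← Real.sqrt_eq_rpow, ← Real.sqrt_eq_rpow, ← Real.sqrt_mul (hF.1 x)] at h
  exact Real.sqrt_le_left (hF.1 _) |>.1 h

lemma lc_convex {F : EE n → ℝ} (hF : IsLogConcave F) : Convex ℝ {x | 0 < F x} := by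
  intro x hx y hy a b ha hb hab
  have hb' : b = 1 - a := by linarith
  subst hb'
  refine lt_of_lt_of_le ?_ (hF.2 x y a ha (by linarith))
  have hx' : 0 < F x := hx
  have hy' : 0 < F y := hy
  positivity

lemma lc_concave {F : EE n → ℝ} (hF : IsLogConcave F) :
    ConcaveOn ℝ {x | 0 < F x} (fun x => Real.log (F x)) := by
  refine ⟨lc_convex hF, ?_⟩
  intro x hx y hy a b ha hb hab
  have hb' : b = 1 - a := by linarith
  subst hb'
  have hx' : 0 < F x := hx
  have hy' : 0 < F y := hy
  have := Real.log_le_log (by positivity) (hF.2 x y a ha (by linarith))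
  rw [Real.log_mul (by positivity) (by positivity), Real.log_rpow hx', Real.log_rpow hy'] at this
  simpa using this

lemma lc_subgrad {F : EE n → ℝ} (hF : IsLogConcave F) (ho : IsOpen {x | 0 < F x}) {y : EE n} (hy : 0 < F y) :
    ∃ ζ : EE n, ∀ x, F x ≤ F y * Real.exp (inner ℝ ζ (x - y)) := by
  have hc := lc_concave hF
  have hcont := hc.continuousOn ho
  set H : Set (EE n × ℝ) := {p | p.1 ∈ {x | 0 < F x} ∧ p.2 < Real.log (F p.1)} with hH
  have hHc : Convex ℝ H := hc.convex_strict_hypograph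
  have hHo : IsOpen H := by
    have e : H = (({x | 0 < F x} ×ˢ (Set.univ : Set ℝ)) ∩ (fun p : EE n × ℝ => Real.log (F p.1) - p.2) ⁻¹' Set.Ioi 0) := by
      ext p; simp [hH]
    rw [e]
    refine ContinuousOn.isOpen_inter_preimage ?_ (ho.prod isOpen_univ) isOpen_Ioi
    refine ContinuousOn.sub ?_ continuousOn_snd
    exact hcont.comp continuousOn_fst (fun p hp => hp.1)
  obtain ⟨f, hf⟩ := geometric_hahn_banach_open_point (x := (y, Real.log (F y))) hHc hHo (by simp [hH])
  set c := f (0, 1) with hcdef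
  have hdec : ∀ x t, f (x, t) = f (x, 0) + t * c := by
    intro x t
    have : ((x, t) : EE n × ℝ) = (x, 0) + t • (0, 1) := by simp
    rw [this, map_add, map_smul]; simp [hcdef]
  have hcpos : 0 < c := by
    have := hf (y, Real.log (F y) - 1) ⟨hy, by simp⟩
    rw [hdec, hdec y (Real.log (F y))] at this
    nlinarith
  set φ : EE n →L[ℝ] ℝ := (-(1/c)) • f.comp (ContinuousLinearMap.inl ℝ (EE n) ℝ) with hφ
  refine ⟨(InnerProductSpace.toDual ℝ (EE n)).symm φ, fun x => ?_⟩
  rw [InnerProductSpace.toDual_symm_apply]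
  rcases (hF.1 x).eq_or_lt with h0 | h0
  · rw [← h0]; positivity
  have key : f (x, 0) + Real.log (F x) * c ≤ f (y, 0) + Real.log (F y) * c := by
    refine le_of_forall_pos_lt_add fun ε hε => ?_
    have := hf (x, Real.log (F x) - ε / c) ⟨h0, by simp; positivity⟩
    rw [hdec, hdec y (Real.log (F y))] at this
    have e : (Real.log (F x) - ε / c) * c = Real.log (F x) * c - ε := by field_simp
    linarith
  have e2 : φ (x - y) = (f (y, 0) - f (x, 0)) / c := by
    simp only [hφ, map_sub]
    simp
    field_simp
    ring
  rw [e2]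
  have : Real.log (F x) ≤ Real.log (F y) + (f (y, 0) - f (x, 0)) / c := by
    rw [← sub_le_iff_le_add', le_div_iff₀ hcpos]
    linarith
  calc F x = Real.exp (Real.log (F x)) := (Real.exp_log h0).symm
    _ ≤ Real.exp (Real.log (F y) + (f (y, 0) - f (x, 0)) / c) := Real.exp_le_exp.2 this
    _ = _ := by rw [Real.exp_add, Real.exp_log hy]

/-- The measure with density F. -/
noncomputable def dm (F : EE n → ℝ) : Measure (EE n) := volume.withDensity (fun x => ENNReal.ofReal (F x))

lemma dm_integrable {F : EE n → ℝ} (hm : Measurable F) (h0 : ∀ x, 0 ≤ F x) {W : Type*} [NormedAddCommGroup W]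
    [NormedSpace ℝ W] {g : EE n → W} : Integrable g (dm F) ↔ Integrable (fun x => F x • g x) := by
  rw [dm, integrable_withDensity_iff_integrable_smul' (by fun_prop) (by simp)]
  simp only [ENNReal.toReal_ofReal (h0 _)]

lemma dm_integral {F : EE n → ℝ} (hm : Measurable F) (h0 : ∀ x, 0 ≤ F x) {W : Type*} [NormedAddCommGroup W]
    [NormedSpace ℝ W] (g : EE n → W) : ∫ x, g x ∂(dm F) = ∫ x, F x • g x := by
  rw [dm, integral_withDensity_eq_integral_toReal_smul (by fun_prop) (by simp)]
  simp only [ENNReal.toReal_ofReal (h0 _)]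

lemma dm_ae_pos {F : EE n → ℝ} (hm : Measurable F) : ∀ᵐ x ∂(dm F), 0 < F x := by
  rw [dm, ae_withDensity_iff (by fun_prop)]
  filter_upwards with x hx
  simpa using hx

lemma bary_mem {F : EE n → ℝ} {R : ℝ} (hF : IsLogConcave F) (hm : Measurable F) (ho : IsOpen {x | 0 < F x})
    (h : CptP (dm F) R) (ξ : EE n) : 0 < F (bary (dm F) ξ) := by
  by_contra hcon
  obtain ⟨f, hf⟩ := geometric_hahn_banach_open_point (lc_convex hF) ho hcon
  have ht := h.tl ξ
  have := ht.prob
  have hae : ∀ᵐ x ∂(tl (dm F) ξ), 0 < F x := (tilted_absolutelyContinuous _ _) (dm_ae_pos hm)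
  have hi : Integrable (fun x => f (bary (dm F) ξ) - f x) (tl (dm F) ξ) := ht.int (by fun_prop)
  have h1 : ∫ x, (f (bary (dm F) ξ) - f x) ∂(tl (dm F) ξ) = 0 := by
    rw [integral_sub (integrable_const _) (ht.int (by fun_prop)), f.integral_comp_comm (ht.int (g := fun x => x) continuous_id)]
    simp [bary]
  have h2 := (integral_eq_zero_iff_of_nonneg_ae (by filter_upwards [hae] with x hx; simpa using (hf x hx).le) hi).1 h1
  have h3 : ∀ᵐ x ∂(tl (dm F) ξ), False := by
    filter_upwards [h2, hae] with x hx hx'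
    have := hf x hx'
    simp at hx
    linarith
  have h4 : (ae (tl (dm F) ξ)) = ⊥ := by simpa using h3
  rw [ae_eq_bot] at h4
  exact IsProbabilityMeasure.ne_zero _ h4

/-- Key pointwise bound. -/
lemma key_C {F : EE n → ℝ} {R : ℝ} (hF : IsLogConcave F) (hm : Measurable F) (ho : IsOpen {x | 0 < F x})
    (h : CptP (dm F) R) (hF0 : 0 < F 0) (ξ : EE n) :
    F 0 * Real.exp (-inner ℝ ξ (bary (dm F) ξ)) ≤ 4 ^ n * F (bary (dm F) ξ) := by
  set y := bary (dm F) ξ with hy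
  have hpos : 0 < F y := bary_mem hF hm ho h ξ
  obtain ⟨ζ, hζ⟩ := lc_subgrad hF ho hpos
  set k : EE n → ℝ := fun x => F x * Real.exp (inner ℝ ξ x) with hk
  have hk0 : ∀ x, 0 ≤ k x := fun x => mul_nonneg (hF.1 x) (Real.exp_pos _).le
  have hkm : Measurable k := hm.mul (by fun_prop : Continuous fun x : EE n => Real.exp (inner ℝ ξ x)).measurable
  have hky : 0 < k y := mul_pos hpos (Real.exp_pos _)
  have hintg : ∀ {g : EE n → ℝ}, Continuous g → Integrable (fun x => k x * g x) := by
    intro g hg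
    have h1 : Integrable (fun x => Real.exp (inner ℝ ξ x) * g x) (dm F) := h.int (by fun_prop)
    have := (dm_integrable hm hF.1).1 h1
    refine this.congr ?_
    filter_upwards with x
    simp [hk]; ring
  have hM : ∫ x, k x = MM (dm F) ξ := by
    rw [MM, dm_integral hm hF.1]; rfl
  have hMpos := h.MM_pos ξ
  set M := MM (dm F) ξ
  have hki : Integrable k := by simpa using hintg (g := fun _ => 1) continuous_const
  -- zero mean
  set θ := ζ + ξ
  have hkle : ∀ x, k x ≤ k y * Real.exp (inner ℝ θ (x - y)) := by
    intro x
    have := mul_le_mul_of_nonneg_right (hζ x) (Real.exp_pos (inner ℝ ξ x)).le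
    refine this.trans (le_of_eq ?_)
    simp only [hk, θ, mul_assoc, ← Real.exp_add, inner_add_left, inner_sub_right]
    congr 2; ring
  have hzero : ∫ x, k x * inner ℝ θ (x - y) = 0 := by
    have ht := h.tl ξ
    have := ht.prob
    have h1 : ∫ x, inner ℝ θ (x - y) ∂(tl (dm F) ξ) = 0 := by
      simp only [inner_sub_right]
      rw [integral_sub (ht.int (by fun_prop)) (integrable_const _), integral_inner (ht.int (g := fun x => x) continuous_id)]
      simp [hy, bary]
    rw [tl_integral, dm_integral hm hF.1] at h1
    have h2 : (∫ x, F x • Real.exp (inner ℝ ξ x) • inner ℝ θ (x - y)) = 0 := by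
      rcases smul_eq_zero.1 h1 with h | h
      · exact absurd h (inv_ne_zero hMpos.ne')
      · exact h
    rw [← h2]
    congr 1; ext x; simp [hk, mul_assoc]
  -- upper bound
  have hup : ∀ x, Real.sqrt (F 0) * Real.sqrt (k x) ≤ k ((1/2 : ℝ) • x) := by
    intro x
    rw [← Real.sqrt_mul (hF.1 0)]
    refine Real.sqrt_le_iff.2 ⟨hk0 _, ?_⟩
    have h1 := lc_mid hF 0 x
    rw [zero_add] at h1
    simp only [hk]
    rw [mul_pow, ← Real.exp_nat_mul, inner_smul_right]
    have e : (((2 : ℕ) : ℝ) * (1 / 2 * inner ℝ ξ x)) = inner ℝ ξ x := by push_cast; ring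
    rw [e, ← mul_assoc]
    exact mul_le_mul_of_nonneg_right h1 (Real.exp_pos _).le
  have hki2 : Integrable (fun x => k ((1/2 : ℝ) • x)) := hki.comp_smul (by norm_num)
  have hsF0 : 0 < Real.sqrt (F 0) := Real.sqrt_pos.2 hF0
  have hsi : Integrable (fun x => Real.sqrt (F 0) * Real.sqrt (k x)) := by
    refine hki2.mono' (by fun_prop) ?_
    filter_upwards with x
    rw [Real.norm_of_nonneg (by positivity)]
    exact hup x
  have hU : ∫ x, Real.sqrt (F 0) * Real.sqrt (k x) ≤ 2 ^ n * M := by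
    refine (integral_mono hsi hki2 hup).trans (le_of_eq ?_)
    rw [Measure.integral_comp_smul, hM]
    simp
  -- lower bound
  have hlow : ∀ x, k x * (1 - inner ℝ θ (x - y) / 2) ≤ Real.sqrt (k y) * Real.sqrt (k x) := by
    intro x
    have h1 : k x ≤ (Real.sqrt (k y) * Real.exp (inner ℝ θ (x - y) / 2)) ^ 2 := by
      rw [mul_pow, Real.sq_sqrt (hk0 y), ← Real.exp_nat_mul]
      refine (hkle x).trans (le_of_eq ?_)
      congr 2; push_cast; ring
    have h2 : Real.sqrt (k x) ≤ Real.sqrt (k y) * Real.exp (inner ℝ θ (x - y) / 2) :=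
      Real.sqrt_le_iff.2 ⟨by positivity, h1⟩
    have h3 : 1 - inner ℝ θ (x - y) / 2 ≤ Real.exp (-(inner ℝ θ (x - y) / 2)) := by
      have := Real.add_one_le_exp (-(inner ℝ θ (x - y) / 2)); linarith
    calc k x * (1 - inner ℝ θ (x - y) / 2) ≤ k x * Real.exp (-(inner ℝ θ (x - y) / 2)) :=
          mul_le_mul_of_nonneg_left h3 (hk0 x)
      _ = Real.sqrt (k x) * Real.sqrt (k x) * Real.exp (-(inner ℝ θ (x - y) / 2)) := by
          rw [Real.mul_self_sqrt (hk0 x)]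
      _ ≤ (Real.sqrt (k y) * Real.exp (inner ℝ θ (x - y) / 2)) * Real.sqrt (k x) * Real.exp (-(inner ℝ θ (x - y) / 2)) := by
          gcongr
      _ = Real.sqrt (k y) * Real.sqrt (k x) * (Real.exp (inner ℝ θ (x - y) / 2) * Real.exp (-(inner ℝ θ (x - y) / 2))) := by ring
      _ = _ := by rw [← Real.exp_add]; simp
  have hsi' : Integrable (fun x => Real.sqrt (k x)) := by
    have := hsi.const_mul (Real.sqrt (F 0))⁻¹
    refine this.congr ?_
    filter_upwards with x
    field_simp
  have hL : M ≤ ∫ x, Real.sqrt (k y) * Real.sqrt (k x) := by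
    have := integral_mono (hintg (g := fun x => 1 - inner ℝ θ (x - y) / 2) (by fun_prop)) (hsi'.const_mul (Real.sqrt (k y))) hlow
    refine le_trans (le_of_eq ?_) this
    have e : ∀ x, k x * (1 - inner ℝ θ (x - y) / 2) = k x - (k x * inner ℝ θ (x - y)) / 2 := by intro x; ring
    simp only [e]
    rw [integral_sub hki ((hintg (g := fun x => inner ℝ θ (x - y)) (by fun_prop)).div_const 2), integral_div, hzero, hM]
    simp
  rw [integral_const_mul] at hU hL
  set I := ∫ x, Real.sqrt (k x)
  have hI0 : 0 ≤ I := integral_nonneg fun x => Real.sqrt_nonneg _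
  have h5 : Real.sqrt (F 0) ≤ 2 ^ n * Real.sqrt (k y) := by
    have : Real.sqrt (F 0) * M ≤ 2 ^ n * Real.sqrt (k y) * M := by
      calc Real.sqrt (F 0) * M ≤ Real.sqrt (F 0) * (Real.sqrt (k y) * I) := by gcongr
        _ = Real.sqrt (k y) * (Real.sqrt (F 0) * I) := by ring
        _ ≤ Real.sqrt (k y) * (2 ^ n * M) := by gcongr
        _ = _ := by ring
    exact le_of_mul_le_mul_right this hMpos
  have h6 : F 0 ≤ 4 ^ n * k y := by
    have h7 := pow_le_pow_left₀ hsF0.le h5 2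
    rw [Real.sq_sqrt hF0.le, mul_pow, Real.sq_sqrt hky.le, ← pow_mul, mul_comm n 2, pow_mul] at h7
    norm_num at h7
    exact h7
  calc F 0 * Real.exp (-inner ℝ ξ y) ≤ (4 ^ n * k y) * Real.exp (-inner ℝ ξ y) := by gcongr
    _ = 4 ^ n * F y * (Real.exp (inner ℝ ξ y) * Real.exp (-inner ℝ ξ y)) := by simp only [hk]; ring
    _ = _ := by rw [← Real.exp_add]; simp
end C1

section D1
variable {n : ℕ}

/-- Even log-concave density with bounded open support. -/
structure EvenD (F : EE n → ℝ) (R : ℝ) : Prop where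
  lc : IsLogConcave F
  meas : Measurable F
  opn : IsOpen {x | 0 < F x}
  cpt : CptP (dm F) R
  even : ∀ x, F (-x) = F x
  pos0 : 0 < F 0

lemma EvenD.sym {F : EE n → ℝ} {R : ℝ} (h : EvenD F R) : SymM (dm F) := by
  have hF := h.meas
  unfold SymM
  ext s hs
  rw [Measure.map_apply (by fun_prop) hs, dm, withDensity_apply _ hs, withDensity_apply _ (measurable_neg hs)]
  rw [← lintegral_indicator hs, ← lintegral_indicator (measurable_neg hs)]
  rw [← lintegral_neg_eq_self]
  congr 1; ext x
  simp only [Set.indicator, Set.mem_preimage]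
  have e : (-x ∈ Neg.neg ⁻¹' s) = (x ∈ s) := by rw [Set.mem_preimage, neg_neg]
  rw [h.even]
  by_cases hx : x ∈ s
  · rw [if_pos hx, if_pos (e ▸ hx)]
  · rw [if_neg hx, if_neg (fun h' => hx (e ▸ h'))]

lemma EvenD.lint {F : EE n → ℝ} {R : ℝ} (h : EvenD F R) : ∫⁻ x, ENNReal.ofReal (F x) = 1 := by
  have := h.cpt.prob.measure_univ
  rwa [dm, withDensity_apply _ MeasurableSet.univ, Measure.restrict_univ] at this

lemma lint_smul (g : EE n → ENNReal) {r : ℝ} (hr : 0 < r) :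
    ∫⁻ x, g (r • x) = ENNReal.ofReal ((r ^ n)⁻¹) * ∫⁻ x, g x := by
  have h1 := Measure.map_addHaar_smul (volume : Measure (EE n)) hr.ne'
  have h2 : ∫⁻ x, g x ∂(Measure.map (fun x : EE n => r • x) volume) = ∫⁻ x, g (r • x) :=
    lintegral_map_equiv g (MeasurableEquiv.smul₀ r hr.ne')
  rw [← h2, h1, lintegral_smul_measure]
  simp [abs_of_pos hr]

lemma rev_santalo {F : EE n → ℝ} {R : ℝ} (h : EvenD F R) (hn : 1 ≤ n) :
    ENNReal.ofReal ((2 * π) ^ n) ≤ ENNReal.ofReal (4 ^ n / F 0) * (4 ^ n * ∫⁻ ξ, ENNReal.ofReal (Real.exp (-LL (dm F) ξ))) := by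
  haveI : (volume : Measure (EE n × EE n)).IsAddHaarMeasure :=
    inferInstanceAs ((volume : Measure (EE n)).prod (volume : Measure (EE n))).IsAddHaarMeasure
  have hc := h.cpt
  have hF0 := h.pos0
  set ν := dm F with hν
  set κ : ℝ := 4 ^ n / F 0 with hκ
  have hκ0 : 0 < κ := by positivity
  have hkey : ∀ ξ, Real.exp (-inner ℝ ξ (bary ν ξ)) ≤ κ * F (bary ν ξ) := by
    intro ξ
    have := key_C h.lc h.meas h.opn hc hF0 ξ
    rw [hκ, div_mul_eq_mul_div, le_div_iff₀ hF0]
    linarith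
  have hsq : ∀ ξ, Real.exp (-inner ℝ ξ (bary ν ξ)) ^ 2 ≤ Real.exp (-LL ν ξ) * (κ * F (bary ν ξ)) := by
    intro ξ
    rw [pow_two]
    refine mul_le_mul ?_ (hkey ξ) (Real.exp_pos _).le (Real.exp_pos _).le
    have := LL_le_inner hc ξ
    exact Real.exp_le_exp.2 (by linarith)
  set Φ : EE n × EE n → ENNReal := fun q => ENNReal.ofReal (Real.exp (-LL ν ((1/2 : ℝ) • q.1))) *
    (ENNReal.ofReal κ * ENNReal.ofReal (F ((1/2 : ℝ) • q.2))) with hΦ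
  have hpt : ∀ p : EE n × EE n, ENNReal.ofReal (Real.exp (-inner ℝ p.1 (bary ν p.1))) * ENNReal.ofReal (Real.exp (-inner ℝ p.2 (bary ν p.2)))
      ≤ Φ (psiMap (bary ν) 1 1 p) := by
    intro p
    simp only [hΦ, psiMap, one_smul]
    rw [← ENNReal.ofReal_mul (Real.exp_pos _).le, ← ENNReal.ofReal_mul hκ0.le, ← ENNReal.ofReal_mul (Real.exp_pos _).le]
    refine ENNReal.ofReal_le_ofReal ?_
    have hFn := h.lc.1
    refine le_of_sq_le_sq ?_ (by have := hFn ((1/2 : ℝ) • (bary ν p.1 - bary ν p.2)); positivity)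
    have h1 := LL_mid hc p.1 p.2
    have h2 := lc_mid h.lc (bary ν p.1) (-bary ν p.2)
    rw [h.even, ← sub_eq_add_neg] at h2
    have h3 : Real.exp (-LL ν p.1) * Real.exp (-LL ν p.2) ≤ Real.exp (-LL ν ((1/2 : ℝ) • (p.1 + p.2))) ^ 2 := by
      rw [← Real.exp_add, ← Real.exp_nat_mul]
      refine Real.exp_le_exp.2 ?_
      push_cast; linarith
    calc (Real.exp (-inner ℝ p.1 (bary ν p.1)) * Real.exp (-inner ℝ p.2 (bary ν p.2))) ^ 2
        = Real.exp (-inner ℝ p.1 (bary ν p.1)) ^ 2 * Real.exp (-inner ℝ p.2 (bary ν p.2)) ^ 2 := by ring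
      _ ≤ (Real.exp (-LL ν p.1) * (κ * F (bary ν p.1))) * (Real.exp (-LL ν p.2) * (κ * F (bary ν p.2))) := by
          have := hFn (bary ν p.1)
          exact mul_le_mul (hsq p.1) (hsq p.2) (by positivity) (by positivity)
      _ = (Real.exp (-LL ν p.1) * Real.exp (-LL ν p.2)) * (κ ^ 2 * (F (bary ν p.1) * F (bary ν p.2))) := by ring
      _ ≤ Real.exp (-LL ν ((1/2 : ℝ) • (p.1 + p.2))) ^ 2 * (κ ^ 2 * F ((1/2 : ℝ) • (bary ν p.1 - bary ν p.2)) ^ 2) := by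
          have := hFn (bary ν p.1); have := hFn (bary ν p.2)
          gcongr
      _ = _ := by ring
  have hLc := LL_cont hc
  have hFm := h.meas
  have hder : ∀ p ∈ (Set.univ : Set (EE n × EE n)), HasFDerivWithinAt (psiMap (bary ν) 1 1) (psiDer (covA ν) p) Set.univ p := by
    intro p _
    have := psiMap_hasFDerivAt (bary_hasFDeriv hc) 1 1 p
    rw [diagMap_one, ContinuousLinearMap.comp_id] at this
    exact this.hasFDerivWithinAt
  have hchange := lintegral_image_eq_lintegral_abs_det_fderiv_mul (volume : Measure (EE n × EE n)) MeasurableSet.univ hder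
    ((psiMap_injective (bary_strict hc) one_pos one_pos).injOn) Φ
  have h4 := main_lower hc h.sym hn
  refine h4.trans ?_
  have h5 : (∫⁻ p, ENNReal.ofReal |(psiDer (covA ν) p).det| * ENNReal.ofReal (Real.exp (-inner ℝ p.1 (bary ν p.1))) *
      ENNReal.ofReal (Real.exp (-inner ℝ p.2 (bary ν p.2)))) ≤ ∫⁻ p, Φ p := by
    calc _ ≤ ∫⁻ p, ENNReal.ofReal |(psiDer (covA ν) p).det| * Φ (psiMap (bary ν) 1 1 p) := by
          refine lintegral_mono fun p => ?_
          rw [mul_assoc]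
          exact mul_le_mul_right (hpt p) _
      _ ≤ ∫⁻ p, Φ p := by
          rw [Measure.restrict_univ] at hchange
          rw [← hchange]
          exact setLIntegral_le_lintegral _ _
  refine h5.trans (le_of_eq ?_)
  have h6 : (∫⁻ p, Φ p) = (∫⁻ a, ENNReal.ofReal (Real.exp (-LL ν ((1/2 : ℝ) • a)))) *
      (∫⁻ b, (ENNReal.ofReal κ * ENNReal.ofReal (F ((1/2 : ℝ) • b)))) := by
    rw [Measure.volume_eq_prod]
    have m1 : AEMeasurable (fun a : EE n => ENNReal.ofReal (Real.exp (-LL ν ((1/2 : ℝ) • a)))) volume := by fun_prop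
    have m2 : AEMeasurable (fun b : EE n => ENNReal.ofReal κ * ENNReal.ofReal (F ((1/2 : ℝ) • b))) volume := by fun_prop
    exact lintegral_prod_mul m1 m2
  rw [h6, lintegral_const_mul _ (by fun_prop), lint_smul (fun a => ENNReal.ofReal (Real.exp (-LL ν a))) (by norm_num),
    lint_smul (fun a => ENNReal.ofReal (F a)) (by norm_num), h.lint]
  have e : ENNReal.ofReal ((((1:ℝ)/2) ^ n)⁻¹) = 2 ^ n := by
    rw [← inv_pow]
    norm_num
  rw [e]
  have e4 : (4 : ENNReal) ^ n = 2 ^ n * 2 ^ n := by rw [← mul_pow]; norm_num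
  rw [e4]
  ring

lemma det_int {F : EE n → ℝ} {R : ℝ} (h : EvenD F R) :
    ∫⁻ ξ, ENNReal.ofReal |(covA (dm F) ξ).det| * ENNReal.ofReal (Real.exp (-inner ℝ ξ (bary (dm F) ξ))) ≤ ENNReal.ofReal (4 ^ n / F 0) := by
  have hc := h.cpt
  have hF0 := h.pos0
  set ν := dm F with hν
  set κ : ℝ := 4 ^ n / F 0 with hκ
  have hκ0 : 0 < κ := by positivity
  have hkey : ∀ ξ, Real.exp (-inner ℝ ξ (bary ν ξ)) ≤ κ * F (bary ν ξ) := by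
    intro ξ
    have := key_C h.lc h.meas h.opn hc hF0 ξ
    rw [hκ, div_mul_eq_mul_div, le_div_iff₀ hF0]
    linarith
  have hinj : Function.Injective (bary ν) := by
    intro x z hxz
    by_contra hne
    have := bary_strict hc x z hne
    simp [hxz] at this
  have hFm := h.meas
  have hchange := lintegral_image_eq_lintegral_abs_det_fderiv_mul (volume : Measure (EE n)) MeasurableSet.univ
    (fun x _ => (bary_hasFDeriv hc x).hasFDerivWithinAt) hinj.injOn (fun y => ENNReal.ofReal κ * ENNReal.ofReal (F y))
  calc _ ≤ ∫⁻ ξ, ENNReal.ofReal |(covA ν ξ).det| * (ENNReal.ofReal κ * ENNReal.ofReal (F (bary ν ξ))) := by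
        refine lintegral_mono fun p => ?_
        rw [← ENNReal.ofReal_mul hκ0.le]
        exact mul_le_mul_right (ENNReal.ofReal_le_ofReal (hkey p)) _
    _ ≤ ∫⁻ y, ENNReal.ofReal κ * ENNReal.ofReal (F y) := by
        rw [Measure.restrict_univ] at hchange
        rw [← hchange]
        exact setLIntegral_le_lintegral _ _
    _ = _ := by
        rw [lintegral_const_mul _ (by fun_prop), h.lint, mul_one]

lemma klartag {F : EE n → ℝ} {R : ℝ} (h : EvenD F R) (hn : 1 ≤ n) :
    ∃ ξ, LL (dm F) ((2:ℝ) • ξ) ≤ 4 * n ∧ |(covA (dm F) ξ).det| ≤ 4 * (4 ^ n / F 0) ^ 2 * 2 ^ n := by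
  by_contra hcon
  push Not at hcon
  have hc := h.cpt
  have hF0 := h.pos0
  have hdet := det_int h
  have hsan := rev_santalo h hn
  set ν := dm F with hν
  set κ : ℝ := 4 ^ n / F 0 with hκ
  have hκ0 : 0 < κ := by positivity
  have hLc := LL_cont hc
  set Z := ∫⁻ ξ, ENNReal.ofReal (Real.exp (-LL ν ξ)) with hZ
  have hZt : Z ≠ ⊤ := by
    have := (expLL_int hc h.sym hn).lintegral_lt_top
    exact this.ne
  have hZlow : 1 ≤ ENNReal.ofReal κ * Z := by
    have h1 : (4 : ENNReal) ^ n ≤ ENNReal.ofReal ((2 * π) ^ n) := by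
      rw [ENNReal.ofReal_pow (by positivity)]
      gcongr
      rw [show (4 : ENNReal) = ENNReal.ofReal 4 by norm_num]
      exact ENNReal.ofReal_le_ofReal (by linarith [Real.two_le_pi])
    have h2 : (4 : ENNReal) ^ n * 1 ≤ 4 ^ n * (ENNReal.ofReal κ * Z) := by
      rw [mul_one]
      refine (h1.trans hsan).trans (le_of_eq (by ring))
    exact (ENNReal.mul_le_mul_iff_right (by positivity) (by finiteness)).1 h2
  set w : EE n → ENNReal := fun ξ => ENNReal.ofReal (Real.exp (-LL ν ((2:ℝ) • ξ))) with hw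
  have hwm : Measurable w := by fun_prop
  have hW : ∫⁻ ξ, w ξ = ENNReal.ofReal ((2 ^ n)⁻¹) * Z :=
    lint_smul (fun ξ => ENNReal.ofReal (Real.exp (-LL ν ξ))) (by norm_num)
  set W := ∫⁻ ξ, w ξ with hWdef
  set S : Set (EE n) := {ξ | LL ν ((2:ℝ) • ξ) ≤ 4 * n} with hS
  have hSm : MeasurableSet S := measurableSet_le (by fun_prop) measurable_const
  have hbad : ∫⁻ ξ in Sᶜ, w ξ ≤ W / 2 := by
    calc ∫⁻ ξ in Sᶜ, w ξ ≤ ∫⁻ ξ in Sᶜ, ENNReal.ofReal (Real.exp (-(2 * n))) * ENNReal.ofReal (Real.exp (-LL ν ξ)) := by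
          refine setLIntegral_mono' hSm.compl fun ξ hξ => ?_
          rw [← ENNReal.ofReal_mul (Real.exp_pos _).le, ← Real.exp_add]
          refine ENNReal.ofReal_le_ofReal (Real.exp_le_exp.2 ?_)
          have h1 := LL_half hc ξ
          have h2 : 4 * (n:ℝ) < LL ν ((2:ℝ) • ξ) := by simpa [hS] using hξ
          linarith
      _ ≤ ∫⁻ ξ, ENNReal.ofReal (Real.exp (-(2 * n))) * ENNReal.ofReal (Real.exp (-LL ν ξ)) := setLIntegral_le_lintegral _ _
      _ = ENNReal.ofReal (Real.exp (-(2 * n))) * Z := lintegral_const_mul _ (by fun_prop)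
      _ ≤ ENNReal.ofReal ((2 ^ n)⁻¹ / 2) * Z := by
          gcongr
          have h3 : Real.exp (-(2 * (n:ℝ))) ≤ (1/4) ^ n := by
            have : Real.exp (-(2 * (n:ℝ))) = (Real.exp (-2)) ^ n := by rw [← Real.exp_nat_mul]; congr 1; ring
            rw [this]
            gcongr
            rw [Real.exp_neg]
            have h4 : (4:ℝ) ≤ Real.exp 2 := by
              have := Real.add_one_le_exp (1:ℝ)
              have e : Real.exp 2 = Real.exp 1 * Real.exp 1 := by rw [← Real.exp_add]; norm_num
              rw [e]; nlinarith
            rw [one_div]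
            gcongr
          refine h3.trans ?_
          have h5 : ((1:ℝ)/4) ^ n = (1/2) ^ n * (1/2)^n := by rw [← mul_pow]; norm_num
          have h6 : ((1:ℝ)/2) ^ n ≤ 1/2 := by
            calc ((1:ℝ)/2) ^ n ≤ (1/2)^1 := pow_le_pow_of_le_one (by norm_num) (by norm_num) hn
              _ = 1/2 := by norm_num
          have h7 : ((2:ℝ) ^ n)⁻¹ = (1/2) ^ n := by simp
          rw [h5, h7]
          have h8 : (0:ℝ) ≤ (1/2) ^ n := by positivity
          nlinarith
      _ = W / 2 := by
          rw [hW, ENNReal.ofReal_div_of_pos (by norm_num), ENNReal.div_eq_inv_mul, ENNReal.div_eq_inv_mul, mul_assoc]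
          norm_num
  have hWt : W ≠ ⊤ := by rw [hW]; finiteness
  have hgood : W / 2 ≤ ∫⁻ ξ in S, w ξ := by
    have h1 := lintegral_add_compl w hSm (μ := volume)
    have h2 : W / 2 + W / 2 ≤ (∫⁻ ξ in S, w ξ) + W / 2 := by
      rw [ENNReal.add_halves]
      exact h1.symm.le.trans (add_le_add le_rfl hbad)
    exact ENNReal.le_of_add_le_add_right (by finiteness) h2
  set D : ℝ := 4 * κ ^ 2 * 2 ^ n with hD
  have hD0 : 0 < D := by positivity
  have hfin : ENNReal.ofReal D * (W / 2) ≤ ENNReal.ofReal κ := by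
    refine le_trans ?_ hdet
    calc ENNReal.ofReal D * (W / 2) ≤ ENNReal.ofReal D * ∫⁻ ξ in S, w ξ := mul_le_mul' le_rfl hgood
      _ = ∫⁻ ξ in S, ENNReal.ofReal D * w ξ := (lintegral_const_mul _ hwm).symm
      _ ≤ ∫⁻ ξ in S, ENNReal.ofReal |(covA ν ξ).det| * ENNReal.ofReal (Real.exp (-inner ℝ ξ (bary ν ξ))) := by
          refine setLIntegral_mono' hSm fun ξ hξ => ?_
          refine mul_le_mul' (ENNReal.ofReal_le_ofReal (hcon ξ hξ).le) (ENNReal.ofReal_le_ofReal (Real.exp_le_exp.2 ?_))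
          have := inner_le_LL hc ξ
          have := LL_nonneg hc h.sym ξ
          linarith
      _ ≤ _ := setLIntegral_le_lintegral _ _
  have hWlow : ENNReal.ofReal ((2 ^ n)⁻¹ ) ≤ ENNReal.ofReal κ * W := by
    rw [hW]
    calc ENNReal.ofReal ((2 ^ n)⁻¹) = ENNReal.ofReal ((2 ^ n)⁻¹) * 1 := by rw [mul_one]
      _ ≤ ENNReal.ofReal ((2 ^ n)⁻¹) * (ENNReal.ofReal κ * Z) := by gcongr
      _ = _ := by ring
  have h8 : ENNReal.ofReal (2 * κ) ≤ ENNReal.ofReal D * (W / 2) := by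
    calc ENNReal.ofReal (2 * κ) = ENNReal.ofReal (2 * κ * 2 ^ n) * ENNReal.ofReal ((2 ^ n)⁻¹) := by
          rw [← ENNReal.ofReal_mul (by positivity)]
          congr 1
          field_simp
      _ ≤ ENNReal.ofReal (2 * κ * 2 ^ n) * (ENNReal.ofReal κ * W) := by gcongr
      _ = ENNReal.ofReal (D / 2) * W := by
          rw [← mul_assoc, ← ENNReal.ofReal_mul (by positivity)]
          congr 2
          rw [hD]; ring
      _ = _ := by
          rw [ENNReal.ofReal_div_of_pos (by norm_num), ENNReal.div_eq_inv_mul, ENNReal.div_eq_inv_mul]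
          norm_num
          ring
  have h9 := h8.trans hfin
  rw [ENNReal.ofReal_le_ofReal_iff hκ0.le] at h9
  linarith
end D1

section F1
variable {n : ℕ}

lemma cov_pos {ν : Measure (EE n)} {R : ℝ} (h : CptP ν R) (ξ : EE n) {δ : EE n} (hδ : δ ≠ 0) :
    0 < inner ℝ (covA ν ξ δ) δ := by
  rw [covA_inner h]
  have ht := h.tl ξ
  have := ht.prob
  refine lt_of_le_of_ne (integral_nonneg fun x => mul_self_nonneg _) fun h0 => ?_
  have h1 := (integral_eq_zero_iff_of_nonneg (fun x => mul_self_nonneg _)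
    (ht.int (g := fun x => inner ℝ (x - bary ν ξ) δ * inner ℝ (x - bary ν ξ) δ)
      ((by fun_prop : Continuous fun x : EE n => inner ℝ (x - bary ν ξ) δ).mul
        (by fun_prop : Continuous fun x : EE n => inner ℝ (x - bary ν ξ) δ)))).1 h0.symm
  have h2 := ht.strict hδ
  have h3 : ∫ x, Real.exp (inner ℝ δ (x - ∫ z, z ∂(tl ν ξ))) ∂(tl ν ξ) = ∫ x, 1 ∂(tl ν ξ) := by
    refine integral_congr_ae ?_
    filter_upwards [h1] with x hx
    have : inner ℝ (x - bary ν ξ) δ = 0 := by simpa using hx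
    rw [real_inner_comm] at this
    have e : (∫ z, z ∂(tl ν ξ)) = bary ν ξ := rfl
    rw [e, this, Real.exp_zero]
  rw [h3] at h2
  simp at h2

lemma linalg (hn : 1 ≤ n) (A : EE n →L[ℝ] EE n) (hs : ∀ x y, inner ℝ (A x) y = inner ℝ x (A y))
    (hp : ∀ x, x ≠ 0 → 0 < inner ℝ (A x) x) :
    ∃ (T : EE n ≃L[ℝ] EE n) (b : OrthonormalBasis (Fin n) ℝ (EE n)) (c : Fin n → ℝ) (s : ℝ),
      MeasurePreserving T volume volume ∧ (∀ v, ‖T v‖ ^ 2 = ∑ i, c i ^ 2 * (inner ℝ (b i) v) ^ 2) ∧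
      (∀ i, c i ^ 2 * inner ℝ (A (b i)) (b i) = s) ∧ 0 < s ∧ s ^ n = |A.det| := by
  have hsym : (A : EE n →ₗ[ℝ] EE n).IsSymmetric := fun x y => hs x y
  have hfr : Module.finrank ℝ (EE n) = n := by simp
  set b := hsym.eigenvectorBasis hfr with hb
  set l := hsym.eigenvalues hfr with hl
  have hAb : ∀ i, A (b i) = l i • b i := fun i => hsym.apply_eigenvectorBasis hfr i
  have hl' : ∀ i, inner ℝ (A (b i)) (b i) = l i := by
    intro i
    rw [hAb, inner_smul_left]
    simp
  have hlpos : ∀ i, 0 < l i := by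
    intro i
    rw [← hl']
    exact hp _ (b.orthonormal.ne_zero i)
  have hdetA : A.det = ∏ i, l i := by
    have := hsym.det_eq_prod_eigenvalues hfr
    simpa using this
  have hprod : 0 < ∏ i, l i := Finset.prod_pos fun i _ => hlpos i
  set s : ℝ := (∏ i, l i) ^ ((1 : ℝ) / n) with hsdef
  have hspos : 0 < s := Real.rpow_pos_of_pos hprod _
  have hsn : s ^ n = ∏ i, l i := by
    rw [hsdef, ← Real.rpow_natCast, ← Real.rpow_mul hprod.le]
    have : (1 : ℝ) / n * n = 1 := by field_simp
    rw [this, Real.rpow_one]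
  set c : Fin n → ℝ := fun i => Real.sqrt (s / l i) with hc
  have hc2 : ∀ i, c i ^ 2 = s / l i := fun i => Real.sq_sqrt (by have := hlpos i; positivity)
  have hcpos : ∀ i, 0 < c i := fun i => Real.sqrt_pos.2 (div_pos hspos (hlpos i))
  set T0 : EE n →ₗ[ℝ] EE n := Matrix.toLin b.toBasis b.toBasis (Matrix.diagonal c) with hT0
  have hdet : LinearMap.det T0 = ∏ i, c i := by
    rw [hT0, LinearMap.det_toLin, Matrix.det_diagonal]
  have hdet1 : LinearMap.det T0 = 1 := by
    rw [hdet]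
    have hpp : 0 < ∏ i, c i := Finset.prod_pos fun i _ => hcpos i
    have : (∏ i, c i) ^ 2 = 1 := by
      rw [← Finset.prod_pow]
      simp only [hc2]
      rw [Finset.prod_div_distrib, Finset.prod_const, Finset.card_univ, Fintype.card_fin, hsn]
      exact div_self hprod.ne'
    nlinarith
  have hne : LinearMap.det T0 ≠ 0 := by rw [hdet1]; norm_num
  have hTb : ∀ v i, inner ℝ (b i) (T0 v) = c i * inner ℝ (b i) v := by
    intro v i
    have h1 : b.toBasis.repr (T0 v) i = c i * b.toBasis.repr v i := by
      rw [hT0, Matrix.repr_toLin, Matrix.mulVec_diagonal]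
    simpa [OrthonormalBasis.repr_apply_apply] using h1
  refine ⟨(LinearMap.equivOfDetNeZero T0 hne).toContinuousLinearEquiv, b, c, s, ?_, ?_, ?_, hspos, ?_⟩
  · have e : ∀ v, (LinearMap.equivOfDetNeZero T0 hne).toContinuousLinearEquiv v = T0 v := fun v => rfl
    refine ⟨ContinuousLinearEquiv.continuous _ |>.measurable, ?_⟩
    have := Measure.map_linearMap_addHaar_eq_smul_addHaar (volume : Measure (EE n)) hne
    rw [hdet1] at this
    simp only [inv_one, abs_one, ENNReal.ofReal_one, one_smul] at this
    exact this
  · intro v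
    have e : (LinearMap.equivOfDetNeZero T0 hne).toContinuousLinearEquiv v = T0 v := rfl
    rw [e, ← b.sum_sq_norm_inner_right]
    refine Finset.sum_congr rfl fun i _ => ?_
    rw [hTb, Real.norm_eq_abs, sq_abs]; ring
  · intro i
    rw [hl', hc2]
    have := hlpos i
    field_simp
  · rw [hdetA, hsn, abs_of_pos hprod]

lemma even_Mpos {F : EE n → ℝ} {R : ℝ} (h : EvenD F R) (hn : 1 ≤ n) (hlow : ((256 : ℝ) ^ n)⁻¹ ≤ F 0) :
    ∃ (T : EE n ≃L[ℝ] EE n) (m : EE n), MeasurePreserving T volume volume ∧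
      ENNReal.ofReal ((2^10 : ℝ)⁻¹ ^ n) ≤ dm F {x | ‖T x - m‖ ^ 2 ≤ 2 ^ 25 * n} := by
  have hc := h.cpt
  obtain ⟨ξ, hξ1, hξ2⟩ := klartag h hn
  set ν := dm F with hν
  have hνp := hc.prob
  have hA1 : ∀ x y, inner ℝ (covA ν ξ x) y = inner ℝ x (covA ν ξ y) := by
    intro x y
    rw [covA_inner hc, ← real_inner_comm, covA_inner hc]
    congr 1; ext z; ring
  obtain ⟨T, b, c, s, hT, hTn, hcs, hs, hsn⟩ := linalg hn (covA ν ξ) hA1 (fun x hx => cov_pos hc ξ hx)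
  set y := bary ν ξ with hy
  have hn0 : (0 : ℝ) < n := by exact_mod_cast hn
  -- bound on s
  have hs23 : s ≤ 2 ^ 23 := by
    have hF0 := h.pos0
    have h1 : 4 ^ n / F 0 ≤ (2 ^ 10 : ℝ) ^ n := by
      rw [div_le_iff₀ hF0]
      calc (4 : ℝ) ^ n = (2^10) ^ n * ((256 : ℝ) ^ n)⁻¹ := by
            rw [← inv_pow, ← mul_pow]; norm_num
        _ ≤ _ := by gcongr
    have h2 : s ^ n ≤ (2 ^ 23) ^ n := by
      rw [hsn]
      refine hξ2.trans ?_
      have h4 : (4 : ℝ) ≤ 4 ^ n := by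
        calc (4:ℝ) = 4 ^ 1 := by norm_num
          _ ≤ 4 ^ n := pow_le_pow_right₀ (by norm_num) hn
      calc 4 * (4 ^ n / F 0) ^ 2 * 2 ^ n ≤ 4 ^ n * ((2 ^ 10) ^ n) ^ 2 * 2 ^ n := by
            gcongr
        _ = (2 ^ 23) ^ n := by
            rw [← pow_mul, mul_comm n 2, pow_mul, ← mul_pow, ← mul_pow]; norm_num
    exact le_of_pow_le_pow_left₀ (by omega) (by norm_num) h2
  set P := tl ν ξ with hP
  have hPc : CptP P R := hc.tl ξ
  have hPp := hPc.prob
  set φ : EE n → ℝ := fun x => ‖T (x - y)‖ ^ 2 / (4 * s * n) + Real.exp (inner ℝ ξ x) * (Real.exp (-(4 * n)) / 4) with hφ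
  have hφc : Continuous φ := by fun_prop
  have hE1 : ∫ x, ‖T (x - y)‖ ^ 2 ∂P = n * s := by
    simp only [hTn]
    rw [integral_finsetSum _ (fun i _ => hPc.int (by fun_prop))]
    have : ∀ i, ∫ x, c i ^ 2 * inner ℝ (b i) (x - y) ^ 2 ∂P = s := by
      intro i
      rw [integral_const_mul, ← hcs i, covA_inner hc]
      congr 2; ext x
      rw [real_inner_comm]; ring
    simp [this]
  have hE2 : ∫ x, Real.exp (inner ℝ ξ x) ∂P ≤ Real.exp (4 * n) := by
    rw [hP, tl_integral]
    have e : ∫ x, Real.exp (inner ℝ ξ x) • Real.exp (inner ℝ ξ x) ∂ν = MM ν ((2:ℝ) • ξ) := by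
      rw [MM]; congr 1; ext x
      rw [smul_eq_mul, ← Real.exp_add, inner_smul_left]; congr 1; simp; ring
    rw [e]
    have h1 := h.cpt.MM_pos ((2:ℝ) • ξ)
    have h2 : MM ν ((2:ℝ) • ξ) ≤ Real.exp (4 * n) := by
      rw [← Real.exp_log h1]; exact Real.exp_le_exp.2 hξ1
    have h3 : 1 ≤ MM ν ξ := by
      have := LL_nonneg hc h.sym ξ
      rw [LL] at this
      have h4 := h.cpt.MM_pos ξ
      rw [← Real.exp_log h4]; exact Real.one_le_exp this
    rw [smul_eq_mul]
    calc (MM ν ξ)⁻¹ * MM ν ((2:ℝ) • ξ) ≤ 1 * MM ν ((2:ℝ) • ξ) := by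
          gcongr
          exact inv_le_one_of_one_le₀ h3
      _ ≤ _ := by rw [one_mul]; exact h2
  have hEφ : ∫ x, φ x ∂P ≤ 1 / 2 := by
    simp only [hφ]
    rw [integral_add (hPc.int (by fun_prop)) (hPc.int (by fun_prop)), integral_div, integral_mul_const, hE1]
    have h1 : (n : ℝ) * s / (4 * s * n) = 1 / 4 := by field_simp
    have h2 : (∫ x, Real.exp (inner ℝ ξ x) ∂P) * (Real.exp (-(4 * n)) / 4) ≤ 1 / 4 := by
      calc _ ≤ Real.exp (4 * n) * (Real.exp (-(4 * n)) / 4) := by gcongr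
        _ = (Real.exp (4 * n) * Real.exp (-(4 * n))) / 4 := by ring
        _ = 1/4 := by rw [← Real.exp_add]; simp
    rw [h1]; linarith
  have hφ0 : ∀ x, 0 ≤ φ x := fun x => by positivity
  have hmk := mul_meas_ge_le_integral_of_nonneg (ae_of_all P hφ0) (hPc.int hφc) 1
  set S : Set (EE n) := {x | φ x < 1} with hS
  have hSm : MeasurableSet S := measurableSet_lt hφc.measurable measurable_const
  have hPS : 1 / 2 ≤ P.real S := by
    have : {x | 1 ≤ φ x} = Sᶜ := by ext x; simp [hS]
    rw [this, probReal_compl_eq_one_sub hSm] at hmk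
    linarith
  have hPS' : ENNReal.ofReal (1/2) ≤ P S := by
    rw [← ENNReal.ofReal_toReal (measure_ne_top P S)]
    exact ENNReal.ofReal_le_ofReal hPS
  have hPν : P S ≤ ENNReal.ofReal (4 * Real.exp (4 * n)) * ν S := by
    rw [hP, tl, tilted_apply' _ _ hSm]
    calc _ ≤ ∫⁻ a in S, ENNReal.ofReal (4 * Real.exp (4 * n)) ∂ν := by
          refine setLIntegral_mono' hSm fun x hx => ENNReal.ofReal_le_ofReal ?_
          have h4 := h.cpt.MM_pos ξ
          have h3 : 1 ≤ MM ν ξ := by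
            have := LL_nonneg hc h.sym ξ
            rw [LL] at this
            rw [← Real.exp_log h4]; exact Real.one_le_exp this
          have h5 : Real.exp (inner ℝ ξ x) * (Real.exp (-(4 * n)) / 4) ≤ 1 := by
            have h6 : φ x < 1 := hx
            have h7 : 0 ≤ ‖T (x - y)‖ ^ 2 / (4 * s * n) := by positivity
            simp only [hφ] at h6
            linarith
          have h8 : Real.exp (inner ℝ ξ x) ≤ 4 * Real.exp (4 * n) := by
            rw [Real.exp_neg] at h5
            have := Real.exp_pos (4 * (n:ℝ))
            field_simp at h5
            linarith
          exact (div_le_self (Real.exp_pos _).le h3).trans h8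
      _ = _ := by simp
  have hSsub : S ⊆ {x | ‖T x - T y‖ ^ 2 ≤ 2 ^ 25 * n} := by
    intro x hx
    have h6 : φ x < 1 := hx
    have h7 : 0 ≤ Real.exp (inner ℝ ξ x) * (Real.exp (-(4 * n)) / 4) := by positivity
    have h8 : ‖T (x - y)‖ ^ 2 / (4 * s * n) ≤ 1 := by
      simp only [hφ] at h6
      linarith
    rw [div_le_one (by positivity), map_sub] at h8
    refine h8.trans ?_
    nlinarith
  refine ⟨T, T y, hT, ?_⟩
  refine le_trans ?_ (measure_mono hSsub)
  have hfin : ENNReal.ofReal (1/2) ≤ ENNReal.ofReal (4 * Real.exp (4 * n)) * ν S := hPS'.trans hPν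
  have hpos : (0:ℝ) < 4 * Real.exp (4 * n) := by positivity
  rw [← ENNReal.ofReal_toReal (measure_ne_top ν S)] at hfin ⊢
  rw [← ENNReal.ofReal_mul hpos.le, ENNReal.ofReal_le_ofReal_iff (by positivity)] at hfin
  refine ENNReal.ofReal_le_ofReal ?_
  have h9 : Real.exp (4 * n) ≤ (2^7) ^ n := by
    have : Real.exp (4 * (n:ℝ)) = (Real.exp 1 ^ 4) ^ n := by rw [← pow_mul, ← Real.exp_nat_mul]; congr 1; push_cast; ring
    rw [this]
    gcongr
    have := Real.exp_one_lt_d9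
    calc Real.exp 1 ^ 4 ≤ (2.7182818286) ^ 4 := by gcongr
      _ ≤ _ := by norm_num
  have h10 : (8:ℝ) ≤ 8 ^ n := by
    calc (8:ℝ) = 8 ^ 1 := by norm_num
      _ ≤ 8 ^ n := pow_le_pow_right₀ (by norm_num) hn
  rw [inv_pow, inv_le_iff_one_le_mul₀ (by positivity)]
  have e : ((2:ℝ)^10) ^ n = 8 ^ n * (2^7) ^ n := by rw [← mul_pow]; norm_num
  have h11 : 8 * Real.exp (4 * n) ≤ (2^10) ^ n := by
    rw [e]; gcongr
  have h12 : 0 ≤ (ν S).toReal := ENNReal.toReal_nonneg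
  nlinarith
end F1

section G1
variable {n : ℕ}

lemma lc_mul {F G : EE n → ℝ} (hF : IsLogConcave F) (hG : IsLogConcave G) : IsLogConcave (fun x => F x * G x) := by
  refine ⟨fun x => mul_nonneg (hF.1 x) (hG.1 x), fun x y t h0 h1 => ?_⟩
  simp only
  rw [Real.mul_rpow (hF.1 x) (hG.1 x), Real.mul_rpow (hF.1 y) (hG.1 y)]
  have h2 := hF.2 x y t h0 h1
  have h3 := hG.2 x y t h0 h1
  calc _ = (F x ^ t * F y ^ (1 - t)) * (G x ^ t * G y ^ (1 - t)) := by ring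
    _ ≤ _ := mul_le_mul h2 h3 (mul_nonneg (Real.rpow_nonneg (hG.1 x) _) (Real.rpow_nonneg (hG.1 y) _)) (hF.1 _)

lemma lc_sqrt {F : EE n → ℝ} (hF : IsLogConcave F) : IsLogConcave (fun x => Real.sqrt (F x)) := by
  refine ⟨fun x => Real.sqrt_nonneg _, fun x y t h0 h1 => ?_⟩
  have h2 := Real.sqrt_le_sqrt (hF.2 x y t h0 h1)
  rw [Real.sqrt_mul (Real.rpow_nonneg (hF.1 x) _)] at h2
  refine le_trans (le_of_eq ?_) h2
  simp only [Real.sqrt_eq_rpow]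
  rw [← Real.rpow_mul (hF.1 x), ← Real.rpow_mul (hF.1 x), ← Real.rpow_mul (hF.1 y), ← Real.rpow_mul (hF.1 y), mul_comm t,
    mul_comm (1 - t)]

lemma lc_comp {F : EE n → ℝ} (hF : IsLogConcave F) {A : EE n → EE n}
    (hA : ∀ x y (t : ℝ), A (t • x + (1 - t) • y) = t • A x + (1 - t) • A y) : IsLogConcave (fun x => F (A x)) := by
  refine ⟨fun x => hF.1 _, fun x y t h0 h1 => ?_⟩
  simp only [hA]
  exact hF.2 _ _ t h0 h1

lemma lc_const_mul {F : EE n → ℝ} (hF : IsLogConcave F) {c : ℝ} (hc : 0 < c) : IsLogConcave (fun x => c * F x) := by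
  refine ⟨fun x => mul_nonneg hc.le (hF.1 x), fun x y t h0 h1 => ?_⟩
  simp only
  rw [Real.mul_rpow hc.le (hF.1 x), Real.mul_rpow hc.le (hF.1 y)]
  have e : c ^ t * c ^ (1 - t) = c := by rw [← Real.rpow_add hc]; simp
  calc _ = (c ^ t * c ^ (1 - t)) * (F x ^ t * F y ^ (1 - t)) := by ring
    _ ≤ _ := by rw [e]; exact mul_le_mul_of_nonneg_left (hF.2 x y t h0 h1) hc.le

lemma lc_indicator {F : EE n → ℝ} (hF : IsLogConcave F) {S : Set (EE n)} (hS : Convex ℝ S) :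
    IsLogConcave (S.indicator F) := by
  have hn : ∀ x, 0 ≤ S.indicator F x := fun x => Set.indicator_nonneg (fun x _ => hF.1 x) x
  refine ⟨hn, fun x y t h0 h1 => ?_⟩
  rcases h0.eq_or_lt with rfl | h0'
  · simp
  rcases h1.eq_or_lt with rfl | h1'
  · simp
  by_cases hx : x ∈ S
  · by_cases hy : y ∈ S
    · have hm : t • x + (1 - t) • y ∈ S := hS hx hy h0 (by linarith) (by ring)
      rw [Set.indicator_of_mem hx, Set.indicator_of_mem hy, Set.indicator_of_mem hm]
      exact hF.2 x y t h0 h1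
    · rw [Set.indicator_of_notMem hy, Real.zero_rpow (by linarith : (1 - t) ≠ 0), mul_zero]
      exact hn _
  · rw [Set.indicator_of_notMem hx, Real.zero_rpow h0'.ne', zero_mul]
    exact hn _

lemma sqrt_int {F : EE n → ℝ} (hF : IsLogConcave F) (z : EE n) :
    ENNReal.ofReal (Real.sqrt (F z)) * ∫⁻ x, ENNReal.ofReal (Real.sqrt (F x)) ≤ 2 ^ n * ∫⁻ x, ENNReal.ofReal (F x) := by
  have e : ENNReal.ofReal ((((1:ℝ)/2) ^ n)⁻¹) = 2 ^ n := by
    rw [← inv_pow]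
    norm_num
  calc _ = ∫⁻ x, ENNReal.ofReal (Real.sqrt (F z)) * ENNReal.ofReal (Real.sqrt (F x)) := by
        rw [lintegral_const_mul' _ _ (by finiteness)]
    _ ≤ ∫⁻ x, ENNReal.ofReal (F ((1/2 : ℝ) • (x + z))) := by
        refine lintegral_mono fun x => ?_
        rw [← ENNReal.ofReal_mul (Real.sqrt_nonneg _), ← Real.sqrt_mul (hF.1 z)]
        refine ENNReal.ofReal_le_ofReal (Real.sqrt_le_iff.2 ⟨hF.1 _, ?_⟩)
        rw [add_comm x z]
        exact lc_mid hF z x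
    _ = ∫⁻ x, ENNReal.ofReal (F ((1/2 : ℝ) • x)) :=
        lintegral_add_right_eq_self (fun x => ENNReal.ofReal (F ((1/2 : ℝ) • x))) z
    _ = _ := by rw [lint_smul (fun x => ENNReal.ofReal (F x)) (by norm_num), e]

lemma sqrt_int' {F : EE n → ℝ} (hF : IsLogConcave F) (h1 : ∫⁻ x, ENNReal.ofReal (F x) = 1) {z : EE n}
    (hz : ((4:ℝ) ^ n)⁻¹ ≤ F z) : ∫⁻ x, ENNReal.ofReal (Real.sqrt (F x)) ≤ 4 ^ n := by
  have h2 := sqrt_int hF z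
  rw [h1, mul_one] at h2
  have h3 : ENNReal.ofReal (((2:ℝ) ^ n)⁻¹) ≤ ENNReal.ofReal (Real.sqrt (F z)) := by
    refine ENNReal.ofReal_le_ofReal (Real.le_sqrt_of_sq_le ?_)
    refine le_trans (le_of_eq ?_) hz
    rw [inv_pow, ← pow_mul, mul_comm n 2, pow_mul]; norm_num
  have e : ENNReal.ofReal (((2:ℝ) ^ n)⁻¹) = (2 ^ n)⁻¹ := by
    rw [ENNReal.ofReal_inv_of_pos (by positivity), ENNReal.ofReal_pow (by norm_num)]; norm_num
  rw [e] at h3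
  have h4 : ((2:ENNReal) ^ n)⁻¹ * ∫⁻ x, ENNReal.ofReal (Real.sqrt (F x)) ≤ 2 ^ n :=
    (mul_le_mul' h3 le_rfl).trans h2
  calc _ = 2 ^ n * (((2:ENNReal) ^ n)⁻¹ * ∫⁻ x, ENNReal.ofReal (Real.sqrt (F x))) := by
        rw [← mul_assoc, ENNReal.mul_inv_cancel (by positivity) (by finiteness), one_mul]
    _ ≤ 2 ^ n * 2 ^ n := mul_le_mul' le_rfl h4
    _ = 4 ^ n := by rw [← mul_pow]; norm_num

lemma sym_prod {f : EE n → ENNReal} (hf : Measurable f) (h1 : ∫⁻ x, f x = 1) :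
    ∫⁻ z, ∫⁻ x, f (z + x) * f (z - x) = ENNReal.ofReal ((2 ^ n)⁻¹) := by
  have h2 : ∀ z, ∫⁻ x, f (z + x) * f (z - x) = ∫⁻ u, f u * f ((2:ℝ) • z - u) := by
    intro z
    rw [← lintegral_add_left_eq_self (fun u => f u * f ((2:ℝ) • z - u)) z]
    congr 1; ext x
    congr 2
    rw [two_smul]; abel
  simp only [h2]
  rw [lintegral_lintegral_swap (by fun_prop)]
  have h3 : ∀ u, ∫⁻ z, f u * f ((2:ℝ) • z - u) = f u * ENNReal.ofReal ((2 ^ n)⁻¹) := by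
    intro u
    rw [lintegral_const_mul _ (by fun_prop), lint_smul (fun z => f (z - u)) (by norm_num),
      lintegral_sub_right_eq_self (fun z => f z) u, h1, mul_one]
  simp only [h3]
  rw [lintegral_mul_const _ hf, h1, one_mul]

lemma exists_center {F : EE n → ℝ} (hn : 1 ≤ n) (hF : IsLogConcave F) (hm : Measurable F) (h1 : ∫⁻ x, ENNReal.ofReal (F x) = 1) {z : EE n}
    (hz : ((4:ℝ) ^ n)⁻¹ ≤ F z) :
    ∃ x0, ((256 : ℝ) ^ n)⁻¹ ≤ F x0 ∧ ENNReal.ofReal ((8 ^ n)⁻¹) ≤ ∫⁻ x, ENNReal.ofReal (Real.sqrt (F (x0 + x) * F (x0 - x))) := by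
  by_contra hcon
  push Not at hcon
  have hsq := sqrt_int' hF h1 hz
  have hle1 : ∀ x0, ∫⁻ x, ENNReal.ofReal (Real.sqrt (F (x0 + x) * F (x0 - x))) ≤ 1 := by
    intro x0
    calc _ ≤ ∫⁻ x, (ENNReal.ofReal (F (x0 + x)) / 2 + ENNReal.ofReal (F (x0 - x)) / 2) := by
          refine lintegral_mono fun x => ?_
          have := hF.1 (x0 + x); have := hF.1 (x0 - x)
          have e2 : ∀ a : ℝ, ENNReal.ofReal a / 2 = ENNReal.ofReal (a / 2) := fun a => by
            rw [ENNReal.ofReal_div_of_pos (by norm_num)]; norm_num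
          rw [e2, e2, ← ENNReal.ofReal_add (by positivity) (by positivity)]
          refine ENNReal.ofReal_le_ofReal (Real.sqrt_le_iff.2 ⟨by positivity, ?_⟩)
          nlinarith [sq_nonneg (F (x0 + x) - F (x0 - x))]
      _ = 1 := by
          rw [lintegral_add_left (by fun_prop)]
          simp only [div_eq_mul_inv]
          rw [lintegral_mul_const _ (by fun_prop), lintegral_mul_const _ (by fun_prop),
            lintegral_add_left_eq_self (fun x => ENNReal.ofReal (F x)), lintegral_sub_left_eq_self (fun x => ENNReal.ofReal (F x)),
            h1, one_mul, ENNReal.inv_two_add_inv_two]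
  have hpt : ∀ x0, ∫⁻ x, ENNReal.ofReal (F (x0 + x)) * ENNReal.ofReal (F (x0 - x)) ≤
      ENNReal.ofReal (F x0) * ENNReal.ofReal ((8 ^ n)⁻¹) + ENNReal.ofReal ((16 ^ n)⁻¹) * ENNReal.ofReal (Real.sqrt (F x0)) := by
    intro x0
    have hb : ∫⁻ x, ENNReal.ofReal (F (x0 + x)) * ENNReal.ofReal (F (x0 - x)) ≤
        ENNReal.ofReal (F x0) * ∫⁻ x, ENNReal.ofReal (Real.sqrt (F (x0 + x) * F (x0 - x))) := by
      rw [← lintegral_const_mul' _ _ (by finiteness)]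
      refine lintegral_mono fun x => ?_
      rw [← ENNReal.ofReal_mul (hF.1 _), ← ENNReal.ofReal_mul (hF.1 _)]
      refine ENNReal.ofReal_le_ofReal ?_
      have hp : 0 ≤ F (x0 + x) * F (x0 - x) := mul_nonneg (hF.1 _) (hF.1 _)
      have h3 : Real.sqrt (F (x0 + x) * F (x0 - x)) ≤ F x0 := by
        refine Real.sqrt_le_iff.2 ⟨hF.1 _, ?_⟩
        have := lc_mid hF (x0 + x) (x0 - x)
        have e : (1/2 : ℝ) • (x0 + x + (x0 - x)) = x0 := by
          rw [show x0 + x + (x0 - x) = (2:ℝ) • x0 by rw [two_smul]; abel, smul_smul]; norm_num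
        rwa [e] at this
      calc _ = Real.sqrt (F (x0 + x) * F (x0 - x)) * Real.sqrt (F (x0 + x) * F (x0 - x)) := (Real.mul_self_sqrt hp).symm
        _ ≤ _ := mul_le_mul_of_nonneg_right h3 (Real.sqrt_nonneg _)
    refine hb.trans ?_
    by_cases hx : ((256 : ℝ) ^ n)⁻¹ ≤ F x0
    · exact (mul_le_mul' le_rfl (hcon x0 hx).le).trans le_self_add
    · push Not at hx
      refine le_trans ?_ le_add_self
      refine (mul_le_mul' le_rfl (hle1 x0)).trans ?_
      rw [mul_one, ← ENNReal.ofReal_mul (by positivity)]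
      refine ENNReal.ofReal_le_ofReal ?_
      have h4 : Real.sqrt (F x0) ≤ (16 ^ n)⁻¹ := by
        refine Real.sqrt_le_iff.2 ⟨by positivity, hx.le.trans (le_of_eq ?_)⟩
        rw [inv_pow, ← pow_mul, mul_comm n 2, pow_mul]; norm_num
      calc F x0 = Real.sqrt (F x0) * Real.sqrt (F x0) := (Real.mul_self_sqrt (hF.1 _)).symm
        _ ≤ _ := mul_le_mul_of_nonneg_right h4 (Real.sqrt_nonneg _)
  have h5 := sym_prod (f := fun x => ENNReal.ofReal (F x)) (by fun_prop) h1
  have h6 : ENNReal.ofReal ((2 ^ n)⁻¹) ≤ ENNReal.ofReal ((8 ^ n)⁻¹ + (4 ^ n)⁻¹) := by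
    rw [← h5]
    refine (lintegral_mono hpt).trans ?_
    rw [lintegral_add_left (by fun_prop), lintegral_mul_const _ (by fun_prop), lintegral_const_mul _ (by fun_prop), h1, one_mul,
      ENNReal.ofReal_add (by positivity) (by positivity)]
    refine add_le_add le_rfl ((mul_le_mul' le_rfl hsq).trans (le_of_eq ?_))
    have : (4 : ENNReal) ^ n = ENNReal.ofReal (4 ^ n) := by rw [ENNReal.ofReal_pow (by norm_num)]; norm_num
    rw [this, ← ENNReal.ofReal_mul (by positivity), ← inv_pow, ← inv_pow, ← mul_pow]
    norm_num
  rw [ENNReal.ofReal_le_ofReal_iff (by positivity)] at h6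
  have a1 : ((2:ℝ)⁻¹) ^ n ≤ 1/2 := by
    calc ((2:ℝ)⁻¹) ^ n ≤ (2⁻¹)^1 := pow_le_pow_of_le_one (by norm_num) (by norm_num) hn
      _ = 1/2 := by norm_num
  rw [← inv_pow, ← inv_pow, ← inv_pow] at h6
  have a2 : ((4:ℝ)⁻¹) ^ n = (2⁻¹) ^ n * (2⁻¹) ^ n := by rw [← mul_pow]; norm_num
  have a3 : ((8:ℝ)⁻¹) ^ n = (2⁻¹) ^ n * ((2⁻¹) ^ n * (2⁻¹) ^ n) := by rw [← mul_pow, ← mul_pow]; norm_num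
  have a4 : (0:ℝ) < (2⁻¹) ^ n := by positivity
  rw [a2, a3] at h6
  set q := ((2:ℝ)⁻¹) ^ n
  nlinarith [mul_pos a4 a4]
end G1

section G2
variable {n : ℕ}

lemma gen_Mpos {F : EE n → ℝ} (hn : 1 ≤ n) (hF : IsLogConcave F) (hm : Measurable F) (ho : IsOpen {x | 0 < F x})
    (h1 : ∫⁻ x, ENNReal.ofReal (F x) = 1) {z : EE n} (hz : ((4:ℝ) ^ n)⁻¹ ≤ F z) :
    ∃ (T : EE n ≃L[ℝ] EE n) (m : EE n), MeasurePreserving T volume volume ∧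
      ENNReal.ofReal ((2^14 : ℝ)⁻¹ ^ n) ≤ dm F {x | ‖T x - m‖ ^ 2 ≤ 2 ^ 25 * n} := by
  obtain ⟨x0, hx0, hh⟩ := exists_center hn hF hm h1 hz
  set H : EE n → ℝ := fun x => Real.sqrt (F (x0 + x) * F (x0 - x)) with hH
  have hFp : 0 < F x0 := lt_of_lt_of_le (by positivity) hx0
  have hHlc : IsLogConcave H := by
    refine lc_sqrt (lc_mul (lc_comp hF ?_) (lc_comp hF ?_))
    · intro x y t
      rw [smul_add, smul_add, sub_smul, sub_smul, one_smul, one_smul]; abel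
    · intro x y t
      rw [smul_sub, smul_sub, sub_smul, sub_smul, one_smul, one_smul]; abel
  have hHm : Measurable H := by fun_prop
  have hHle : ∀ x, H x ≤ F (x0 + x) / 2 + F (x0 - x) / 2 := by
    intro x
    have := hF.1 (x0 + x); have := hF.1 (x0 - x)
    refine Real.sqrt_le_iff.2 ⟨by positivity, ?_⟩
    nlinarith [sq_nonneg (F (x0 + x) - F (x0 - x))]
  have e2 : ∀ a : ℝ, ENNReal.ofReal a / 2 = ENNReal.ofReal (a / 2) := fun a => by
    rw [ENNReal.ofReal_div_of_pos (by norm_num)]; norm_num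
  have hHle' : ∀ x, ENNReal.ofReal (H x) ≤ ENNReal.ofReal (F (x0 + x)) / 2 + ENNReal.ofReal (F (x0 - x)) / 2 := by
    intro x
    have := hF.1 (x0 + x); have := hF.1 (x0 - x)
    rw [e2, e2, ← ENNReal.ofReal_add (by positivity) (by positivity)]
    exact ENNReal.ofReal_le_ofReal (hHle x)
  have hle1 : ∫⁻ x, ENNReal.ofReal (H x) ≤ 1 := by
    calc _ ≤ ∫⁻ x, (ENNReal.ofReal (F (x0 + x)) / 2 + ENNReal.ofReal (F (x0 - x)) / 2) := lintegral_mono hHle'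
      _ = 1 := by
          rw [lintegral_add_left (by fun_prop)]
          simp only [div_eq_mul_inv]
          rw [lintegral_mul_const _ (by fun_prop), lintegral_mul_const _ (by fun_prop),
            lintegral_add_left_eq_self (fun x => ENNReal.ofReal (F x)), lintegral_sub_left_eq_self (fun x => ENNReal.ofReal (F x)),
            h1, one_mul, ENNReal.inv_two_add_inv_two]
  have hun : dm H Set.univ = ∫⁻ x, ENNReal.ofReal (H x) := by
    rw [dm, withDensity_apply _ MeasurableSet.univ, Measure.restrict_univ]
  have hlim : Filter.Tendsto (fun k : ℕ => dm H (Metric.ball 0 (k:ℝ))) Filter.atTop (nhds (dm H Set.univ)) := by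
    have := tendsto_measure_iUnion_atTop (μ := dm H) (s := fun k : ℕ => Metric.ball (0 : EE n) (k:ℝ))
      (fun i j hij => Metric.ball_subset_ball (by exact_mod_cast hij))
    rwa [Metric.iUnion_ball_nat] at this
  have hlt : ENNReal.ofReal ((16 ^ n)⁻¹) < dm H Set.univ := by
    rw [hun]
    refine lt_of_lt_of_le ?_ hh
    rw [ENNReal.ofReal_lt_ofReal_iff (by positivity)]
    have : (8:ℝ) ^ n < 16 ^ n := pow_lt_pow_left₀ (by norm_num) (by norm_num) (by omega)
    gcongr
  obtain ⟨k, hk, hk0⟩ := ((hlim.eventually (lt_mem_nhds hlt)).and (Filter.eventually_gt_atTop 0)).exists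
  have hk0' : (0:ℝ) < k := by exact_mod_cast hk0
  set B : Set (EE n) := Metric.ball 0 (k:ℝ) with hB
  have hBm : MeasurableSet B := measurableSet_ball
  have hBv : dm H B = ∫⁻ x in B, ENNReal.ofReal (H x) := by rw [dm, withDensity_apply _ hBm]
  have hBle : dm H B ≤ 1 := (measure_mono (Set.subset_univ _)).trans (hun ▸ hle1)
  set v : ℝ := (dm H B).toReal with hv
  have hvof : ENNReal.ofReal v = dm H B := ENNReal.ofReal_toReal (ne_top_of_le_ne_top ENNReal.one_ne_top hBle)
  have hvlow : (16 ^ n)⁻¹ ≤ v := by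
    rw [← hvof] at hk
    exact ((ENNReal.ofReal_lt_ofReal_iff' ).1 hk).1.le
  have hvpos : 0 < v := lt_of_lt_of_le (by positivity) hvlow
  have hv1 : v ≤ 1 := by
    rw [← hvof] at hBle
    simpa using hBle
  set K : EE n → ℝ := fun x => v⁻¹ * B.indicator H x with hK
  have hKm : Measurable K := (hHm.indicator hBm).const_mul _
  have hKof : ∀ x, ENNReal.ofReal (K x) = ENNReal.ofReal v⁻¹ * B.indicator (fun x => ENNReal.ofReal (H x)) x := by
    intro x
    rw [hK, ENNReal.ofReal_mul (by positivity)]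
    by_cases hx : x ∈ B <;> simp [hx]
  have hKint : ∫⁻ x, ENNReal.ofReal (K x) = 1 := by
    simp only [hKof]
    rw [lintegral_const_mul _ ((by fun_prop : Measurable fun x => ENNReal.ofReal (H x)).indicator hBm),
      lintegral_indicator hBm, ← hBv, ← hvof, ← ENNReal.ofReal_mul (by positivity), inv_mul_cancel₀ hvpos.ne', ENNReal.ofReal_one]
  have hK0 : K 0 = v⁻¹ * F x0 := by
    have : (0 : EE n) ∈ B := by simp [hB, hk0']
    simp only [hK, Set.indicator_of_mem this, hH]
    simp [Real.sqrt_mul_self hFp.le]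
  have hKE : EvenD K k := by
    refine ⟨lc_const_mul (lc_indicator hHlc (convex_ball _ _)) (by positivity), hKm, ?_, ⟨⟨?_⟩, hk0', ?_, ?_⟩, ?_, ?_⟩
    · have : {x | 0 < K x} = B ∩ ((fun x => x0 + x) ⁻¹' {x | 0 < F x} ∩ (fun x => x0 - x) ⁻¹' {x | 0 < F x}) := by
        ext x
        by_cases hx : x ∈ B
        · simp only [hK, Set.mem_setOf_eq, Set.indicator_of_mem hx, Set.mem_inter_iff, hx, true_and, Set.mem_preimage]
          have a1 := hF.1 (x0 + x)
          have a2 := hF.1 (x0 - x)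
          rw [mul_pos_iff_of_pos_left (by positivity), hH]
          simp only [Real.sqrt_pos]
          constructor
          · intro h
            exact ⟨lt_of_le_of_ne a1 fun h' => by simp [← h'] at h, lt_of_le_of_ne a2 fun h' => by simp [← h'] at h⟩
          · rintro ⟨h, h'⟩; exact mul_pos h h'
        · simp [hK, hx]
      rw [this]
      exact Metric.isOpen_ball.inter ((ho.preimage (by fun_prop)).inter (ho.preimage (by fun_prop)))
    · rw [dm, withDensity_apply _ MeasurableSet.univ, Measure.restrict_univ, hKint]
    · filter_upwards [dm_ae_pos hKm] with x hx
      by_contra hxn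
      have : x ∉ B := by
        simp only [hB, mem_ball_zero_iff]
        push Not at hxn ⊢
        exact hxn.le
      simp [hK, this] at hx
    · exact withDensity_absolutelyContinuous _ _
    · intro x
      have hx : -x ∈ B ↔ x ∈ B := by simp [hB]
      have e : H (-x) = H x := by
        simp only [hH]
        rw [sub_neg_eq_add, ← sub_eq_add_neg, mul_comm]
      simp only [hK]
      by_cases hxB : x ∈ B
      · rw [Set.indicator_of_mem hxB, Set.indicator_of_mem (hx.2 hxB), e]
      · rw [Set.indicator_of_notMem hxB, Set.indicator_of_notMem (fun h => hxB (hx.1 h))]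
    · rw [hK0]; positivity
  obtain ⟨T, m, hT, hmass⟩ := even_Mpos hKE hn (by
    rw [hK0]
    refine hx0.trans (le_mul_of_one_le_left hFp.le ?_)
    exact (one_le_inv₀ hvpos).2 hv1)
  set S : Set (EE n) := {x | ‖T x - m‖ ^ 2 ≤ 2 ^ 25 * n} with hS
  have hTc : Continuous T := T.continuous
  have hSm : MeasurableSet S := measurableSet_le (by fun_prop) measurable_const
  set a := ∫⁻ x in S, ENNReal.ofReal (F (x0 + x)) with ha
  set b := ∫⁻ x in S, ENNReal.ofReal (F (x0 - x)) with hb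
  have hkey : ENNReal.ofReal ((2^14 : ℝ)⁻¹ ^ n) ≤ a / 2 + b / 2 := by
    calc ENNReal.ofReal ((2^14 : ℝ)⁻¹ ^ n) ≤ ENNReal.ofReal v * ENNReal.ofReal ((2^10 : ℝ)⁻¹ ^ n) := by
          rw [← ENNReal.ofReal_mul hvpos.le]
          refine ENNReal.ofReal_le_ofReal ?_
          calc (2^14 : ℝ)⁻¹ ^ n = (16 ^ n)⁻¹ * (2^10 : ℝ)⁻¹ ^ n := by
                rw [← inv_pow (16:ℝ) n, ← mul_pow]; norm_num
            _ ≤ _ := by gcongr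
      _ ≤ ENNReal.ofReal v * dm K S := mul_le_mul' le_rfl hmass
      _ = ∫⁻ x in S, B.indicator (fun x => ENNReal.ofReal (H x)) x := by
          rw [dm, withDensity_apply _ hSm]
          simp only [hKof]
          rw [lintegral_const_mul _ ((by fun_prop : Measurable fun x => ENNReal.ofReal (H x)).indicator hBm), ← mul_assoc,
            ← ENNReal.ofReal_mul hvpos.le, mul_inv_cancel₀ hvpos.ne', ENNReal.ofReal_one, one_mul]
      _ ≤ ∫⁻ x in S, (ENNReal.ofReal (F (x0 + x)) / 2 + ENNReal.ofReal (F (x0 - x)) / 2) := by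
          refine lintegral_mono fun x => ?_
          exact (Set.indicator_le_self _ _ x).trans (hHle' x)
      _ = a / 2 + b / 2 := by
          rw [lintegral_add_left (by fun_prop)]
          simp only [div_eq_mul_inv]
          rw [lintegral_mul_const _ (by fun_prop), lintegral_mul_const _ (by fun_prop)]
  have hor : ENNReal.ofReal ((2^14 : ℝ)⁻¹ ^ n) ≤ a ∨ ENNReal.ofReal ((2^14 : ℝ)⁻¹ ^ n) ≤ b := by
    rcases le_total a b with hab | hab
    · right
      refine hkey.trans ((add_le_add (ENNReal.div_le_div_right hab 2) le_rfl).trans (ENNReal.add_halves b).le)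
    · left
      refine hkey.trans ((add_le_add le_rfl (ENNReal.div_le_div_right hab 2)).trans (ENNReal.add_halves a).le)
  have hset : ∀ m', MeasurableSet {x | ‖T x - m'‖ ^ 2 ≤ 2 ^ 25 * (n:ℝ)} := fun m' => measurableSet_le (by fun_prop) measurable_const
  rcases hor with h | h
  · refine ⟨T, T x0 + m, hT, h.trans (le_of_eq ?_)⟩
    have := lintegral_add_left_eq_self (μ := (volume : Measure (EE n))) (({x | ‖T x - (T x0 + m)‖^2 ≤ 2^25*(n:ℝ)}).indicator (fun x => ENNReal.ofReal (F x))) x0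
    rw [dm, withDensity_apply _ (hset _), ← lintegral_indicator (hset _), ha, ← lintegral_indicator hSm]
    refine Eq.trans ?_ this
    refine lintegral_congr fun x => ?_
    have e : ‖T (x0 + x) - (T x0 + m)‖ = ‖T x - m‖ := by
      rw [map_add]; congr 1; abel
    by_cases hx : ‖T x - m‖ ^ 2 ≤ 2 ^ 25 * (n:ℝ)
    · rw [Set.indicator_of_mem (show x ∈ S from hx), Set.indicator_of_mem]
      simpa only [Set.mem_setOf_eq, e] using hx
    · rw [Set.indicator_of_notMem (show x ∉ S from hx), Set.indicator_of_notMem]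
      simpa only [Set.mem_setOf_eq, e] using hx
  · refine ⟨T, T x0 - m, hT, h.trans (le_of_eq ?_)⟩
    have := lintegral_sub_left_eq_self (μ := (volume : Measure (EE n))) (({x | ‖T x - (T x0 - m)‖^2 ≤ 2^25*(n:ℝ)}).indicator (fun x => ENNReal.ofReal (F x))) x0
    rw [dm, withDensity_apply _ (hset _), ← lintegral_indicator (hset _), hb, ← lintegral_indicator hSm]
    refine Eq.trans ?_ this
    refine lintegral_congr fun x => ?_
    have e : ‖T (x0 - x) - (T x0 - m)‖ = ‖T x - m‖ := by
      rw [map_sub, ← norm_neg]; congr 1; abel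
    by_cases hx : ‖T x - m‖ ^ 2 ≤ 2 ^ 25 * (n:ℝ)
    · rw [Set.indicator_of_mem (show x ∈ S from hx), Set.indicator_of_mem]
      simpa only [Set.mem_setOf_eq, e] using hx
    · rw [Set.indicator_of_notMem (show x ∉ S from hx), Set.indicator_of_notMem]
      simpa only [Set.mem_setOf_eq, e] using hx
end G2

section H1
variable {n : ℕ}

lemma lc_rep {f : EE n → ℝ} (hf : IsLogConcave f) :
    ∃ f' : EE n → ℝ, IsLogConcave f' ∧ Measurable f' ∧ IsOpen {x | 0 < f' x} ∧ f' =ᵐ[volume] f := by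
  have hc := lc_convex hf
  set U := interior {x | 0 < f x} with hU
  have hUo : IsOpen U := isOpen_interior
  refine ⟨U.indicator f, lc_indicator hf hc.interior, ?_, ?_, ?_⟩
  · have h1 : ContinuousOn f U := by
      have h2 : ContinuousOn (fun x => Real.exp (Real.log (f x))) U :=
        Real.continuous_exp.comp_continuousOn (lc_concave hf).continuousOn_interior
      refine h2.congr fun x hx => ?_
      exact (Real.exp_log (interior_subset hx : x ∈ {x | 0 < f x})).symm
    classical
    have h3 := h1.measurable_piecewise (g := fun _ => (0:ℝ)) continuousOn_const hUo.measurableSet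
    convert h3 using 1
    ext x; simp [Set.indicator, Set.piecewise]
  · convert hUo using 1
    ext x
    by_cases hx : x ∈ U
    · simp only [Set.mem_setOf_eq, Set.indicator_of_mem hx, hx, iff_true]
      exact (interior_subset hx : x ∈ {x | 0 < f x})
    · simp [Set.indicator_of_notMem hx, hx]
  · have h0 : volume (frontier {x | 0 < f x}) = 0 := hc.addHaar_frontier volume
    have h1 : ∀ᵐ x ∂(volume : Measure (EE n)), x ∉ frontier {x | 0 < f x} := measure_eq_zero_iff_ae_notMem.1 h0
    filter_upwards [h1] with x hx
    by_cases hxU : x ∈ U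
    · rw [Set.indicator_of_mem hxU]
    · rw [Set.indicator_of_notMem hxU]
      by_contra h
      apply hx
      refine ⟨subset_closure ?_, hxU⟩
      exact lt_of_le_of_ne (hf.1 x) h

lemma exists_big {f f' : EE n → ℝ} (he : f' =ᵐ[volume] f)
    (h1 : 1 ≤ essSup (fun x => ENNReal.ofReal (f x)) volume) : ∃ z, 1/2 ≤ f' z := by
  by_contra! h
  have h2 : essSup (fun x => ENNReal.ofReal (f x)) volume ≤ ENNReal.ofReal (1/2) := by
    refine essSup_le_of_ae_le _ ?_
    filter_upwards [he] with x hx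
    rw [← hx]
    exact ENNReal.ofReal_le_ofReal (h x).le
  have h3 := h1.trans h2
  rw [ENNReal.one_le_ofReal] at h3
  norm_num at h3

lemma sqrt_posn {f : EE n → ℝ} (hn : 1 ≤ n) (hf : IsLogConcave f) (hm : Measurable f) (ho : IsOpen {x | 0 < f x})
    (h1 : ∫⁻ x, ENNReal.ofReal (f x) = 1) {z : EE n} (hz : 1/2 ≤ f z) :
    (∫⁻ x, ENNReal.ofReal (√(f x))) ≠ 0 ∧ (∫⁻ x, ENNReal.ofReal (√(f x))) ≠ ⊤ ∧
    ∃ (T : EE n ≃L[ℝ] EE n) (m : EE n), MeasurePreserving T volume volume ∧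
      ENNReal.ofReal ((2^14 : ℝ)⁻¹ ^ n) * ∫⁻ x, ENNReal.ofReal (√(f x)) ≤
        ∫⁻ x in {x | ‖T x - m‖ ^ 2 ≤ 2 ^ 25 * n}, ENNReal.ofReal (√(f x)) := by
  set I := ∫⁻ x, ENNReal.ofReal (√(f x)) with hI
  have hs := sqrt_int hf z
  rw [h1, mul_one, ← hI] at hs
  have hzp : 0 < f z := by linarith
  have hI0 : I ≠ 0 := by
    intro h
    rw [hI, lintegral_eq_zero_iff (by fun_prop)] at h
    have : ∫⁻ x, ENNReal.ofReal (f x) = 0 := by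
      rw [lintegral_eq_zero_iff (by fun_prop)]
      filter_upwards [h] with x hx
      have hx' : √(f x) ≤ 0 := by simpa using hx
      have : f x ≤ 0 := Real.sqrt_eq_zero'.1 (le_antisymm hx' (Real.sqrt_nonneg _))
      simpa using this
    simp [this] at h1
  have hIt : I ≠ ⊤ := by
    intro h
    rw [h, ENNReal.mul_top (by simpa using hzp)] at hs
    exact absurd hs (by simp)
  refine ⟨hI0, hIt, ?_⟩
  set J := I.toReal with hJ
  have hJp : 0 < J := ENNReal.toReal_pos hI0 hIt
  have hJI : ENNReal.ofReal J = I := ENNReal.ofReal_toReal hIt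
  set F : EE n → ℝ := fun x => J⁻¹ * √(f x) with hFd
  have hFof : ∀ x, ENNReal.ofReal (F x) = ENNReal.ofReal J⁻¹ * ENNReal.ofReal (√(f x)) := fun x =>
    ENNReal.ofReal_mul (by positivity)
  have hFm : Measurable F := by fun_prop
  have hFo : IsOpen {x | 0 < F x} := by
    convert ho using 3 with x
    simp [hFd, hJp]
  have hcan : ENNReal.ofReal J⁻¹ * I = 1 := by
    rw [← hJI, ← ENNReal.ofReal_mul (by positivity), inv_mul_cancel₀ hJp.ne', ENNReal.ofReal_one]
  have hF1 : ∫⁻ x, ENNReal.ofReal (F x) = 1 := by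
    simp only [hFof]
    rw [lintegral_const_mul _ (by fun_prop), ← hI, hcan]
  have hsJ : √(f z) * J ≤ 2 ^ n := by
    rw [← hJI, ← ENNReal.ofReal_mul (by positivity)] at hs
    have : (2:ENNReal) ^ n = ENNReal.ofReal (2 ^ n) := by
      rw [ENNReal.ofReal_pow (by norm_num)]; norm_num
    rw [this] at hs
    exact (ENNReal.ofReal_le_ofReal_iff (by positivity)).1 hs
  have hFz : ((4:ℝ)^n)⁻¹ ≤ F z := by
    have hsq : √(f z) * √(f z) = f z := Real.mul_self_sqrt hzp.le
    have hsp : 0 < √(f z) := Real.sqrt_pos.2 hzp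
    have h4 : (4:ℝ)^n = 2^n * 2^n := by rw [← mul_pow]; norm_num
    have h2n : (2:ℝ) ≤ 2 ^ n := by
      calc (2:ℝ) = 2 ^ 1 := by norm_num
        _ ≤ 2 ^ n := pow_le_pow_right₀ (by norm_num) hn
    have : J ≤ 4 ^ n * √(f z) := by
      refine le_of_mul_le_mul_left ?_ hsp
      nlinarith
    show _ ≤ J⁻¹ * √(f z)
    rw [inv_mul_eq_div, inv_eq_one_div, div_le_div_iff₀ (by positivity) hJp]
    linarith
  obtain ⟨T, m, hT, hm'⟩ := gen_Mpos hn (lc_const_mul (lc_sqrt hf) (inv_pos.2 hJp)) hFm hFo hF1 hFz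
  refine ⟨T, m, hT, ?_⟩
  have hset : MeasurableSet {x | ‖T x - m‖ ^ 2 ≤ 2 ^ 25 * (n:ℝ)} := by
    have : Continuous T := T.continuous
    exact measurableSet_le (by fun_prop) measurable_const
  rw [dm, withDensity_apply _ hset] at hm'
  have e : ∀ x, ENNReal.ofReal (J⁻¹ * √(f x)) = ENNReal.ofReal J⁻¹ * ENNReal.ofReal (√(f x)) := hFof
  simp only [e] at hm'
  rw [lintegral_const_mul _ (by fun_prop)] at hm'
  calc _ ≤ (ENNReal.ofReal J⁻¹ * ∫⁻ x in {x | ‖T x - m‖ ^ 2 ≤ 2 ^ 25 * n}, ENNReal.ofReal (√(f x))) * I := mul_le_mul' hm' le_rfl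
    _ = (ENNReal.ofReal J⁻¹ * I) * ∫⁻ x in {x | ‖T x - m‖ ^ 2 ≤ 2 ^ 25 * n}, ENNReal.ofReal (√(f x)) := by ring
    _ = _ := by rw [hcan, one_mul]

/-- Everything pushed forward by the positioning map. -/
lemma good_pos {f : EE n → ℝ} (hn : 1 ≤ n) (hf : IsLogConcave f)
    (h1 : ∫⁻ x, ENNReal.ofReal (f x) = 1) (hes : 1 ≤ essSup (fun x => ENNReal.ofReal (f x)) volume) :
    ∃ (T : EE n ≃L[ℝ] EE n) (f₁ : EE n → ℝ) (m : EE n), MeasurePreserving T volume volume ∧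
      IsLogConcave f₁ ∧ Measurable f₁ ∧ ∫⁻ x, ENNReal.ofReal (f₁ x) = 1 ∧
      (volume.withDensity (fun x => ENNReal.ofReal (f x))).map T = volume.withDensity (fun x => ENNReal.ofReal (f₁ x)) ∧
      (∫⁻ x, ENNReal.ofReal (√(f₁ x))) ≠ 0 ∧ (∫⁻ x, ENNReal.ofReal (√(f₁ x))) ≠ ⊤ ∧
      ENNReal.ofReal ((2^14 : ℝ)⁻¹ ^ n) * ∫⁻ x, ENNReal.ofReal (√(f₁ x)) ≤
        ∫⁻ x in {x | ‖x - m‖ ^ 2 ≤ 2 ^ 25 * n}, ENNReal.ofReal (√(f₁ x)) := by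
  obtain ⟨f', hf', hm', ho', he⟩ := lc_rep hf
  obtain ⟨z, hz⟩ := exists_big he hes
  have he2 : (fun x => ENNReal.ofReal (f x)) =ᵐ[volume] fun x => ENNReal.ofReal (f' x) := by
    filter_upwards [he] with x hx
    rw [hx]
  have h1' : ∫⁻ x, ENNReal.ofReal (f' x) = 1 := by rw [← h1]; exact (lintegral_congr_ae he2).symm
  obtain ⟨h0, ht, T, m, hT, hk⟩ := sqrt_posn hn hf' hm' ho' h1' hz
  have hTc : Continuous T := T.continuous
  have hTs : Continuous T.symm := T.symm.continuous
  have hemb : MeasurableEmbedding T := T.toHomeomorph.measurableEmbedding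
  have hI : ∀ g : EE n → ENNReal, ∫⁻ x, g (T.symm x) = ∫⁻ x, g x := by
    intro g
    rw [← hT.lintegral_comp_emb hemb]
    simp
  refine ⟨T, fun x => f' (T.symm x), m, hT, lc_comp hf' (fun x y t => by simp), hm'.comp hTs.measurable, ?_, ?_, ?_, ?_, ?_⟩
  · rw [hI (fun x => ENNReal.ofReal (f' x)), h1']
  · rw [withDensity_congr_ae he2]
    ext s hs
    rw [Measure.map_apply hTc.measurable hs, withDensity_apply _ hs, withDensity_apply _ (hTc.measurable hs),
      ← hT.setLIntegral_comp_preimage_emb hemb (fun x => ENNReal.ofReal (f' (T.symm x))) s]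
    simp
  · rwa [hI (fun x => ENNReal.ofReal (√(f' x)))]
  · rwa [hI (fun x => ENNReal.ofReal (√(f' x)))]
  · rw [hI (fun x => ENNReal.ofReal (√(f' x))), ← hT.setLIntegral_comp_preimage_emb hemb]
    simpa using hk
end H1

section H2
variable {n : ℕ}

lemma vol_ball_le (m : EE n) : volume {x : EE n | ‖x - m‖ ^ 2 ≤ 2 ^ 27 * n} ≤ ENNReal.ofReal (2 ^ (17 * n)) := by
  set b : ℝ := (2^27)⁻¹ with hb
  have hbp : 0 < b := by positivity
  have hi : ∫ v : EE n, rexp (-b * ‖v‖ ^ 2) = (π / b) ^ (Module.finrank ℝ (EE n) / 2 : ℝ) :=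
    GaussianFourier.integral_rexp_neg_mul_sq_norm hbp
  have hintg : Integrable (fun v : EE n => rexp (-b * ‖v‖ ^ 2)) := by
    by_contra h
    rw [integral_undef h] at hi
    have : 0 < (π / b) ^ (Module.finrank ℝ (EE n) / 2 : ℝ) := Real.rpow_pos_of_pos (by positivity) _
    linarith
  have hval : (π / b) ^ (Module.finrank ℝ (EE n) / 2 : ℝ) ≤ 2 ^ (15 * n) := by
    rw [finrank_euclideanSpace_fin]
    have h1 : π / b ≤ 2 ^ (30:ℕ) := by
      rw [hb, div_inv_eq_mul]
      have := Real.pi_lt_four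
      norm_num; linarith
    calc (π / b) ^ ((n:ℝ) / 2) ≤ ((2:ℝ) ^ (30:ℕ)) ^ ((n:ℝ) / 2) := Real.rpow_le_rpow (by positivity) h1 (by positivity)
      _ = 2 ^ (15 * n) := by
        rw [← Real.rpow_natCast, ← Real.rpow_mul (by norm_num), ← Real.rpow_natCast]
        congr 1; push_cast; ring
  have hexp : rexp n ≤ 2 ^ (2 * n) := by
    have : rexp (n:ℝ) = (rexp 1) ^ n := by rw [← Real.exp_nat_mul]; simp
    rw [this, pow_mul]
    refine pow_le_pow_left₀ (by positivity) ?_ _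
    have := Real.exp_one_lt_d9
    linarith
  have hms : MeasurableSet {x : EE n | ‖x - m‖ ^ 2 ≤ 2 ^ 27 * n} := measurableSet_le (by fun_prop) measurable_const
  calc volume {x : EE n | ‖x - m‖ ^ 2 ≤ 2 ^ 27 * n} = ∫⁻ x in {x : EE n | ‖x - m‖ ^ 2 ≤ 2 ^ 27 * n}, 1 := by simp
    _ ≤ ∫⁻ x in {x : EE n | ‖x - m‖ ^ 2 ≤ 2 ^ 27 * n}, ENNReal.ofReal (rexp n) * ENNReal.ofReal (rexp (-b * ‖x - m‖ ^ 2)) := by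
        refine setLIntegral_mono' hms fun x hx => ?_
        rw [← ENNReal.ofReal_mul (by positivity), ← Real.exp_add, ENNReal.one_le_ofReal, Real.one_le_exp_iff]
        have : b * ‖x - m‖ ^ 2 ≤ b * (2 ^ 27 * n) := mul_le_mul_of_nonneg_left hx hbp.le
        have e : b * (2 ^ 27 * n) = n := by rw [hb]; field_simp
        linarith
    _ ≤ ∫⁻ x : EE n, ENNReal.ofReal (rexp n) * ENNReal.ofReal (rexp (-b * ‖x - m‖ ^ 2)) := setLIntegral_le_lintegral _ _
    _ = ENNReal.ofReal (rexp n) * ∫⁻ x : EE n, ENNReal.ofReal (rexp (-b * ‖x - m‖ ^ 2)) := by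
        rw [lintegral_const_mul _ (by fun_prop)]
    _ = ENNReal.ofReal (rexp n) * ∫⁻ x : EE n, ENNReal.ofReal (rexp (-b * ‖x‖ ^ 2)) := by
        rw [lintegral_sub_right_eq_self (fun x : EE n => ENNReal.ofReal (rexp (-b * ‖x‖ ^ 2))) m]
    _ = ENNReal.ofReal (rexp n * (π / b) ^ (Module.finrank ℝ (EE n) / 2 : ℝ)) := by
        rw [← ofReal_integral_eq_lintegral_ofReal hintg (Filter.Eventually.of_forall fun x => by positivity), hi,
          ENNReal.ofReal_mul (by positivity)]
    _ ≤ _ := by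
        refine ENNReal.ofReal_le_ofReal ?_
        calc _ ≤ (2:ℝ) ^ (2 * n) * 2 ^ (15 * n) := by
              refine mul_le_mul hexp hval ?_ (by positivity)
              exact Real.rpow_nonneg (by positivity) _
          _ = _ := by rw [← pow_add]; congr 1; ring

/-- If both functions have mass on balls, their convolution is large somewhere. -/
lemma conv_big (hn : 1 ≤ n) {φ ψ : EE n → ENNReal} (hφ : Measurable φ) (hψ : Measurable ψ) {m₁ m₂ : EE n}
    (hφ0 : ∫⁻ x, φ x ≠ 0) (hφt : ∫⁻ x, φ x ≠ ⊤) (hψ0 : ∫⁻ x, ψ x ≠ 0) (hψt : ∫⁻ x, ψ x ≠ ⊤)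
    (h1 : ENNReal.ofReal ((2^14 : ℝ)⁻¹ ^ n) * ∫⁻ x, φ x ≤ ∫⁻ x in {x | ‖x - m₁‖ ^ 2 ≤ 2 ^ 25 * n}, φ x)
    (h2 : ENNReal.ofReal ((2^14 : ℝ)⁻¹ ^ n) * ∫⁻ x, ψ x ≤ ∫⁻ x in {x | ‖x - m₂‖ ^ 2 ≤ 2 ^ 25 * n}, ψ x) :
    ∃ z, ENNReal.ofReal ((2^46 : ℝ)⁻¹ ^ n) * ((∫⁻ x, φ x) * ∫⁻ x, ψ x) ≤ ∫⁻ y, φ y * ψ (-y + z) := by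
  by_contra! h
  set A := ∫⁻ x, φ x
  set B := ∫⁻ x, ψ x
  set c := ENNReal.ofReal ((2^14 : ℝ)⁻¹ ^ n) with hc
  set κ := ENNReal.ofReal ((2^46 : ℝ)⁻¹ ^ n) with hκ
  set S₁ := {x : EE n | ‖x - m₁‖ ^ 2 ≤ 2 ^ 25 * (n:ℝ)} with hS₁
  set S₂ := {x : EE n | ‖x - m₂‖ ^ 2 ≤ 2 ^ 25 * (n:ℝ)} with hS₂
  set D := {x : EE n | ‖x - (m₁ + m₂)‖ ^ 2 ≤ 2 ^ 27 * (n:ℝ)} with hD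
  have hS₁m : MeasurableSet S₁ := measurableSet_le (by fun_prop) measurable_const
  have hS₂m : MeasurableSet S₂ := measurableSet_le (by fun_prop) measurable_const
  have hDm : MeasurableSet D := measurableSet_le (by fun_prop) measurable_const
  set φ' := S₁.indicator φ with hφ'
  set ψ' := S₂.indicator ψ with hψ'
  have hφm : Measurable φ' := hφ.indicator hS₁m
  have hψm : Measurable ψ' := hψ.indicator hS₂m
  have hsub : ∀ y z, φ' y * ψ' (-y + z) ≤ D.indicator (fun z => φ y * ψ (-y + z)) z := by
    intro y z
    by_cases hy : y ∈ S₁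
    · by_cases hz : -y + z ∈ S₂
      · have : z ∈ D := by
          have hy' : ‖y - m₁‖ ^ 2 ≤ 2 ^ 25 * (n:ℝ) := hy
          have hz' : ‖-y + z - m₂‖ ^ 2 ≤ 2 ^ 25 * (n:ℝ) := hz
          show ‖z - (m₁ + m₂)‖ ^ 2 ≤ 2 ^ 27 * (n:ℝ)
          have e : z - (m₁ + m₂) = (y - m₁) + (-y + z - m₂) := by abel
          have h3 : ‖z - (m₁ + m₂)‖ ≤ ‖y - m₁‖ + ‖-y + z - m₂‖ := by rw [e]; exact norm_add_le _ _
          have h4 := norm_nonneg (z - (m₁ + m₂))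
          have h5 : ‖z - (m₁ + m₂)‖ ^ 2 ≤ (‖y - m₁‖ + ‖-y + z - m₂‖) ^ 2 := pow_le_pow_left₀ h4 h3 2
          nlinarith [sq_nonneg (‖y - m₁‖ - ‖-y + z - m₂‖)]
        rw [hφ', hψ', Set.indicator_of_mem hy, Set.indicator_of_mem hz, Set.indicator_of_mem this]
      · rw [hψ', Set.indicator_of_notMem hz, mul_zero]; exact zero_le
    · rw [hφ', Set.indicator_of_notMem hy, zero_mul]; exact zero_le
  have hmass : c * A * (c * B) ≤ ∫⁻ z in D, ∫⁻ y, φ y * ψ (-y + z) := by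
    calc c * A * (c * B) ≤ (∫⁻ x, φ' x) * ∫⁻ x, ψ' x := by
          rw [hφ', hψ', lintegral_indicator hS₁m, lintegral_indicator hS₂m]
          exact mul_le_mul' h1 h2
      _ = ∫⁻ y, ∫⁻ z, φ' y * ψ' (-y + z) := by
          rw [← lintegral_mul_const _ hφm]
          refine lintegral_congr fun y => ?_
          rw [lintegral_const_mul _ (by fun_prop), lintegral_add_left_eq_self ψ' (-y)]
      _ = ∫⁻ z, ∫⁻ y, φ' y * ψ' (-y + z) := by
          rw [lintegral_lintegral_swap]
          exact Measurable.aemeasurable (by fun_prop)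
      _ ≤ ∫⁻ z, D.indicator (fun z => ∫⁻ y, φ y * ψ (-y + z)) z := by
          refine lintegral_mono fun z => ?_
          refine (lintegral_mono fun y => hsub y z).trans (le_of_eq ?_)
          by_cases hz : z ∈ D
          · simp only [Set.indicator_of_mem hz]
          · simp only [Set.indicator_of_notMem hz, lintegral_zero]
      _ = _ := lintegral_indicator hDm _
  have hup : ∫⁻ z in D, ∫⁻ y, φ y * ψ (-y + z) ≤ κ * (A * B) * ENNReal.ofReal (2 ^ (17 * n)) := by
    calc _ ≤ ∫⁻ z in D, κ * (A * B) := lintegral_mono fun z => (h z).le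
      _ = κ * (A * B) * volume D := by simp
      _ ≤ _ := mul_le_mul' le_rfl (vol_ball_le _)
  have hAB0 : A * B ≠ 0 := mul_ne_zero hφ0 hψ0
  have hABt : A * B ≠ ⊤ := ENNReal.mul_ne_top hφt hψt
  have h3 : (A * B) * (c * c) ≤ (A * B) * (κ * ENNReal.ofReal (2 ^ (17 * n))) := by
    calc _ = c * A * (c * B) := by ring
      _ ≤ _ := hmass.trans hup
      _ = _ := by ring
  rw [ENNReal.mul_le_mul_iff_right hAB0 hABt, hc, hκ, ← ENNReal.ofReal_mul (by positivity), ← ENNReal.ofReal_mul (by positivity),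
    ENNReal.ofReal_le_ofReal_iff (by positivity)] at h3
  rw [pow_mul, ← mul_pow, ← mul_pow] at h3
  have h4 : ((2^46 : ℝ)⁻¹ * 2 ^ 17) ^ n < ((2^14 : ℝ)⁻¹ * (2^14 : ℝ)⁻¹) ^ n :=
    pow_lt_pow_left₀ (by norm_num) (by positivity) (by omega)
  linarith
end H2

section H3
variable {n : ℕ}

lemma mid_enn {f : EE n → ℝ} (hf : IsLogConcave f) (x y : EE n) :
    ENNReal.ofReal (√(f x)) * ENNReal.ofReal (√(f y)) ≤ ENNReal.ofReal (f ((1/2:ℝ)•(x+y))) := by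
  rw [← ENNReal.ofReal_mul (Real.sqrt_nonneg _), ← Real.sqrt_mul (hf.1 x)]
  exact ENNReal.ofReal_le_ofReal (Real.sqrt_le_iff.2 ⟨hf.1 _, lc_mid hf x y⟩)

lemma sqrt_sq_enn {f : EE n → ℝ} (hf : IsLogConcave f) (x : EE n) :
    ENNReal.ofReal (f x) = ENNReal.ofReal (√(f x)) * ENNReal.ofReal (√(f x)) := by
  rw [← ENNReal.ofReal_mul (Real.sqrt_nonneg _), Real.mul_self_sqrt (hf.1 x)]

lemma lint_half (g : EE n → ENNReal) : ∫⁻ x, g ((1/2:ℝ) • x) = 2 ^ n * ∫⁻ x, g x := by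
  rw [lint_smul g (by norm_num : (0:ℝ) < 1/2)]
  congr 1
  rw [← inv_pow, ENNReal.ofReal_pow (by norm_num)]
  norm_num

lemma conv_claim {f g : EE n → ℝ} (hf : IsLogConcave f) (hg : IsLogConcave g) (hfm : Measurable f) (hgm : Measurable g)
    (z w : EE n) :
    (∫⁻ y, ENNReal.ofReal (√(f y)) * ENNReal.ofReal (√(g (-y + z)))) *
      ∫⁻ x, ENNReal.ofReal (f x) * ENNReal.ofReal (g (-x + ((2:ℝ) • w - z))) ≤
    2 ^ n * (∫⁻ y, ENNReal.ofReal (f y) * ENNReal.ofReal (g (-y + w))) *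
      ∫⁻ x, ENNReal.ofReal (√(f x)) * ENNReal.ofReal (√(g (-x + ((2:ℝ) • w - z)))) := by
  set v := (2:ℝ) • w - z with hv
  set q := ∫⁻ y, ENNReal.ofReal (√(f y)) * ENNReal.ofReal (√(g (-y + z))) with hq
  set p := ∫⁻ y, ENNReal.ofReal (f y) * ENNReal.ofReal (g (-y + w)) with hp
  have key : ∀ x, q * (ENNReal.ofReal (√(f x)) * ENNReal.ofReal (√(g (-x + v)))) ≤ 2 ^ n * p := by
    intro x
    rw [hq, ← lintegral_mul_const _ (by fun_prop)]
    calc _ ≤ ∫⁻ y, ENNReal.ofReal (f ((1/2:ℝ) • (y + x))) * ENNReal.ofReal (g (-((1/2:ℝ) • (y + x)) + w)) := by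
          refine lintegral_mono fun y => ?_
          have h1 := mid_enn hf y x
          have h2 := mid_enn hg (-y + z) (-x + v)
          have e : (1/2:ℝ) • (-y + z + (-x + v)) = -((1/2:ℝ) • (y + x)) + w := by
            rw [hv]; module
          rw [e] at h2
          calc _ = (ENNReal.ofReal (√(f y)) * ENNReal.ofReal (√(f x))) * (ENNReal.ofReal (√(g (-y + z))) * ENNReal.ofReal (√(g (-x + v)))) := by ring
            _ ≤ _ := mul_le_mul' h1 h2
      _ = ∫⁻ y, ENNReal.ofReal (f ((1/2:ℝ) • y)) * ENNReal.ofReal (g (-((1/2:ℝ) • y) + w)) :=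
          lintegral_add_right_eq_self (fun y => ENNReal.ofReal (f ((1/2:ℝ) • y)) * ENNReal.ofReal (g (-((1/2:ℝ) • y) + w))) x
      _ = 2 ^ n * p := lint_half (fun y => ENNReal.ofReal (f y) * ENNReal.ofReal (g (-y + w)))
      _ ≤ _ := le_rfl
  rw [← lintegral_const_mul _ (by fun_prop), ← lintegral_const_mul _ (by fun_prop)]
  refine lintegral_mono fun x => ?_
  calc _ = (q * (ENNReal.ofReal (√(f x)) * ENNReal.ofReal (√(g (-x + v))))) * (ENNReal.ofReal (√(f x)) * ENNReal.ofReal (√(g (-x + v)))) := by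
        simp only [sqrt_sq_enn hf x, sqrt_sq_enn hg (-x + v)]; ring
    _ ≤ _ := mul_le_mul' (key x) le_rfl

lemma conv_total {φ ψ : EE n → ENNReal} (hφ : Measurable φ) (hψ : Measurable ψ) :
    ∫⁻ z, ∫⁻ y, φ y * ψ (-y + z) = (∫⁻ x, φ x) * ∫⁻ x, ψ x := by
  rw [lintegral_lintegral_swap (Measurable.aemeasurable (by fun_prop)), ← lintegral_mul_const _ hφ]
  refine lintegral_congr fun y => ?_
  rw [lintegral_const_mul _ (by fun_prop), lintegral_add_left_eq_self ψ (-y)]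

lemma sqrt_mul_le_add (a b : ENNReal) : (a * b) ^ (1/2 : ℝ) ≤ a + b := by
  have h : a * b ≤ (a + b) ^ (2:ℝ) := by
    rw [ENNReal.rpow_two, pow_two]
    exact mul_le_mul' (self_le_add_right _ _) (self_le_add_left _ _)
  calc _ ≤ ((a + b) ^ (2:ℝ)) ^ (1/2 : ℝ) := ENNReal.rpow_le_rpow h (by norm_num)
    _ = a + b := by rw [← ENNReal.rpow_mul]; norm_num

lemma sqrt_conv_le (hn : 1 ≤ n) {f g : EE n → ℝ} (hf : IsLogConcave f) (hg : IsLogConcave g) (hfm : Measurable f) (hgm : Measurable g)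
    (hf1 : ∫⁻ x, ENNReal.ofReal (f x) = 1) (hg1 : ∫⁻ x, ENNReal.ofReal (g x) = 1)
    (hφ0 : ∫⁻ x, ENNReal.ofReal (√(f x)) ≠ 0) (hφt : ∫⁻ x, ENNReal.ofReal (√(f x)) ≠ ⊤)
    (hψ0 : ∫⁻ x, ENNReal.ofReal (√(g x)) ≠ 0) (hψt : ∫⁻ x, ENNReal.ofReal (√(g x)) ≠ ⊤) {z : EE n}
    (hz : ENNReal.ofReal ((2^46 : ℝ)⁻¹ ^ n) * ((∫⁻ x, ENNReal.ofReal (√(f x))) * ∫⁻ x, ENNReal.ofReal (√(g x))) ≤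
      ∫⁻ y, ENNReal.ofReal (√(f y)) * ENNReal.ofReal (√(g (-y + z)))) :
    ∫⁻ w, (∫⁻ y, ENNReal.ofReal (f y) * ENNReal.ofReal (g (-y + w))) ^ (1/2:ℝ) ≤ ENNReal.ofReal ((2 ^ 48) ^ n) := by
  set p : EE n → ENNReal := fun w => ∫⁻ y, ENNReal.ofReal (f y) * ENNReal.ofReal (g (-y + w)) with hp
  set q : EE n → ENNReal := fun w => ∫⁻ y, ENNReal.ofReal (√(f y)) * ENNReal.ofReal (√(g (-y + w))) with hq
  set A := ∫⁻ x, ENNReal.ofReal (√(f x)) with hA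
  set B := ∫⁻ x, ENNReal.ofReal (√(g x)) with hB
  have hpm : Measurable p := by
    rw [hp]; exact Measurable.lintegral_prod_right' (f := fun a : EE n × EE n => ENNReal.ofReal (f a.2) * ENNReal.ofReal (g (-a.2 + a.1))) (by fun_prop)
  have hqm : Measurable q := by
    rw [hq]; exact Measurable.lintegral_prod_right' (f := fun a : EE n × EE n => ENNReal.ofReal (√(f a.2)) * ENNReal.ofReal (√(g (-a.2 + a.1)))) (by fun_prop)
  have hptot : ∫⁻ w, p w = 1 := by
    have := conv_total (φ := fun x => ENNReal.ofReal (f x)) (ψ := fun x => ENNReal.ofReal (g x)) (by fun_prop) (by fun_prop)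
    rw [hf1, hg1, one_mul] at this
    exact this
  have hqtot : ∫⁻ w, q w = A * B :=
    conv_total (φ := fun x => ENNReal.ofReal (√(f x))) (ψ := fun x => ENNReal.ofReal (√(g x))) (by fun_prop) (by fun_prop)
  have hAB0 : A * B ≠ 0 := mul_ne_zero hφ0 hψ0
  have hABt : A * B ≠ ⊤ := ENNReal.mul_ne_top hφt hψt
  have hclaim : ∀ w, q z * p ((2:ℝ) • w - z) ≤ 2 ^ n * p w * q ((2:ℝ) • w - z) := fun w => conv_claim hf hg hfm hgm z w
  -- replace q z by κ A B
  set κ := ENNReal.ofReal ((2^46 : ℝ)⁻¹ ^ n) with hκ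
  set κ' := ENNReal.ofReal ((2^46 : ℝ) ^ n) with hκ'
  have hκκ : κ' * κ = 1 := by
    rw [hκ, hκ', ← ENNReal.ofReal_mul (by positivity), ← mul_pow]; norm_num
  have hpt : ∀ w, p ((2:ℝ) • w - z) ^ (1/2:ℝ) ≤ p w + (2 ^ n * κ' * (A * B)⁻¹) * q ((2:ℝ) • w - z) := by
    intro w
    refine le_trans (ENNReal.rpow_le_rpow ?_ (by norm_num)) (sqrt_mul_le_add _ _)
    calc p ((2:ℝ) • w - z) = (κ' * (A * B)⁻¹) * ((κ * (A * B)) * p ((2:ℝ) • w - z)) := by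
          rw [← mul_assoc, show κ' * (A * B)⁻¹ * (κ * (A * B)) = (κ' * κ) * ((A * B) * (A * B)⁻¹) by ring, hκκ,
            ENNReal.mul_inv_cancel hAB0 hABt, one_mul, one_mul]
      _ ≤ (κ' * (A * B)⁻¹) * (2 ^ n * p w * q ((2:ℝ) • w - z)) := by
          refine mul_le_mul' le_rfl ((mul_le_mul' hz le_rfl).trans (hclaim w))
      _ = _ := by ring
  have h2c : ∀ r : EE n → ENNReal, ∫⁻ w, r ((2:ℝ) • w - z) = ENNReal.ofReal ((2 ^ n)⁻¹) * ∫⁻ w, r w := by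
    intro r
    rw [lint_smul (fun w => r (w - z)) (by norm_num : (0:ℝ) < 2), lintegral_sub_right_eq_self r z]
  have h2i : (2:ENNReal) ^ n * ENNReal.ofReal ((2 ^ n)⁻¹) = 1 := by
    have : (2:ENNReal) ^ n = ENNReal.ofReal (2 ^ n) := by
      rw [ENNReal.ofReal_pow (by norm_num)]; norm_num
    rw [this, ← ENNReal.ofReal_mul (by positivity), mul_inv_cancel₀ (by positivity), ENNReal.ofReal_one]
  have hfin : ENNReal.ofReal ((2 ^ n)⁻¹) * ∫⁻ w, p w ^ (1/2:ℝ) ≤ 1 + κ' := by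
    rw [← h2c (fun w => p w ^ (1/2:ℝ))]
    calc _ ≤ ∫⁻ w, (p w + (2 ^ n * κ' * (A * B)⁻¹) * q ((2:ℝ) • w - z)) := lintegral_mono hpt
      _ = 1 + (2 ^ n * κ' * (A * B)⁻¹) * (ENNReal.ofReal ((2 ^ n)⁻¹) * (A * B)) := by
          rw [lintegral_add_left hpm, hptot, lintegral_const_mul _ (by fun_prop), h2c q, hqtot]
      _ = 1 + κ' * (2 ^ n * ENNReal.ofReal ((2 ^ n)⁻¹)) * ((A * B) * (A * B)⁻¹) := by ring
      _ = 1 + κ' := by rw [h2i, ENNReal.mul_inv_cancel hAB0 hABt, mul_one, mul_one]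
  calc ∫⁻ w, p w ^ (1/2:ℝ) = 2 ^ n * (ENNReal.ofReal ((2 ^ n)⁻¹) * ∫⁻ w, p w ^ (1/2:ℝ)) := by
        rw [← mul_assoc, h2i, one_mul]
    _ ≤ 2 ^ n * (1 + κ') := mul_le_mul' le_rfl hfin
    _ = ENNReal.ofReal (2 ^ n * (1 + (2^46) ^ n)) := by
        rw [ENNReal.ofReal_mul (by positivity), ENNReal.ofReal_add (by positivity) (by positivity), ENNReal.ofReal_pow (by norm_num)]
        simp [hκ']
    _ ≤ _ := by
        refine ENNReal.ofReal_le_ofReal ?_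
        have h1 : (1:ℝ) ≤ (2^46) ^ n := one_le_pow₀ (by norm_num)
        have h2 : (2:ℝ) ≤ 2 ^ n := by
          calc (2:ℝ) = 2 ^ 1 := by norm_num
            _ ≤ 2 ^ n := pow_le_pow_right₀ (by norm_num) hn
        calc (2:ℝ) ^ n * (1 + (2^46) ^ n) ≤ 2 ^ n * (2 ^ n * (2 ^ 46) ^ n) := by
              refine mul_le_mul_of_nonneg_left ?_ (by positivity)
              nlinarith
          _ = (2 ^ 48) ^ n := by rw [← mul_pow, ← mul_pow]; norm_num

lemma dEnt_le {p : EE n → ENNReal} (hpm : Measurable p) (hp1 : ∫⁻ x, p x = 1) {Q : ℝ} (hQ : 1 ≤ Q)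
    (hs : ∫⁻ x, p x ^ (1/2:ℝ) ≤ ENNReal.ofReal Q) : dEnt (volume.withDensity p) ≤ 2 * Real.log Q := by
  have hQ0 : 0 < Q := by linarith
  have hlQ : 0 ≤ Real.log Q := Real.log_nonneg hQ
  have hrn : (volume.withDensity p).rnDeriv volume =ᵐ[volume] p := Measure.rnDeriv_withDensity _ hpm
  have he : dEnt (volume.withDensity p) = ∫ x, -((p x).toReal * Real.log (p x).toReal) := by
    rw [dEnt, integral_neg]
    congr 1
    refine integral_congr_ae ?_
    filter_upwards [hrn] with x hx
    rw [hx]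
  rw [he]
  by_cases hi : Integrable (fun x => -((p x).toReal * Real.log (p x).toReal))
  swap
  · rw [integral_undef hi]; positivity
  set r : EE n → ℝ := fun x => (p x).toReal with hr
  have hr0 : ∀ x, 0 ≤ r x := fun x => ENNReal.toReal_nonneg
  have hri : Integrable r := integrable_toReal_of_lintegral_ne_top hpm.aemeasurable (by rw [hp1]; simp)
  have hrI : ∫ x, r x = 1 := by
    rw [hr, integral_toReal hpm.aemeasurable, hp1, ENNReal.toReal_one]
    exact ae_lt_top hpm (by rw [hp1]; simp)
  have hsq : ∀ x, √(r x) = (p x ^ (1/2:ℝ)).toReal := fun x => by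
    rw [Real.sqrt_eq_rpow, ← ENNReal.toReal_rpow]
  have hst : ∫⁻ x, p x ^ (1/2:ℝ) ≠ ⊤ := ne_top_of_le_ne_top ENNReal.ofReal_ne_top hs
  have hsi : Integrable (fun x => √(r x)) := by
    simp only [hsq]
    exact integrable_toReal_of_lintegral_ne_top (by fun_prop) hst
  have hsI : ∫ x, √(r x) ≤ Q := by
    simp only [hsq]
    rw [integral_toReal (by fun_prop) (ae_lt_top (by fun_prop) hst)]
    exact ENNReal.toReal_le_of_le_ofReal hQ0.le hs
  have hpt : ∀ x, -(r x * Real.log (r x)) ≤ 2 * (Real.log Q - 1) * r x + 2 / Q * √(r x) := by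
    intro x
    rcases (hr0 x).eq_or_lt with h | h
    · rw [← h]; simp
    · have hsp : 0 < √(r x) := Real.sqrt_pos.2 h
      have h1 : Real.log ((√(r x) * Q)⁻¹) ≤ (√(r x) * Q)⁻¹ - 1 := Real.log_le_sub_one_of_pos (by positivity)
      rw [Real.log_inv, Real.log_mul hsp.ne' hQ0.ne', Real.log_sqrt h.le] at h1
      have h2 := mul_le_mul_of_nonneg_left h1 h.le
      have h3 : r x * (√(r x) * Q)⁻¹ = √(r x) / Q := by
        nth_rw 1 [← Real.mul_self_sqrt h.le]
        field_simp
      have h4 : 2 / Q * √(r x) = 2 * (√(r x) / Q) := by ring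
      rw [h4, ← h3]
      nlinarith
  calc _ ≤ ∫ x, (2 * (Real.log Q - 1) * r x + 2 / Q * √(r x)) :=
        integral_mono hi ((hri.const_mul _).add (hsi.const_mul _)) hpt
    _ = 2 * (Real.log Q - 1) + 2 / Q * ∫ x, √(r x) := by
        rw [integral_add (hri.const_mul _) (hsi.const_mul _), integral_const_mul, integral_const_mul, hrI, mul_one]
    _ ≤ 2 * (Real.log Q - 1) + 2 / Q * Q := by gcongr
    _ = 2 * Real.log Q := by field_simp; ring
end H3

theorem normalized_reverse_entropy_power_inequality :
    ∃ C : ℝ, 0 < C ∧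
    ∀ (n : ℕ), 1 ≤ n →
    ∀ (Ω : Type) [MeasureSpace Ω], IsProbabilityMeasure (ℙ : Measure Ω) →
    ∀ (X Y : Ω → EuclideanSpace ℝ (Fin n))
      (f g : EuclideanSpace ℝ (Fin n) → ℝ),
      Measurable X → Measurable Y →
      IsLogConcave f → IsLogConcave g →
      Measure.map X (ℙ : Measure Ω)
        = volume.withDensity (fun x => ENNReal.ofReal (f x)) →
      Measure.map Y (ℙ : Measure Ω)
        = volume.withDensity (fun x => ENNReal.ofReal (g x)) →
      1 ≤ essSup (fun x => ENNReal.ofReal (f x)) volume →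
      1 ≤ essSup (fun x => ENNReal.ofReal (g x)) volume →
      ProbabilityTheory.IndepFun X Y (ℙ : Measure Ω) →
      ∃ (u₁ u₂ : EuclideanSpace ℝ (Fin n) →ᵃ[ℝ] EuclideanSpace ℝ (Fin n)),
        MeasurePreserving u₁ volume volume ∧
        MeasurePreserving u₂ volume volume ∧
        entPow (Measure.map (fun ω => u₁ (X ω) + u₂ (Y ω)) (ℙ : Measure Ω)) ≤ C := by
  refine ⟨rexp (4 * Real.log (2 ^ 48)), Real.exp_pos _, ?_⟩
  intro n hn Ω _ hP X Y f g hX hY hf hg hXf hYg hfe hge hind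
  have tot : ∀ (Z : Ω → EE n) (k : EE n → ℝ), Measurable Z →
      Measure.map Z (ℙ : Measure Ω) = volume.withDensity (fun x => ENNReal.ofReal (k x)) →
      ∫⁻ x, ENNReal.ofReal (k x) = 1 := by
    intro Z k hZ h
    have h1 : Measure.map Z (ℙ : Measure Ω) Set.univ = 1 := by
      rw [Measure.map_apply hZ MeasurableSet.univ]; simp
    rw [h, withDensity_apply _ MeasurableSet.univ, setLIntegral_univ] at h1
    exact h1
  obtain ⟨T₁, f₁, m₁, hT₁, hf₁, hfm, hf1, hfw, hf0, hft, hfb⟩ := good_pos hn hf (tot X f hX hXf) hfe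
  obtain ⟨T₂, g₁, m₂, hT₂, hg₁, hgm, hg1, hgw, hg0, hgt, hgb⟩ := good_pos hn hg (tot Y g hY hYg) hge
  have hc₁ : Continuous T₁ := T₁.continuous
  have hc₂ : Continuous T₂ := T₂.continuous
  refine ⟨T₁.toLinearEquiv.toLinearMap.toAffineMap, T₂.toLinearEquiv.toLinearMap.toAffineMap, hT₁, hT₂, ?_⟩
  obtain ⟨z, hz⟩ := conv_big hn (φ := fun x => ENNReal.ofReal (√(f₁ x))) (ψ := fun x => ENNReal.ofReal (√(g₁ x)))
    (by fun_prop) (by fun_prop) hf0 hft hg0 hgt hfb hgb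
  have hs := sqrt_conv_le hn hf₁ hg₁ hfm hgm hf1 hg1 hf0 hft hg0 hgt hz
  set p : EE n → ENNReal := fun w => ∫⁻ y, ENNReal.ofReal (f₁ y) * ENNReal.ofReal (g₁ (-y + w)) with hp
  have hpm : Measurable p := by
    rw [hp]; exact Measurable.lintegral_prod_right' (f := fun a : EE n × EE n => ENNReal.ofReal (f₁ a.2) * ENNReal.ofReal (g₁ (-a.2 + a.1))) (by fun_prop)
  have hptot : ∫⁻ w, p w = 1 := by
    have := conv_total (φ := fun x => ENNReal.ofReal (f₁ x)) (ψ := fun x => ENNReal.ofReal (g₁ x)) (by fun_prop) (by fun_prop)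
    rw [hf1, hg1, one_mul] at this
    exact this
  have hlaw : Measure.map (fun ω => T₁ (X ω) + T₂ (Y ω)) (ℙ : Measure Ω) = volume.withDensity p := by
    have hi : IndepFun (fun ω => T₁ (X ω)) (fun ω => T₂ (Y ω)) (ℙ : Measure Ω) :=
      hind.comp hc₁.measurable hc₂.measurable
    have h1 := hi.map_add_eq_map_conv_map (hc₁.measurable.comp hX) (hc₂.measurable.comp hY)
    have h2 : Measure.map (T₁ ∘ X) (ℙ : Measure Ω) = volume.withDensity (fun x => ENNReal.ofReal (f₁ x)) := by
      rw [← hfw, ← hXf, Measure.map_map hc₁.measurable hX]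
    have h3 : Measure.map (T₂ ∘ Y) (ℙ : Measure Ω) = volume.withDensity (fun x => ENNReal.ofReal (g₁ x)) := by
      rw [← hgw, ← hYg, Measure.map_map hc₂.measurable hY]
    rw [h2, h3, conv_withDensity_eq_lconvolution (by fun_prop) (by fun_prop)] at h1
    exact h1
  have hQ : (1:ℝ) ≤ (2 ^ 48) ^ n := one_le_pow₀ (by norm_num)
  have hent := dEnt_le hpm hptot hQ hs
  change entPow (Measure.map (fun ω => T₁ (X ω) + T₂ (Y ω)) (ℙ : Measure Ω)) ≤ _
  rw [hlaw, entPow, Real.exp_le_exp]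
  have hn0 : (0:ℝ) < n := by exact_mod_cast hn
  rw [div_le_iff₀ hn0]
  rw [Real.log_pow] at hent
  linarith
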